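/- Let Γ be a piecewise Dini-smooth Jordan curve. Then the Widom factors of Γ converge to 1, i.e. lim_{n→∞} ‖T_n‖_Γ / cap(Γ)^n = 1, where T_n is the n-th Chebyshev polynomial of Γ. -/

import Mathlib

open Filter Topology MeasureTheory Set

noncomputable section

/-- The supremum norm of `f` over the set `Γ`. -/
def supNorm (Γ : Set ℂ) (f : ℂ → ℂ) : ℝ := sSup ((fun z => ‖f z‖) '' Γ)

/-- `Γ` is a Jordan curve: the image of a continuous `2π`-periodic map `ℝ → ℂ` that is
injective modulo the period. -/
def IsJordanCurve (Γ : Set ℂ) : Prop :=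
  ∃ f : ℝ → ℂ, Continuous f ∧ Function.Periodic f (2 * Real.pi) ∧
    (∀ s t : ℝ, f s = f t → ∃ n : ℤ, t - s = n * (2 * Real.pi)) ∧
    Γ = Set.range f

/-- The modulus of continuity of `g` on the interval `[a, b]`, evaluated at `t`. -/
def modCont (g : ℝ → ℂ) (a b t : ℝ) : ℝ :=
  sSup {d : ℝ | ∃ s₁ ∈ Set.Icc a b, ∃ s₂ ∈ Set.Icc a b, |s₁ - s₂| ≤ t ∧ d = ‖g s₁ - g s₂‖}

/-- `γ`, with derivative `γ'`, parametrizes a Dini-smooth Jordan arc on `[a, b]`: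
`γ'` is continuous and nonvanishing on `[a, b]` and its modulus of continuity `ω`
satisfies `∫₀¹ ω(t)/t dt < ∞`. -/
structure IsDiniSmoothArc (γ γ' : ℝ → ℂ) (a b : ℝ) : Prop where
  lt : a < b
  inj : Set.InjOn γ (Set.Icc a b)
  deriv : ∀ s ∈ Set.Icc a b, HasDerivWithinAt γ (γ' s) (Set.Icc a b) s
  cont : ContinuousOn γ' (Set.Icc a b)
  nonzero : ∀ s ∈ Set.Icc a b, γ' s ≠ 0
  dini : MeasureTheory.IntegrableOn (fun t => modCont γ' a b t / t) (Set.Ioc (0 : ℝ) 1)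

/-- A piecewise Dini-smooth Jordan curve: a Jordan curve which is the union of finitely many
Dini-smooth arcs. -/
def IsPiecewiseDiniSmoothJordanCurve (Γ : Set ℂ) : Prop :=
  IsJordanCurve Γ ∧
    ∃ (N : ℕ) (γ γ' : Fin N → ℝ → ℂ) (a b : Fin N → ℝ),
      (∀ i, IsDiniSmoothArc (γ i) (γ' i) (a i) (b i)) ∧
      Γ = ⋃ i, γ i '' Set.Icc (a i) (b i)

/-- The unbounded connected component `Ω` of the complement of `Γ` (in the finite plane). -/
def exteriorDomain (Γ : Set ℂ) : Set ℂ :=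
  {z | z ∈ Γᶜ ∧ ¬ Bornology.IsBounded (connectedComponentIn Γᶜ z)}

/-- `φ` is the canonical exterior conformal map of `Γ` onto `{|w| > 1}` with `φ(∞) = ∞` and
`φ(z)/z → c⁻¹` as `z → ∞`; the constant `c` is then the logarithmic capacity of `Γ`. -/
structure IsExteriorMap (Γ : Set ℂ) (φ : ℂ → ℂ) (c : ℝ) : Prop where
  cpos : 0 < c
  diff : DifferentiableOn ℂ φ (exteriorDomain Γ)
  bij : Set.BijOn φ (exteriorDomain Γ) {w : ℂ | 1 < ‖w‖}
  tendsto : Filter.Tendsto (fun z => φ z / z)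
    (Bornology.cobounded ℂ ⊓ Filter.principal (exteriorDomain Γ)) (nhds ((c : ℂ)⁻¹))

/-- `F` is the `n`-th Faber polynomial of `Γ`: the unique polynomial with
`φ(z)^n − F(z) → 0` as `z → ∞` in the exterior domain. -/
def IsFaberPoly (Γ : Set ℂ) (φ : ℂ → ℂ) (n : ℕ) (F : Polynomial ℂ) : Prop :=
  Filter.Tendsto (fun z => φ z ^ n - F.eval z)
    (Bornology.cobounded ℂ ⊓ Filter.principal (exteriorDomain Γ)) (nhds 0)

/-- `ψ` is the inverse of `φ`, extended to a homeomorphism of `{|w| ≥ 1}` onto the closure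
of the exterior domain; on the unit circle it parametrizes `Γ`. -/
structure IsExteriorParam (Γ : Set ℂ) (φ ψ : ℂ → ℂ) : Prop where
  cont : ContinuousOn ψ {w : ℂ | 1 ≤ ‖w‖}
  inj : Set.InjOn ψ {w : ℂ | 1 ≤ ‖w‖}
  inv : ∀ w : ℂ, 1 < ‖w‖ → ψ w ∈ exteriorDomain Γ ∧ φ (ψ w) = w
  boundary : ∀ w : ℂ, ‖w‖ = 1 → ψ w ∈ Γ
  boundary_surj : ∀ z ∈ Γ, ∃ w : ℂ, ‖w‖ = 1 ∧ ψ w = z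

/-- `T` is the `n`-th Chebyshev polynomial of `Γ`: the monic polynomial of degree `n`
minimizing the supremum norm over `Γ`. -/
def IsChebyshevPoly (Γ : Set ℂ) (n : ℕ) (T : Polynomial ℂ) : Prop :=
  T.Monic ∧ T.natDegree = n ∧
    ∀ P : Polynomial ℂ, P.Monic → P.natDegree = n →
      supNorm Γ (fun z => T.eval z) ≤ supNorm Γ (fun z => P.eval z)

/-- `v` is a secant-argument function of `Γ = ψ(unit circle)` at `θ` (relative to `α` with
`α < θ < α + 2π`): a bounded-variation branch of `t ↦ arg (ψ(e^{it}) − ψ(e^{iθ}))` on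
`[α, α + 2π]`, continuous on `[α, θ)` and on `(θ, α + 2π]`, normalized by `v θ = v(θ+)`
and by requiring the jump `v(θ+) − v(θ−)` to lie in `[0, 2π]`. -/
structure IsSecantArg (ψ : ℂ → ℂ) (θ α : ℝ) (v : ℝ → ℝ) : Prop where
  hα : α < θ
  hθ : θ < α + 2 * Real.pi
  bv : BoundedVariationOn v (Set.Icc α (α + 2 * Real.pi))
  contBefore : ContinuousOn v (Set.Ico α θ)
  contAfter : ContinuousOn v (Set.Ioc θ (α + 2 * Real.pi))
  rightCont : ContinuousWithinAt v (Set.Ici θ) θ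
  jump_mem : ∃ L : ℝ, Filter.Tendsto v (nhdsWithin θ (Set.Iio θ)) (nhds L) ∧
    v θ - L ∈ Set.Icc 0 (2 * Real.pi)
  branch : ∀ t ∈ Set.Icc α (α + 2 * Real.pi), t ≠ θ →
    Complex.exp (Complex.I * (v t : ℂ))
      = (ψ (Complex.exp (Complex.I * (t : ℂ))) - ψ (Complex.exp (Complex.I * (θ : ℂ))))
        / ((‖ψ (Complex.exp (Complex.I * (t : ℂ))) - ψ (Complex.exp (Complex.I * (θ : ℂ)))‖ : ℂ))

/-- The exterior angle of `Γ = ψ(unit circle)` at the boundary point `ψ(e^{iθ})` equals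
`lam * π`, expressed through the jump `v(θ+) − v(θ−) = lam * π` of a secant-argument
function at `θ`. -/
def HasExteriorAngleAt (ψ : ℂ → ℂ) (θ lam : ℝ) : Prop :=
  ∃ (α : ℝ) (v : ℝ → ℝ), IsSecantArg ψ θ α v ∧
    Filter.Tendsto v (nhdsWithin θ (Set.Iio θ)) (nhds (v θ - lam * Real.pi))

/-- The set `Θ_Γ = {θ_k + 2πj}` of corner parameters modulo `2π`. -/
def cornerSet {l : ℕ} (θk : Fin l → ℝ) : Set ℝ :=
  {x | ∃ (k : Fin l) (j : ℤ), x = θk k + j * (2 * Real.pi)}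

/-- `(μp, μn)` realizes the Lebesgue–Stieltjes (signed) measure `dv` of `v` on `(α, β]`:
both are finite measures and `μp − μn` has the increments of `v`. -/
structure IsLSPair (v : ℝ → ℝ) (α β : ℝ) (μp μn : MeasureTheory.Measure ℝ) : Prop where
  finp : MeasureTheory.IsFiniteMeasure μp
  finn : MeasureTheory.IsFiniteMeasure μn
  incr : ∀ s t : ℝ, α ≤ s → s ≤ t → t ≤ β →
    (μp (Set.Ioc s t)).toReal - (μn (Set.Ioc s t)).toReal = v t - v s

namespace Widom

/-- A nonvanishing continuous function on a real normed space has a continuous logarithm. -/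
lemma exists_log_univ {E : Type*} [NormedAddCommGroup E] [NormedSpace ℝ E] {F : E → ℂ}
    (hF : Continuous F) (h0 : ∀ x, F x ≠ 0) :
    ∃ L : E → ℂ, Continuous L ∧ ∀ x, Complex.exp (L x) = F x := by
  have hsc : IsSimplyConnected (univ : Set E) := by
    have := (convex_univ (𝕜 := ℝ) (E := E)).contractibleSpace univ_nonempty
    exact SimplyConnectedSpace.ofContractible (univ : Set E)
  obtain ⟨L, hL, hLF⟩ := Complex.exists_continuousOn_eqOn_exp_comp hsc isOpen_univ
    hF.continuousOn (by rintro ⟨x, -, hx⟩; exact h0 x hx)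
  exact ⟨L, continuousOn_univ.1 hL, fun x => hLF (mem_univ x)⟩

/-- A continuous function on a preconnected set with constant exponential is constant. -/
lemma eq_of_exp_const {X : Type*} [TopologicalSpace X] {s : Set X} (hs : IsPreconnected s)
    {g : X → ℂ} (hg : ContinuousOn g s)
    (he : ∀ x ∈ s, ∀ y ∈ s, Complex.exp (g x) = Complex.exp (g y)) {x y : X}
    (hx : x ∈ s) (hy : y ∈ s) : g x = g y := by
  have : PreconnectedSpace s := Subtype.preconnectedSpace hs
  have := Complex.isCoveringMap_exp.const_of_comp (g := fun x : s => g x)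
    (continuousOn_iff_continuous_domRestrict.1 hg)
    (fun a a' => Subtype.ext (he a a.2 a' a'.2)) ⟨x, hx⟩ ⟨y, hy⟩
  exact this

/-- The identity has no continuous logarithm on a circle. -/
lemma no_log_sphere {L : ℂ → ℂ} {a : ℂ} {R : ℝ} (hR : 0 < R)
    (hL : ContinuousOn L (Metric.sphere a R))
    (he : ∀ z ∈ Metric.sphere a R, Complex.exp (L z) = z - a) : False := by
  have hm : ∀ t : ℝ, circleMap a R t ∈ Metric.sphere a R :=
    fun t => circleMap_mem_sphere a hR.le t
  have hc : Continuous fun t : ℝ => L (circleMap a R t) - t * Complex.I :=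
    (hL.comp_continuous (continuous_circleMap a R) hm).sub (by fun_prop)
  have hv : ∀ t : ℝ, Complex.exp (L (circleMap a R t) - t * Complex.I) = R := by
    intro t
    rw [Complex.exp_sub, he _ (hm t), circleMap, add_sub_cancel_left,
      mul_div_cancel_right₀ _ (Complex.exp_ne_zero _)]
  have := eq_of_exp_const isPreconnected_univ hc.continuousOn
    (fun x _ y _ => by rw [hv, hv]) (mem_univ (0 : ℝ)) (mem_univ (2 * Real.pi))
  simp only [circleMap, Complex.ofReal_zero, zero_mul, Complex.exp_zero] at this
  push_cast at this
  rw [Complex.exp_two_pi_mul_I, sub_right_inj] at this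
  exact Complex.two_pi_I_ne_zero this.symm

/-- `(z - a) / (z - b)` has a continuous logarithm on `X`. -/
def HasLog (X : Set ℂ) (a b : ℂ) : Prop :=
  ∃ L : ℂ → ℂ, ContinuousOn L X ∧ ∀ z ∈ X, Complex.exp (L z) * (z - b) = z - a

lemma HasLog.symm {X : Set ℂ} {a b : ℂ} (h : HasLog X a b) : HasLog X b a := by
  obtain ⟨L, hL, h⟩ := h
  refine ⟨-L, hL.neg, fun z hz => ?_⟩
  rw [← h z hz, Pi.neg_apply, ← mul_assoc, ← Complex.exp_add]
  simp

lemma HasLog.trans {X : Set ℂ} {a b d : ℂ} (h : HasLog X a b) (h' : HasLog X b d) :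
    HasLog X a d := by
  obtain ⟨L, hL, h⟩ := h
  obtain ⟨L', hL', h'⟩ := h'
  refine ⟨L + L', hL.add hL', fun z hz => ?_⟩
  rw [← h z hz, ← h' z hz, Pi.add_apply, Complex.exp_add, mul_assoc]

lemma HasLog.of_near {X : Set ℂ} {a b : ℂ} {ε : ℝ} (hX : ∀ z ∈ X, ε ≤ ‖z - a‖)
    (hb : ‖b - a‖ < ε) : HasLog X b a := by
  have hs : ∀ z ∈ X, (z - b) / (z - a) ∈ Complex.slitPlane := by
    intro z hz
    have hpos : 0 < ‖z - a‖ := (norm_nonneg _).trans_lt (hb.trans_le (hX z hz))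
    have hne : z - a ≠ 0 := norm_pos_iff.1 hpos
    have : (z - b) / (z - a) = 1 + -((b - a) / (z - a)) := by field_simp; ring
    rw [this]
    apply Complex.mem_slitPlane_of_norm_lt_one
    rw [norm_neg, norm_div, div_lt_one hpos]
    exact hb.trans_le (hX z hz)
  refine ⟨fun z => Complex.log ((z - b) / (z - a)), ?_, fun z hz => ?_⟩
  · refine ContinuousOn.clog (ContinuousOn.div (by fun_prop) (by fun_prop) fun z hz => ?_) hs
    exact norm_pos_iff.1 ((norm_nonneg _).trans_lt (hb.trans_le (hX z hz)))
  · have h0 : z - a ≠ 0 := norm_pos_iff.1 ((norm_nonneg _).trans_lt (hb.trans_le (hX z hz)))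
    rw [Complex.exp_log (Complex.slitPlane_ne_zero (hs z hz)), div_mul_cancel₀ _ h0]

lemma HasLog.of_mem_connectedComponentIn {X : Set ℂ} (hX : IsClosed X) {a b : ℂ}
    (ha : a ∈ Xᶜ) (hb : b ∈ connectedComponentIn Xᶜ a) : HasLog X a b := by
  refine (isPreconnected_connectedComponentIn (F := Xᶜ) (x := a)).induction₂ (HasLog X) ?_
    (fun x y z _ _ _ => HasLog.trans) (fun x y _ _ => HasLog.symm)
    (mem_connectedComponentIn ha) hb
  intro x hx
  have hxX := connectedComponentIn_subset _ _ hx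
  obtain ⟨ε, hε, hball⟩ := Metric.isOpen_iff.1 hX.isOpen_compl x hxX
  refine mem_nhdsWithin_of_mem_nhds ?_
  filter_upwards [Metric.ball_mem_nhds x hε] with y hy
  refine (HasLog.of_near (ε := ε) (fun z hz => ?_) (mem_ball_iff_norm.1 hy)).symm
  by_contra! h
  exact hball (mem_ball_iff_norm.2 h) hz

/-- The complement of a closed ball in the plane is connected. -/
lemma isPreconnected_compl_closedBall (R : ℝ) (hR : 0 ≤ R) :
    IsPreconnected {z : ℂ | R < ‖z‖} := by
  have : {z : ℂ | R < ‖z‖} = (fun p : ℝ × ℝ => circleMap 0 p.1 p.2) '' (Ioi R ×ˢ univ) := by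
    ext z
    simp only [mem_ofPred_eq, mem_image, mem_prod, mem_Ioi, mem_univ, and_true, Prod.exists]
    constructor
    · intro hz
      exact ⟨‖z‖, z.arg, hz, by simp [circleMap]⟩
    · rintro ⟨r, t, hr, rfl⟩
      rwa [norm_circleMap_zero, abs_of_pos (hR.trans_lt hr)]
  rw [this]
  refine (isPreconnected_Ioi.prod isPreconnected_univ).image _ (Continuous.continuousOn ?_)
  unfold circleMap
  fun_prop

lemma frontier_connectedComponentIn_subset {X : Set ℂ} (hX : IsClosed X) (a : ℂ) :
    frontier (connectedComponentIn Xᶜ a) ⊆ X := by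
  intro z hz
  by_contra hzX
  have ho : IsOpen (connectedComponentIn Xᶜ a) := hX.isOpen_compl.connectedComponentIn
  have hoz : IsOpen (connectedComponentIn Xᶜ z) := hX.isOpen_compl.connectedComponentIn
  rw [ho.frontier_eq] at hz
  obtain ⟨w, hw, hw'⟩ := mem_closure_iff.1 hz.1 _ hoz (mem_connectedComponentIn hzX)
  apply hz.2
  rw [connectedComponentIn_eq hw', ← connectedComponentIn_eq hw]
  exact mem_connectedComponentIn hzX

/-- Half of Eilenberg's criterion. -/
lemma not_hasLog_of_isBounded {X : Set ℂ} (hX : IsClosed X) {a b : ℂ}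
    (ha : a ∈ Xᶜ) (hbd : Bornology.IsBounded (connectedComponentIn Xᶜ a))
    (hb : b ∉ connectedComponentIn Xᶜ a) : ¬ HasLog X a b := by
  rintro ⟨L, hL, hLX⟩
  obtain ⟨Λ, hΛ⟩ := ContinuousMap.exists_restrict_eq hX ⟨X.domRestrict L,
    continuousOn_iff_continuous_domRestrict.1 hL⟩
  have hΛX : ∀ z ∈ X, Λ z = L z := fun z hz => DFunLike.congr_fun hΛ ⟨z, hz⟩
  set U := connectedComponentIn Xᶜ a with hU
  classical
  set F : ℂ → ℂ := fun z => if z ∈ U then Complex.exp (Λ z) * (z - b) else z - a with hF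
  have hFc : Continuous F := by
    refine Continuous.if (fun z hz => ?_) (by fun_prop) (by fun_prop)
    have := frontier_connectedComponentIn_subset hX a hz
    rw [hΛX z this, hLX z this]
  have hF0 : ∀ z, F z ≠ 0 := by
    intro z
    by_cases hz : z ∈ U
    · simp only [hF, hz, if_true]
      refine mul_ne_zero (Complex.exp_ne_zero _) (sub_ne_zero.2 ?_)
      rintro rfl
      exact hb hz
    · simp only [hF, hz, if_false]
      refine sub_ne_zero.2 ?_
      rintro rfl
      exact hz (mem_connectedComponentIn ha)
  obtain ⟨R, hR⟩ := hbd.subset_ball a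
  have hR0 : 0 < R := by
    have := hR (mem_connectedComponentIn ha)
    simpa using this
  obtain ⟨M, hM, hMF⟩ := exists_log_univ hFc hF0
  refine no_log_sphere hR0 hM.continuousOn (a := a) fun z hz => ?_
  rw [hMF]
  have : z ∉ U := fun h => by
    have h1 := hR h
    rw [mem_ball_iff_norm] at h1
    rw [mem_sphere_iff_norm] at hz
    exact h1.ne hz
  simp [hF, this]

/-- Eilenberg's criterion. -/
lemma mem_connectedComponentIn_of_hasLog {X : Set ℂ} (hX : IsCompact X) {a b : ℂ}
    (ha : a ∈ Xᶜ) (hb : b ∈ Xᶜ) (h : HasLog X a b) : b ∈ connectedComponentIn Xᶜ a := by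
  by_contra hn
  have h1 : ¬ Bornology.IsBounded (connectedComponentIn Xᶜ a) :=
    fun hbd => not_hasLog_of_isBounded hX.isClosed ha hbd hn h
  have hn' : a ∉ connectedComponentIn Xᶜ b := fun h' => hn <| by
    rw [← connectedComponentIn_eq h']; exact mem_connectedComponentIn hb
  have h2 : ¬ Bornology.IsBounded (connectedComponentIn Xᶜ b) :=
    fun hbd => not_hasLog_of_isBounded hX.isClosed hb hbd hn' h.symm
  obtain ⟨R, hR⟩ := hX.isBounded.subset_closedBall (0 : ℂ)
  have hR' : ∀ z ∈ X, ‖z‖ ≤ max R 0 := fun z hz =>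
    (mem_closedBall_zero_iff.1 (hR hz)).trans (le_max_left _ _)
  have hout : ∀ S : Set ℂ, ¬ Bornology.IsBounded S → ∃ z ∈ S, max R 0 < ‖z‖ := by
    intro S hS
    by_contra! h
    exact hS (Metric.isBounded_closedBall.subset fun z hz => mem_closedBall_zero_iff.2 (h z hz))
  obtain ⟨u, hu, huR⟩ := hout _ h1
  obtain ⟨v, hv, hvR⟩ := hout _ h2
  have := (isPreconnected_compl_closedBall (max R 0) (le_max_right _ _)).subset_connectedComponentIn
    huR (F := Xᶜ) (fun z hz hzX => not_lt.2 (hR' z hzX) hz) hvR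
  apply hn
  rw [connectedComponentIn_eq hu, connectedComponentIn_eq this, ← connectedComponentIn_eq hv]
  exact mem_connectedComponentIn hb

/-- Janiszewski's theorem. -/
lemma janiszewski {X Y : Set ℂ} (hX : IsCompact X) (hY : IsCompact Y)
    (hXY : IsPreconnected (X ∩ Y)) {a b : ℂ} (haX : a ∉ X) (haY : a ∉ Y)
    (hbX : b ∈ connectedComponentIn Xᶜ a) (hbY : b ∈ connectedComponentIn Yᶜ a) :
    b ∈ connectedComponentIn (X ∪ Y)ᶜ a := by
  have hbX' : b ∉ X := connectedComponentIn_subset _ _ hbX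
  have hbY' : b ∉ Y := connectedComponentIn_subset _ _ hbY
  refine mem_connectedComponentIn_of_hasLog (hX.union hY) (by simp [haX, haY])
    (by simp [hbX', hbY']) ?_
  obtain ⟨L, hL, hLX⟩ := HasLog.of_mem_connectedComponentIn hX.isClosed haX hbX
  obtain ⟨M, hM, hMY⟩ := HasLog.of_mem_connectedComponentIn hY.isClosed haY hbY
  have hbz : ∀ z ∈ X ∪ Y, z - b ≠ 0 := by
    rintro z (hz | hz) h0 <;> rw [sub_eq_zero] at h0 <;> subst h0 <;> contradiction
  obtain ⟨k, hk, hkXY⟩ : ∃ k, Complex.exp k = 1 ∧ ∀ z ∈ X ∩ Y, L z = M z + k := by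
    rcases (X ∩ Y).eq_empty_or_nonempty with he | ⟨z₀, hz₀⟩
    · exact ⟨0, by simp, by simp [he]⟩
    have hexp : ∀ z ∈ X ∩ Y, Complex.exp (L z - M z) = 1 := by
      intro z hz
      rw [Complex.exp_sub, div_eq_one_iff_eq (Complex.exp_ne_zero _)]
      exact mul_right_cancel₀ (hbz z (.inl hz.1)) ((hLX z hz.1).trans (hMY z hz.2).symm)
    refine ⟨L z₀ - M z₀, hexp z₀ hz₀, fun z hz => ?_⟩
    have := eq_of_exp_const hXY (g := fun z => L z - M z)
      ((hL.mono inter_subset_left).sub (hM.mono inter_subset_right))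
      (fun x hx y hy => by rw [hexp x hx, hexp y hy]) hz hz₀
    rw [← this]; ring
  classical
  have hYeq : ∀ z ∈ Y, (if z ∈ X then L z else M z + k) = M z + k := by
    intro z hz
    split_ifs with h
    · exact hkXY z ⟨h, hz⟩
    · rfl
  refine ⟨fun z => if z ∈ X then L z else M z + k, ?_, ?_⟩
  · refine ContinuousOn.union_of_isClosed ?_ ?_ hX.isClosed hY.isClosed
    · exact hL.congr fun z hz => by simp [hz]
    · exact (hM.add continuousOn_const).congr hYeq
  · rintro z (hz | hz)
    · simpa [hz] using hLX z hz
    · simp only [hYeq z hz, Complex.exp_add, hk, mul_one]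
      exact hMY z hz

lemma isOpen_exteriorDomain {Γ : Set ℂ} (hΓ : IsCompact Γ) : IsOpen (exteriorDomain Γ) := by
  rw [isOpen_iff_mem_nhds]
  rintro z ⟨hz, hzb⟩
  have ho : IsOpen (connectedComponentIn Γᶜ z) := hΓ.isClosed.isOpen_compl.connectedComponentIn
  filter_upwards [ho.mem_nhds (mem_connectedComponentIn hz)] with w hw
  refine ⟨connectedComponentIn_subset _ _ hw, ?_⟩
  rwa [← connectedComponentIn_eq hw]

lemma exists_large_mem_exteriorDomain {Γ : Set ℂ} (hΓ : IsCompact Γ) :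
    ∃ R : ℝ, 0 < R ∧ (∀ z ∈ Γ, ‖z‖ ≤ R) ∧ ∀ z : ℂ, R < ‖z‖ → z ∈ exteriorDomain Γ := by
  obtain ⟨R, hR⟩ := hΓ.isBounded.subset_closedBall (0 : ℂ)
  have hR' : ∀ z ∈ Γ, ‖z‖ ≤ max R 1 := fun z hz =>
    (mem_closedBall_zero_iff.1 (hR hz)).trans (le_max_left _ _)
  have h0 : 0 < max R 1 := lt_max_of_lt_right one_pos
  refine ⟨max R 1, h0, hR', fun z hz => ?_⟩
  have hsub : {z : ℂ | max R 1 < ‖z‖} ⊆ Γᶜ := fun w hw hwΓ => not_lt.2 (hR' w hwΓ) hw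
  refine ⟨hsub hz, fun hb => ?_⟩
  have h1 := (isPreconnected_compl_closedBall _ h0.le).subset_connectedComponentIn hz hsub
  obtain ⟨M, hM⟩ := (hb.subset h1).subset_closedBall (0 : ℂ)
  have hp : 0 < max (max R 1) M + 1 := by positivity
  have h2 : ((max (max R 1) M + 1 : ℝ) : ℂ) ∈ {z : ℂ | max R 1 < ‖z‖} := by
    rw [mem_ofPred_eq, Complex.norm_real, Real.norm_eq_abs, abs_of_pos hp]
    linarith [le_max_left (max R 1) M]
  have h3 := mem_closedBall_zero_iff.1 (hM h2)
  rw [Complex.norm_real, Real.norm_eq_abs, abs_of_pos hp] at h3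
  linarith [le_max_right (max R 1) M]

lemma subset_exteriorDomain {Γ S : Set ℂ} (hS : IsPreconnected S) (hSΓ : S ⊆ Γᶜ) {z : ℂ}
    (hz : z ∈ S) (hzΩ : z ∈ exteriorDomain Γ) : S ⊆ exteriorDomain Γ := by
  intro w hw
  refine ⟨hSΓ hw, ?_⟩
  have := hS.subset_connectedComponentIn hz hSΓ hw
  rw [← connectedComponentIn_eq this]
  exact hzΩ.2

lemma exteriorDomain_eq {Γ : Set ℂ} (hΓ : IsCompact Γ) {z : ℂ} (hz : z ∈ exteriorDomain Γ) :
    exteriorDomain Γ = connectedComponentIn Γᶜ z := by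
  refine Subset.antisymm (fun w hw => ?_) (subset_exteriorDomain isPreconnected_connectedComponentIn
    (connectedComponentIn_subset _ _) (mem_connectedComponentIn hz.1) hz)
  obtain ⟨R, hR0, hR, -⟩ := exists_large_mem_exteriorDomain hΓ
  have hout : ∀ S : Set ℂ, ¬ Bornology.IsBounded S → ∃ z ∈ S, R < ‖z‖ := by
    intro S hS
    by_contra! h
    exact hS (Metric.isBounded_closedBall.subset fun z hz => mem_closedBall_zero_iff.2 (h z hz))
  obtain ⟨u, hu, huR⟩ := hout _ hz.2
  obtain ⟨v, hv, hvR⟩ := hout _ hw.2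
  have := (isPreconnected_compl_closedBall R hR0.le).subset_connectedComponentIn
    huR (F := Γᶜ) (fun z hz hzX => not_lt.2 (hR z hzX) hz) hvR
  rw [connectedComponentIn_eq hu, connectedComponentIn_eq this, ← connectedComponentIn_eq hv]
  exact mem_connectedComponentIn hw.1

lemma closure_exteriorDomain_subset {Γ : Set ℂ} (hΓ : IsCompact Γ) :
    closure (exteriorDomain Γ) ⊆ exteriorDomain Γ ∪ Γ := by
  intro w hw
  by_cases hwΩ : w ∈ exteriorDomain Γ
  · exact .inl hwΩ
  right
  obtain ⟨z, hz⟩ : (exteriorDomain Γ).Nonempty := closure_nonempty_iff.1 ⟨w, hw⟩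
  refine frontier_connectedComponentIn_subset hΓ.isClosed z ?_
  rw [← exteriorDomain_eq hΓ hz, (isOpen_exteriorDomain hΓ).frontier_eq]
  exact ⟨hw, hwΩ⟩

lemma IsJordanCurve.isCompact {Γ : Set ℂ} (h : IsJordanCurve Γ) : IsCompact Γ := by
  obtain ⟨f, hf, hp, -, rfl⟩ := h
  rw [← hp.image_Icc Real.two_pi_pos 0]
  exact isCompact_Icc.image hf

/-- Inverse of an injective holomorphic map. -/
lemma inverse_holomorphic {U V : Set ℂ} {f g : ℂ → ℂ} (hU : IsOpen U)
    (hf : DifferentiableOn ℂ f U) (hbij : BijOn f U V) (hg : InvOn g f U V) :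
    IsOpen V ∧ DifferentiableOn ℂ g V ∧ ∀ w ∈ V, deriv g w ≠ 0 := by
  have hgm : MapsTo g V U := by
    intro w hw
    obtain ⟨z, hz, rfl⟩ := hbij.surjOn hw
    rwa [hg.1 hz]
  have han : ∀ z ∈ U, AnalyticAt ℂ f z := fun z hz => hf.analyticAt (hU.mem_nhds hz)
  have hnc : ∀ z ∈ U, ¬ ∀ᶠ y in 𝓝 z, f y = f z := by
    intro z hz h
    have h2 : ∀ᶠ y in 𝓝 z, y = z := by
      filter_upwards [h, hU.mem_nhds hz] with y hy hyU using hbij.injOn hyU hz hy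
    have h3 : ({z} : Set ℂ) ∈ 𝓝 z := by filter_upwards [h2] with y hy using hy
    exact not_isOpen_singleton z (by
      rw [isOpen_iff_mem_nhds]; rintro _ rfl; exact h3)
  have hopen : ∀ z ∈ U, 𝓝 (f z) ≤ map f (𝓝 z) := fun z hz =>
    ((han z hz).eventually_constant_or_nhds_le_map_nhds).resolve_left (hnc z hz)
  have hV : IsOpen V := by
    rw [isOpen_iff_mem_nhds]
    intro w hw
    have := hopen (g w) (hgm hw)
    rw [hg.2 hw] at this
    refine this (mem_map.2 ?_)
    filter_upwards [hU.mem_nhds (hgm hw)] with y hy using hbij.mapsTo hy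
  have hgc : ∀ w ∈ V, ContinuousAt g w := by
    intro w hw s hs
    have := hopen (g w) (hgm hw)
    rw [hg.2 hw] at this
    rw [mem_map]
    have h2 : f '' (s ∩ U) ∈ 𝓝 w := by
      refine this (mem_map.2 ?_)
      filter_upwards [hs, hU.mem_nhds (hgm hw)] with y hy hyU using ⟨y, ⟨hy, hyU⟩, rfl⟩
    filter_upwards [h2]
    rintro _ ⟨y, ⟨hys, hyU⟩, rfl⟩
    rw [mem_preimage, hg.1 hyU]
    exact hys
  have hgd : ∀ w ∈ V, deriv f (g w) ≠ 0 → DifferentiableAt ℂ g w := by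
    intro w hw h
    refine (HasStrictDerivAt.of_local_left_inverse (f := f) (hgc w hw)
      (han _ (hgm hw)).hasStrictDerivAt h ?_).hasDerivAt.differentiableAt
    filter_upwards [hV.mem_nhds hw] with y hy using hg.2 hy
  have hgd' : ∀ w ∈ V, DifferentiableAt ℂ g w := by
    intro w hw
    refine (Complex.analyticAt_of_differentiable_on_punctured_nhds_of_continuousAt ?_
      (hgc w hw)).differentiableAt
    rcases (han _ (hgm hw)).deriv.eventually_eq_zero_or_eventually_ne_zero with h0 | h1
    · exfalso
      apply hnc _ (hgm hw)
      obtain ⟨r, hr, hball⟩ := Metric.eventually_nhds_iff_ball.1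
        (h0.and (hU.mem_nhds (hgm hw)))
      filter_upwards [Metric.ball_mem_nhds _ hr] with y hy
      refine (convex_ball (g w) r).is_const_of_fderivWithin_eq_zero (𝕜 := ℂ)
        (fun z hz => (han z (hball z hz).2).differentiableAt.differentiableWithinAt) ?_ hy
        (Metric.mem_ball_self hr)
      intro z hz
      rw [fderivWithin_of_isOpen Metric.isOpen_ball hz]
      ext
      simpa using (hball z hz).1
    · have h2 : ∀ᶠ y in 𝓝[≠] w, g y ∈ ({g w}ᶜ : Set ℂ) ∧ y ∈ V := by
        filter_upwards [self_mem_nhdsWithin, mem_nhdsWithin_of_mem_nhds (hV.mem_nhds hw)] with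
          y hy hyV
        refine ⟨fun h => hy ?_, hyV⟩
        have : g y = g w := h
        rw [mem_singleton_iff, ← hg.2 hyV, this, hg.2 hw]
      have h3 : Tendsto g (𝓝[≠] w) (𝓝[≠] (g w)) :=
        tendsto_nhdsWithin_iff.2 ⟨(hgc w hw).tendsto.mono_left nhdsWithin_le_nhds,
          h2.mono fun y hy => hy.1⟩
      filter_upwards [h3.eventually h1, h2] with y hy hyV using hgd y hyV.2 hy
  refine ⟨hV, fun w hw => (hgd' w hw).differentiableWithinAt, fun w hw h0 => ?_⟩
  have hc : HasDerivAt (fun y => f (g y)) (deriv f (g w) * deriv g w) w :=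
    (han _ (hgm hw)).differentiableAt.hasDerivAt.comp w (hgd' w hw).hasDerivAt
  have hid : HasDerivAt (fun y => f (g y)) 1 w :=
    (hasDerivAt_id w).congr_of_eventuallyEq (by
      filter_upwards [hV.mem_nhds hw] with y hy using hg.2 hy)
  have := hc.unique hid
  rw [h0, mul_zero] at this
  exact zero_ne_one this

/-- The data of the exterior conformal map, transplanted to the unit disc: `x ↦ K x / x` maps the
punctured disc conformally onto the exterior domain. -/
structure DiscMap (Γ : Set ℂ) (c : ℝ) (K : ℂ → ℂ) : Prop where
  cpos : 0 < c
  compact : IsCompact Γ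
  diff : DifferentiableOn ℂ K (Metric.ball 0 1)
  zero : K 0 = c
  inj : InjOn (fun x => K x / x) (Metric.ball 0 1 \ {0})
  image : (fun x => K x / x) '' (Metric.ball 0 1 \ {0}) = exteriorDomain Γ
  deriv_ne : ∀ x ∈ Metric.ball (0 : ℂ) 1, K x - x * deriv K x ≠ 0
  bdry : ∀ ε > 0, ∃ ρ, 0 < ρ ∧ ρ < 1 ∧ ∀ x ∈ Metric.ball (0 : ℂ) 1, ρ < ‖x‖ →
    Metric.infDist (K x / x) Γ < ε

lemma exists_discMap {Γ : Set ℂ} {φ : ℂ → ℂ} {c : ℝ} (hΓ : IsCompact Γ)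
    (h : IsExteriorMap Γ φ c) : ∃ K, DiscMap Γ c K := by
  obtain ⟨R₀, hR₀, -, hlarge⟩ := exists_large_mem_exteriorDomain hΓ
  have hΩo := isOpen_exteriorDomain hΓ
  set Ω := exteriorDomain Γ with hΩ
  have hcob : Ω ∈ Bornology.cobounded ℂ := by
    filter_upwards [tendsto_norm_cobounded_atTop.eventually_gt_atTop R₀] with z hz
      using hlarge z hz
  have hlim : Tendsto (fun z => φ z / z) (Bornology.cobounded ℂ) (𝓝 (c : ℂ)⁻¹) := by
    have := h.tendsto
    rwa [inf_of_le_left (le_principal_iff.2 hcob)] at this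
  have hc0 : (c : ℂ) ≠ 0 := Complex.ofReal_ne_zero.2 h.cpos.ne'
  set ψ := Function.invFunOn φ Ω with hψ
  have hinv : InvOn ψ φ Ω {w : ℂ | 1 < ‖w‖} := h.bij.invOn_invFunOn
  have hψm : ∀ w : ℂ, 1 < ‖w‖ → ψ w ∈ Ω := by
    intro w hw
    obtain ⟨z, hz, rfl⟩ := h.bij.surjOn hw
    rwa [hinv.1 hz]
  obtain ⟨-, hψd, hψ'⟩ := inverse_holomorphic hΩo h.diff h.bij hinv
  have hEo : IsOpen {w : ℂ | 1 < ‖w‖} := isOpen_lt continuous_const continuous_norm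
  -- behaviour at infinity
  have hinvlim : Tendsto (fun z => z / φ z) (Bornology.cobounded ℂ) (𝓝 (c : ℂ)) := by
    have := hlim.inv₀ (inv_ne_zero hc0)
    simpa using this
  set χ : ℂ → ℂ := fun ζ => if ζ = 0 then 0 else (φ ζ⁻¹)⁻¹ with hχ
  have hne0 : ∀ z ∈ Ω, φ z ≠ 0 := fun z hz h0 => by
    have : 1 < ‖φ z‖ := h.bij.mapsTo hz
    rw [h0, norm_zero] at this; linarith
  have hχslope : Tendsto (fun ζ => χ ζ / ζ) (𝓝[≠] 0) (𝓝 (c : ℂ)) := by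
    refine (hinvlim.comp tendsto_inv₀_nhdsNE_zero).congr' ?_
    filter_upwards [self_mem_nhdsWithin] with ζ hζ
    have : ζ ≠ 0 := hζ
    simp [hχ, this, div_eq_mul_inv, mul_comm]
  have hχder : HasDerivAt χ c 0 := by
    rw [hasDerivAt_iff_tendsto_slope]
    refine hχslope.congr fun ζ => ?_
    simp [slope, hχ, div_eq_mul_inv, mul_comm]
  have hχan : AnalyticAt ℂ χ 0 := by
    refine Complex.analyticAt_of_differentiable_on_punctured_nhds_of_continuousAt ?_
      hχder.continuousAt
    have h1 : ∀ᶠ ζ in 𝓝[≠] (0 : ℂ), ζ⁻¹ ∈ Ω := tendsto_inv₀_nhdsNE_zero.eventually hcob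
    filter_upwards [h1, self_mem_nhdsWithin] with ζ hζ hζ0
    have hζ0' : ζ ≠ 0 := hζ0
    have h2 : DifferentiableAt ℂ (fun ζ => (φ ζ⁻¹)⁻¹) ζ :=
      (((h.diff.differentiableAt (hΩo.mem_nhds hζ)).comp ζ
        (differentiableAt_inv hζ0')).inv (hne0 _ hζ))
    refine h2.congr_of_eventuallyEq ?_
    filter_upwards [isOpen_ne.mem_nhds hζ0'] with y hy
    have hy' : y ≠ 0 := hy
    simp [hχ, hy']
  have hχopen : 𝓝 (χ 0) ≤ map χ (𝓝 0) := by
    refine hχan.eventually_constant_or_nhds_le_map_nhds.resolve_left fun hcst => ?_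
    have : HasDerivAt χ 0 0 :=
      (hasDerivAt_const (0 : ℂ) (χ 0)).congr_of_eventuallyEq hcst
    exact hc0 (hχder.unique this)
  have hψinf : Tendsto ψ (Bornology.cobounded ℂ) (Bornology.cobounded ℂ) := by
    have hχ0 : χ 0 = 0 := by simp [hχ]
    rw [hχ0] at hχopen
    rw [← tendsto_norm_atTop_iff_cobounded, tendsto_atTop]
    intro B
    have hB : 0 < max B R₀ + 1 := by linarith [le_max_right B R₀]
    have hmem : χ '' Metric.ball 0 (max B R₀ + 1)⁻¹ ∈ 𝓝 (0 : ℂ) :=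
      hχopen (image_mem_map (Metric.ball_mem_nhds _ (inv_pos.2 hB)))
    have h2 : ∀ᶠ w in Bornology.cobounded ℂ, w⁻¹ ∈ χ '' Metric.ball 0 (max B R₀ + 1)⁻¹ :=
      tendsto_inv₀_cobounded.eventually hmem
    filter_upwards [h2, tendsto_norm_cobounded_atTop.eventually_gt_atTop 1] with w hw hw1
    obtain ⟨ζ, hζ, hζw⟩ := hw
    have hζ0 : ζ ≠ 0 := by
      rintro rfl
      rw [hχ0] at hζw
      have : w = 0 := inv_eq_zero.1 hζw.symm
      rw [this, norm_zero] at hw1; linarith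
    have h3 : φ ζ⁻¹ = w := by
      have : χ ζ = (φ ζ⁻¹)⁻¹ := by simp [hχ, hζ0]
      rw [this] at hζw
      exact inv_injective hζw
    have h4 : max B R₀ + 1 < ‖ζ⁻¹‖ := by
      rw [norm_inv, lt_inv_comm₀ hB (norm_pos_iff.2 hζ0)]
      simpa using hζ
    have h5 : ζ⁻¹ ∈ Ω := hlarge _ (by linarith [le_max_right B R₀])
    rw [← h3, hinv.1 h5]
    linarith [le_max_left B R₀]
  have hψlim : Tendsto (fun w => ψ w / w) (Bornology.cobounded ℂ) (𝓝 (c : ℂ)) := by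
    refine (hinvlim.comp hψinf).congr' ?_
    filter_upwards [tendsto_norm_cobounded_atTop.eventually_gt_atTop 1] with w hw
    simp [hinv.2 hw]
  -- the map on the disc
  set K : ℂ → ℂ := fun x => if x = 0 then (c : ℂ) else x * ψ x⁻¹ with hK
  have hKx : ∀ x, x ≠ 0 → K x / x = ψ x⁻¹ := by
    intro x hx
    simp [hK, hx]
  have hinv1 : ∀ x ∈ Metric.ball (0 : ℂ) 1 \ {0}, 1 < ‖x⁻¹‖ := by
    rintro x ⟨hx, hx0⟩
    rw [norm_inv]
    exact (one_lt_inv₀ (norm_pos_iff.2 hx0)).2 (by simpa using hx)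
  have hψat : ∀ x ∈ Metric.ball (0 : ℂ) 1 \ {0}, DifferentiableAt ℂ ψ x⁻¹ := fun x hx =>
    hψd.differentiableAt (hEo.mem_nhds (hinv1 x hx))
  have hKeq : ∀ x : ℂ, x ≠ 0 → K =ᶠ[𝓝 x] fun x => x * ψ x⁻¹ := by
    intro x hx
    filter_upwards [isOpen_ne.mem_nhds hx] with y hy
    have hy' : y ≠ 0 := hy
    simp [hK, hy']
  have hKder : ∀ x ∈ Metric.ball (0 : ℂ) 1 \ {0},
      HasDerivAt K (1 * ψ x⁻¹ + x * (deriv ψ x⁻¹ * (-(x ^ 2)⁻¹))) x := by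
    intro x hx
    refine HasDerivAt.congr_of_eventuallyEq ?_ (hKeq x hx.2)
    exact (hasDerivAt_id x).mul ((hψat x hx).hasDerivAt.comp x (hasDerivAt_inv hx.2))
  have hKcont : ContinuousAt K 0 := by
    rw [continuousAt_iff_punctured_nhds]
    have h0 : K 0 = c := by simp [hK]
    rw [h0]
    refine (hψlim.comp tendsto_inv₀_nhdsNE_zero).congr' ?_
    filter_upwards [self_mem_nhdsWithin] with x hx
    have hx' : x ≠ 0 := hx
    simp [hK, hx', mul_comm]
  have hKd : ∀ x ∈ Metric.ball (0 : ℂ) 1, DifferentiableAt ℂ K x := by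
    intro x hx
    by_cases hx0 : x = 0
    · subst hx0
      refine (Complex.analyticAt_of_differentiable_on_punctured_nhds_of_continuousAt ?_
        hKcont).differentiableAt
      filter_upwards [self_mem_nhdsWithin, mem_nhdsWithin_of_mem_nhds
        (Metric.ball_mem_nhds (0 : ℂ) one_pos)] with y hy hy1
      exact (hKder y ⟨hy1, hy⟩).differentiableAt
    · exact (hKder x ⟨hx, hx0⟩).differentiableAt
  refine ⟨K, h.cpos, hΓ, fun x hx => (hKd x hx).differentiableWithinAt, by simp [hK], ?_, ?_,
    ?_, ?_⟩
  · intro x hx y hy hxy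
    simp only [hKx x hx.2, hKx y hy.2] at hxy
    have := congrArg φ hxy
    rw [hinv.2 (hinv1 x hx), hinv.2 (hinv1 y hy)] at this
    exact inv_injective this
  · ext z
    constructor
    · rintro ⟨x, hx, rfl⟩
      simp only [hKx x hx.2]
      exact hψm _ (hinv1 x hx)
    · intro hz
      have h1 : 1 < ‖φ z‖ := h.bij.mapsTo hz
      have h0 : (φ z)⁻¹ ≠ 0 := inv_ne_zero (hne0 z hz)
      refine ⟨(φ z)⁻¹, ⟨?_, h0⟩, ?_⟩
      · rw [mem_ball_zero_iff, norm_inv]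
        exact inv_lt_one_of_one_lt₀ h1
      · simp only [hKx _ h0, inv_inv, hinv.1 hz]
  · intro x hx
    by_cases hx0 : x = 0
    · subst hx0; simpa [hK] using h.cpos.ne'
    · rw [(hKder x ⟨hx, hx0⟩).deriv]
      have : K x - x * (1 * ψ x⁻¹ + x * (deriv ψ x⁻¹ * (-(x ^ 2)⁻¹))) = deriv ψ x⁻¹ := by
        simp only [hK, hx0, if_false]
        field_simp
        ring
      rw [this]
      exact hψ' _ (hinv1 x ⟨hx, hx0⟩)
  · intro ε hε
    have hφinf : Tendsto (fun z => ‖φ z‖) (Bornology.cobounded ℂ) atTop := by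
      have h1 : Tendsto (fun z => ‖φ z / z‖ * ‖z‖) (Bornology.cobounded ℂ) atTop :=
        hlim.norm.pos_mul_atTop (norm_pos_iff.2 (inv_ne_zero hc0)) tendsto_norm_cobounded_atTop
      refine h1.congr' ?_
      filter_upwards [tendsto_norm_cobounded_atTop.eventually_gt_atTop 0] with z hz
      rw [norm_div, div_mul_cancel₀ _ hz.ne']
    obtain ⟨R, hR⟩ : ∃ R : ℝ, ∀ z : ℂ, R < ‖z‖ → 2 ≤ ‖φ z‖ := by
      have h1 := hφinf.eventually_ge_atTop 2
      rw [← comap_norm_atTop, eventually_comap] at h1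
      obtain ⟨R, hR⟩ := eventually_atTop.1 h1
      exact ⟨R, fun z hz => hR _ hz.le z rfl⟩
    set S := closure Ω ∩ ({z | ε ≤ Metric.infDist z Γ} ∩ Metric.closedBall 0 R) with hS
    have hScomp : IsCompact S := by
      refine IsCompact.inter_left (IsCompact.inter_left (isCompact_closedBall _ _) ?_)
        isClosed_closure
      exact isClosed_le continuous_const (Metric.continuous_infDist_pt Γ)
    have hSΩ : S ⊆ Ω := by
      rintro z ⟨hz, hz2, -⟩
      refine (closure_exteriorDomain_subset hΓ hz).resolve_right fun hzΓ => ?_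
      have : ε ≤ Metric.infDist z Γ := hz2
      rw [Metric.infDist_zero_of_mem hzΓ] at this
      linarith
    obtain ⟨m, hm1, hm⟩ : ∃ m : ℝ, 1 < m ∧ ∀ z ∈ S, m ≤ ‖φ z‖ := by
      rcases S.eq_empty_or_nonempty with he | hne
      · exact ⟨2, by norm_num, by simp [he]⟩
      · obtain ⟨z₀, hz₀, hmin⟩ := hScomp.exists_isMinOn hne
          ((h.diff.continuousOn.mono hSΩ).norm)
        exact ⟨‖φ z₀‖, h.bij.mapsTo (hSΩ hz₀), fun z hz => hmin hz⟩
    have hp : 1 < min m 2 := lt_min hm1 (by norm_num)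
    refine ⟨(min m 2)⁻¹, by positivity, inv_lt_one_of_one_lt₀ hp, fun x hx hxρ => ?_⟩
    have hx0 : x ≠ 0 := by
      rintro rfl
      rw [norm_zero] at hxρ
      exact absurd hxρ (not_lt.2 (by positivity))
    have hE := hinv1 x ⟨hx, hx0⟩
    rw [hKx x hx0]
    by_contra! hcon
    have hlt : ‖x⁻¹‖ < min m 2 := by
      rw [norm_inv]
      exact inv_lt_of_inv_lt₀ (by positivity) hxρ
    have hφx : φ (ψ x⁻¹) = x⁻¹ := hinv.2 hE
    have hRx : ‖ψ x⁻¹‖ ≤ R := by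
      by_contra! hh
      have := hR _ hh
      rw [hφx] at this
      linarith [min_le_right m 2]
    have := hm (ψ x⁻¹) ⟨subset_closure (hψm _ hE), hcon, by simpa using hRx⟩
    rw [hφx] at this
    linarith [min_le_left m 2]

lemma abs_det_smul_complex (z : ℂ) :
    |((ContinuousLinearMap.toSpanSingleton ℂ z).restrictScalars ℝ : ℂ →L[ℝ] ℂ).det| =
      ‖z‖ ^ 2 := by
  have h : (((ContinuousLinearMap.toSpanSingleton ℂ z).restrictScalars ℝ : ℂ →L[ℝ] ℂ) :
      ℂ →ₗ[ℝ] ℂ) = Algebra.lmul ℝ ℂ z := by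
    ext
    simp [mul_comm]
  have h2 := Algebra.norm_complex_apply z
  rw [Algebra.norm_apply] at h2
  rw [ContinuousLinearMap.det, h, h2, Complex.normSq_eq_norm_sq, abs_of_nonneg (by positivity)]

/-- The area formula for injective holomorphic maps. -/
lemma lintegral_deriv_sq_eq_volume_image {U : Set ℂ} (hU : IsOpen U) {h : ℂ → ℂ}
    (hd : DifferentiableOn ℂ h U) (hi : InjOn h U) :
    ∫⁻ ξ in U, ENNReal.ofReal (‖deriv h ξ‖ ^ 2) = volume (h '' U) := by
  rw [← lintegral_abs_det_fderiv_eq_addHaar_image volume hU.measurableSet (f := h)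
    (f' := fun ξ => (ContinuousLinearMap.toSpanSingleton ℂ (deriv h ξ)).restrictScalars ℝ) ?_ hi]
  · simp_rw [abs_det_smul_complex]
  · intro ξ hξ
    have := (hd.differentiableAt (hU.mem_nhds hξ)).hasDerivAt.hasFDerivAt
    exact (this.restrictScalars ℝ).hasFDerivWithinAt

lemma norm_integral_le_of_lintegral_sq {g : ℝ → ℂ} {a b lam : ℝ} (hab : a ≤ b) (hlam : 0 < lam)
    (hg : ∫⁻ x in Ioc a b, ENNReal.ofReal (‖g x‖ ^ 2) ≤ ENNReal.ofReal (lam ^ 2)) :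
    ‖∫ x in a..b, g x‖ ≤ lam * (b - a + 1) := by
  rw [intervalIntegral.integral_of_le hab]
  have hpos : 0 ≤ lam * (b - a + 1) := mul_nonneg hlam.le (by linarith)
  have h1 : ENNReal.ofReal ‖∫ x in Ioc a b, g x‖ ≤ ENNReal.ofReal (lam * (b - a + 1)) := by
    rw [ofReal_norm]
    refine (enorm_integral_le_lintegral_enorm _).trans ?_
    have h2 : ∀ x, ‖g x‖ₑ ≤ ENNReal.ofReal lam +
        ENNReal.ofReal lam⁻¹ * ENNReal.ofReal (‖g x‖ ^ 2) := by
      intro x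
      rw [← ofReal_norm, ← ENNReal.ofReal_mul (by positivity),
        ← ENNReal.ofReal_add hlam.le (by positivity)]
      refine ENNReal.ofReal_le_ofReal ?_
      have : lam + lam⁻¹ * ‖g x‖ ^ 2 - ‖g x‖ = lam⁻¹ * ((‖g x‖ - lam) ^ 2 + lam * ‖g x‖) := by
        field_simp; ring
      have h3 : 0 ≤ lam⁻¹ * ((‖g x‖ - lam) ^ 2 + lam * ‖g x‖) := by positivity
      linarith
    refine (lintegral_mono h2).trans ?_
    rw [lintegral_add_left measurable_const, lintegral_const_mul' _ _ ENNReal.ofReal_ne_top]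
    refine (add_le_add le_rfl (mul_le_mul_right hg _)).trans ?_
    rw [lintegral_const, Measure.restrict_apply_univ, Real.volume_Ioc,
      ← ENNReal.ofReal_mul hlam.le, ← ENNReal.ofReal_mul (by positivity), ← ENNReal.ofReal_add
      (mul_nonneg hlam.le (by linarith)) (by positivity)]
    refine ENNReal.ofReal_le_ofReal (le_of_eq ?_)
    field_simp
  exact (ENNReal.ofReal_le_ofReal_iff hpos).1 h1

/-- The length-area principle in a half strip. -/
lemma length_area {t₀ B : ℝ} {h : ℂ → ℂ}
    (hd : DifferentiableOn ℂ h {ξ : ℂ | ξ.re < t₀ ∧ |ξ.im| < Real.pi / 2})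
    (hi : InjOn h {ξ : ℂ | ξ.re < t₀ ∧ |ξ.im| < Real.pi / 2})
    (hB : ∀ ξ : ℂ, ξ.re < t₀ → |ξ.im| < Real.pi / 2 → ‖h ξ‖ ≤ B) {lam : ℝ} (hlam : 0 < lam)
    (t₁ : ℝ) : ∃ t < min t₀ t₁, ∀ α ∈ Ioo (-(Real.pi / 2)) (Real.pi / 2),
      ∀ α' ∈ Ioo (-(Real.pi / 2)) (Real.pi / 2),
      ‖h (t + α * Complex.I) - h (t + α' * Complex.I)‖ ≤ lam * (Real.pi + 1) := by
  set U : Set ℂ := {ξ : ℂ | ξ.re < t₀ ∧ |ξ.im| < Real.pi / 2} with hU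
  have hUo : IsOpen U := (isOpen_lt Complex.continuous_re continuous_const).inter
    (isOpen_lt Complex.continuous_im.abs continuous_const)
  set G : ℂ → ENNReal := fun ξ => ENNReal.ofReal (‖deriv h ξ‖ ^ 2) with hG
  have hGm : Measurable G := ((measurable_deriv h).norm.pow_const 2).ennreal_ofReal
  have hfin : ∫⁻ ξ in U, G ξ < ⊤ := by
    rw [hG, lintegral_deriv_sq_eq_volume_image hUo hd hi]
    refine (measure_mono ?_).trans_lt (Metric.isBounded_closedBall (x := (0 : ℂ)) (r := B)).measure_lt_top
    rintro _ ⟨ξ, hξ, rfl⟩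
    simpa using hB ξ hξ.1 hξ.2
  have hprod : ∫⁻ ξ in U, G ξ =
      ∫⁻ t in Iio t₀, ∫⁻ α in Ioo (-(Real.pi / 2)) (Real.pi / 2), G (t + α * Complex.I) := by
    have e := Complex.volume_preserving_equiv_real_prod.symm
    have hpre : Complex.measurableEquivRealProd.symm ⁻¹' U =
        Iio t₀ ×ˢ Ioo (-(Real.pi / 2)) (Real.pi / 2) := by
      ext p
      simp [hU, abs_lt]
    rw [← e.setLIntegral_comp_preimage hUo.measurableSet hGm, hpre, Measure.volume_eq_prod,
      ← Measure.prod_restrict, lintegral_prod _ (by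
        exact (hGm.comp Complex.measurableEquivRealProd.symm.measurable).aemeasurable)]
    refine lintegral_congr fun t => lintegral_congr fun α => ?_
    congr 1
    apply Complex.ext <;> simp
  obtain ⟨t, ht, hlt⟩ : ∃ t < min t₀ t₁,
      ∫⁻ α in Ioo (-(Real.pi / 2)) (Real.pi / 2), G (t + α * Complex.I) ≤
        ENNReal.ofReal (lam ^ 2) := by
    by_contra! hcon
    rw [hprod] at hfin
    have h1 : ∫⁻ t in Iio (min t₀ t₁), ENNReal.ofReal (lam ^ 2) ≤
        ∫⁻ t in Iio t₀, ∫⁻ α in Ioo (-(Real.pi / 2)) (Real.pi / 2), G (t + α * Complex.I) := by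
      refine (setLIntegral_mono' measurableSet_Iio fun t ht => (hcon t ht).le).trans ?_
      exact lintegral_mono_set (Iio_subset_Iio (min_le_left _ _))
    rw [lintegral_const, Measure.restrict_apply_univ, Real.volume_Iio, ENNReal.mul_top] at h1
    · exact absurd hfin (not_lt.2 h1)
    · simpa using hlam.ne'
  refine ⟨t, ht, ?_⟩
  have key : ∀ α ∈ Ioo (-(Real.pi / 2)) (Real.pi / 2), ∀ α' ∈ Ioo (-(Real.pi / 2)) (Real.pi / 2),
      α ≤ α' → ‖h (t + α' * Complex.I) - h (t + α * Complex.I)‖ ≤ lam * (Real.pi + 1) := by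
    intro α hα α' hα' hle
    have hsub : Icc α α' ⊆ Ioo (-(Real.pi / 2)) (Real.pi / 2) :=
      fun x hx => ⟨hα.1.trans_le hx.1, hx.2.trans_lt hα'.2⟩
    have hmem : ∀ x ∈ Icc α α', ((t : ℂ) + x * Complex.I) ∈ U := by
      intro x hx
      have := hsub hx
      refine ⟨?_, ?_⟩
      · simpa using ht.trans_le (min_le_left _ _)
      · simpa [abs_lt] using this
    have hder : ∀ x ∈ Icc α α', HasDerivAt (fun x : ℝ => h (t + x * Complex.I))
        (deriv h (t + x * Complex.I) * Complex.I) x := by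
      intro x hx
      have h1 : HasDerivAt (fun x : ℝ => (t : ℂ) + x * Complex.I) Complex.I x := by
        simpa using ((Complex.ofRealCLM.hasDerivAt (x := x)).mul_const Complex.I).const_add (t : ℂ)
      exact (hd.differentiableAt (hUo.mem_nhds (hmem x hx))).hasDerivAt.comp x h1
    have hcont : ContinuousOn (fun x : ℝ => deriv h (t + x * Complex.I) * Complex.I)
        (Icc α α') := by
      refine ContinuousOn.mul ?_ continuousOn_const
      refine ((hd.analyticOnNhd hUo).deriv.continuousOn).comp (by fun_prop) hmem
    have hint := intervalIntegral.integral_eq_sub_of_hasDerivAt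
      (fun x hx => hder x (by rwa [uIcc_of_le hle] at hx))
      (ContinuousOn.intervalIntegrable (by rwa [uIcc_of_le hle]))
    rw [← hint]
    refine (norm_integral_le_of_lintegral_sq hle hlam ?_).trans ?_
    · simp only [norm_mul, Complex.norm_I, mul_one]
      refine le_trans ?_ hlt
      exact lintegral_mono_set (Ioc_subset_Icc_self.trans hsub)
    · have := hα.1
      have := hα'.2
      gcongr
      linarith
  intro α hα α' hα'
  rcases le_total α α' with h1 | h1
  · rw [norm_sub_rev]; exact key α hα α' hα' h1
  · exact key α' hα' α hα h1

lemma IsJordanCurve.exists_small_arc {Γ : Set ℂ} (hΓ : IsJordanCurve Γ) {ε : ℝ} (hε : 0 < ε) :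
    ∃ η > 0, ∀ S ⊆ Γ, (∀ p ∈ S, ∀ q ∈ S, dist p q < η) →
      ∃ A, IsCompact A ∧ IsPreconnected A ∧ A ⊆ Γ ∧ S ⊆ A ∧ ∀ p ∈ A, ∃ q ∈ S, dist p q ≤ ε := by
  obtain ⟨f, hf, hper, hinj, rfl⟩ := hΓ
  have h2π : 0 < 2 * Real.pi := by positivity
  have huc := (isCompact_Icc (a := (-1 : ℝ)) (b := 2 * Real.pi + 1)).uniformContinuousOn_of_continuous
    hf.continuousOn
  obtain ⟨δ₀, hδ₀, hδ⟩ := Metric.uniformContinuousOn_iff.1 huc ε hε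
  set δ := min (δ₀ / 2) 1 with hδdef
  have hδpos : 0 < δ := lt_min (by linarith) one_pos
  have hδ1 : δ ≤ 1 := min_le_right _ _
  have hδ2 : δ < δ₀ := (min_le_left _ _).trans_lt (by linarith)
  set E : Set (ℝ × ℝ) := Icc 0 (2 * Real.pi) ×ˢ (Icc (-Real.pi) Real.pi ∩ {u | δ ≤ |u|}) with hE
  have hEc : IsCompact E := isCompact_Icc.prod (isCompact_Icc.inter_right
    (isClosed_le continuous_const continuous_abs))
  have hpos : ∀ e ∈ E, 0 < dist (f (e.1 + e.2)) (f e.1) := by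
    rintro ⟨s, u⟩ ⟨-, hu, hu'⟩
    refine dist_pos.2 fun h => ?_
    obtain ⟨n, hn⟩ := hinj _ _ h
    have hn' : u = -(n * (2 * Real.pi)) := by simp only at hn; linarith
    have hu'' : δ ≤ |u| := hu'
    have h1 : |u| ≤ Real.pi := abs_le.2 hu
    rcases eq_or_ne n 0 with rfl | h0
    · simp at hn'
      rw [hn', abs_zero] at hu''
      linarith
    · have h3 : (1 : ℝ) ≤ |(n : ℝ)| := by exact_mod_cast Int.one_le_abs h0
      rw [hn', abs_neg, abs_mul, abs_of_pos h2π] at h1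
      nlinarith [Real.pi_pos]
  have hmin : ∃ η > 0, ∀ e ∈ E, η ≤ dist (f (e.1 + e.2)) (f e.1) := by
    rcases E.eq_empty_or_nonempty with h | h
    · exact ⟨1, one_pos, by simp [h]⟩
    · obtain ⟨e, he, hemin⟩ := hEc.exists_isMinOn h
        (f := fun e : ℝ × ℝ => dist (f (e.1 + e.2)) (f e.1)) (by fun_prop)
      exact ⟨_, hpos e he, fun e' he' => hemin he'⟩
  obtain ⟨η, hη, hηE⟩ := hmin
  refine ⟨η, hη, fun S hS hSd => ?_⟩
  rcases S.eq_empty_or_nonempty with h | ⟨p₀, hp₀⟩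
  · exact ⟨∅, isCompact_empty, isPreconnected_empty, empty_subset _, by simp [h], by simp⟩
  obtain ⟨s', hs'⟩ := hS hp₀
  obtain ⟨s₀, hs₀, hs₀'⟩ := hper.exists_mem_Ico h2π s' 0
  have hp₀' : f s₀ = p₀ := by rw [← hs₀', hs']
  refine ⟨f '' Icc (s₀ - δ) (s₀ + δ), isCompact_Icc.image hf,
    isPreconnected_Icc.image _ hf.continuousOn, image_subset_range _ _, ?_, ?_⟩
  · intro q hq
    obtain ⟨t', ht'⟩ := hS hq
    obtain ⟨t, ht, htt⟩ := hper.exists_mem_Ico h2π t' (s₀ - Real.pi)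
    refine ⟨t, ?_, by rw [← htt, ht']⟩
    by_contra hcon
    have hmem : (s₀, t - s₀) ∈ E := by
      refine ⟨⟨hs₀.1, by simpa using hs₀.2.le⟩, ⟨by linarith [ht.1], by linarith [ht.2]⟩, ?_⟩
      change δ ≤ |t - s₀|
      by_contra! hlt
      rw [abs_lt] at hlt
      exact hcon ⟨by linarith, by linarith⟩
    have := hηE _ hmem
    simp only [add_sub_cancel] at this
    rw [← htt, ht', hp₀'] at this
    exact absurd (hSd q hq p₀ hp₀) (not_lt.2 this)
  · rintro _ ⟨t, ht, rfl⟩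
    refine ⟨p₀, hp₀, ?_⟩
    rw [← hp₀']
    refine (hδ t ⟨?_, ?_⟩ s₀ ⟨?_, ?_⟩ ?_).le
    · linarith [ht.1, hs₀.1]
    · linarith [ht.2, hs₀.2]
    · linarith [hs₀.1]
    · linarith [hs₀.2]
    · rw [Real.dist_eq]
      exact (abs_le.2 ⟨by linarith [ht.1], by linarith [ht.2]⟩ : |t - s₀| ≤ δ).trans_lt hδ2

namespace DiscMap

variable {Γ : Set ℂ} {c : ℝ} {K : ℂ → ℂ}

lemma mem_exteriorDomain (h : DiscMap Γ c K) {x : ℂ} (hx : x ∈ Metric.ball (0 : ℂ) 1 \ {0}) :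
    K x / x ∈ exteriorDomain Γ := h.image ▸ mem_image_of_mem _ hx

lemma differentiableOn_div (h : DiscMap Γ c K) :
    DifferentiableOn ℂ (fun x => K x / x) (Metric.ball (0 : ℂ) 1 \ {0}) :=
  (h.diff.mono sdiff_subset).div differentiableOn_id fun _ hx => hx.2

lemma isOpen_punctured : IsOpen (Metric.ball (0 : ℂ) 1 \ {0}) :=
  Metric.isOpen_ball.sdiff isClosed_singleton

lemma separation (h : DiscMap Γ c K) {N : ℂ → ℝ}
    (hN : ContinuousOn N (Metric.ball (0 : ℂ) 1 \ {0})) {C : Set ℂ} (hC : IsPreconnected C)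
    (hCΩ : C ⊆ exteriorDomain Γ) {x y : ℂ} (hx : x ∈ Metric.ball (0 : ℂ) 1 \ {0})
    (hy : y ∈ Metric.ball (0 : ℂ) 1 \ {0}) (hxC : K x / x ∈ C) (hyC : K y / y ∈ C) {r : ℝ}
    (hxr : N x ≤ r) (hyr : r ≤ N y) :
    ∃ u ∈ Metric.ball (0 : ℂ) 1 \ {0}, N u = r ∧ K u / u ∈ C := by
  set U := Metric.ball (0 : ℂ) 1 \ {0} with hU
  set κ : ℂ → ℂ := fun x => K x / x with hκ
  have hbij : BijOn κ U (exteriorDomain Γ) := ⟨fun u hu => h.mem_exteriorDomain hu, h.inj,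
    h.image.ge⟩
  set g := Function.invFunOn κ U
  have hinv : InvOn g κ U (exteriorDomain Γ) := hbij.invOn_invFunOn
  obtain ⟨-, hg, -⟩ := inverse_holomorphic isOpen_punctured h.differentiableOn_div hbij hinv
  have hgm : MapsTo g (exteriorDomain Γ) U := hbij.surjOn.mapsTo_invFunOn
  have hcont : ContinuousOn (N ∘ g) C :=
    hN.comp (hg.continuousOn.mono hCΩ) (hgm.mono_left hCΩ)
  have hgx : g (κ x) = x := hinv.1 hx
  have hgy : g (κ y) = y := hinv.1 hy
  have hmem : r ∈ (N ∘ g) '' C := by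
    refine hC.intermediate_value hxC hyC hcont ⟨?_, ?_⟩
    · change N (g (κ x)) ≤ r
      rwa [hgx]
    · change r ≤ N (g (κ y))
      rwa [hgy]
  obtain ⟨z, hz, hzr⟩ := hmem
  refine ⟨g z, hgm (hCΩ hz), hzr, ?_⟩
  have : κ (g z) = z := hinv.2 (hCΩ hz)
  change κ (g z) ∈ C
  rwa [this]

lemma exists_bound (h : DiscMap Γ c K) (hne : Γ.Nonempty) {r : ℝ} (hr : 0 < r) :
    ∃ B, ∀ x ∈ Metric.ball (0 : ℂ) 1, r ≤ ‖x‖ → ‖K x / x‖ ≤ B := by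
  obtain ⟨ρ, hρ0, hρ1, hρ⟩ := h.bdry 1 one_pos
  have hc : IsCompact (Metric.closedBall (0 : ℂ) ρ ∩ {x | r ≤ ‖x‖}) :=
    (isCompact_closedBall _ _).inter_right (isClosed_le continuous_const continuous_norm)
  have hcont : ContinuousOn (fun x => K x / x) (Metric.closedBall (0 : ℂ) ρ ∩ {x | r ≤ ‖x‖}) := by
    refine h.differentiableOn_div.continuousOn.mono ?_
    rintro x ⟨hx, hx'⟩
    refine ⟨Metric.closedBall_subset_ball hρ1 hx, ?_⟩
    rintro rfl
    simp at hx'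
    linarith
  obtain ⟨B₁, hB₁⟩ := hc.exists_bound_of_continuousOn hcont
  obtain ⟨R, hR⟩ := h.compact.isBounded.subset_closedBall (0 : ℂ)
  refine ⟨max B₁ (R + 1), fun x hx hrx => ?_⟩
  rcases le_or_gt ‖x‖ ρ with hxρ | hxρ
  · exact (hB₁ x ⟨mem_closedBall_zero_iff.2 hxρ, hrx⟩).trans (le_max_left _ _)
  · have h1 := hρ x hx hxρ
    obtain ⟨q, hq, hqd⟩ := (Metric.infDist_lt_iff hne).1 h1
    have h2 := mem_closedBall_zero_iff.1 (hR hq)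
    have h3 : ‖K x / x‖ ≤ ‖q‖ + dist (K x / x) q := by
      rw [dist_eq_norm]
      calc ‖K x / x‖ = ‖q + (K x / x - q)‖ := by congr 1; ring
        _ ≤ _ := norm_add_le _ _
    exact (by linarith : ‖K x / x‖ ≤ R + 1).trans (le_max_right _ _)

end DiscMap

/-- The squared modulus of `log (x / x₀)`. -/
def logDistSq (x₀ x : ℂ) : ℝ := ‖Complex.log (x / x₀)‖ ^ 2

lemma continuousOn_logDistSq {x₀ : ℂ} (hx₀ : ‖x₀‖ = 1) : ContinuousOn (logDistSq x₀) {0}ᶜ := by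
  have h0 : x₀ ≠ 0 := by rintro rfl; simp at hx₀
  have heq : EqOn (logDistSq x₀) (fun x => Real.log ‖x / x₀‖ ^ 2 +
      (InnerProductGeometry.angle (x / x₀) 1) ^ 2) {0}ᶜ := by
    intro x hx
    have hx0 : x / x₀ ≠ 0 := div_ne_zero hx h0
    simp only [logDistSq]
    rw [Complex.angle_one_right hx0, sq_abs, Complex.sq_norm, Complex.normSq_apply,
      Complex.log_re, Complex.log_im]
    ring
  refine ContinuousOn.congr (fun x hx => ?_) heq
  have hx0 : x / x₀ ≠ 0 := div_ne_zero hx h0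
  have h1 : ContinuousAt (fun x : ℂ => x / x₀) x := by fun_prop
  have h2 : ContinuousAt (fun x : ℂ => InnerProductGeometry.angle (x / x₀) 1) x := by
    have h3 := InnerProductGeometry.continuousAt_angle (x := ((x / x₀, 1) : ℂ × ℂ)) hx0 one_ne_zero
    exact ContinuousAt.comp (f := fun x : ℂ => ((x / x₀, 1) : ℂ × ℂ)) h3
      (h1.prodMk continuousAt_const)
  have h4 : ContinuousAt (fun x : ℂ => Real.log ‖x / x₀‖) x :=
    (h1.norm).log (norm_ne_zero_iff.2 hx0)
  exact ((h4.pow 2).add (h2.pow 2)).continuousWithinAt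

lemma exists_arg_of_re_pos {u : ℂ} (hu : 0 < u.re) :
    u = Complex.exp (Real.log ‖u‖ + u.arg * Complex.I) ∧
      u.arg ∈ Ioo (-(Real.pi / 2)) (Real.pi / 2) := by
  have h0 : u ≠ 0 := by rintro rfl; simp at hu
  refine ⟨?_, abs_lt.1 (Complex.abs_arg_lt_pi_div_two_iff.2 (Or.inl hu))⟩
  rw [Complex.exp_add, ← Complex.ofReal_exp, Real.exp_log (norm_pos_iff.2 h0),
    Complex.norm_mul_exp_arg_mul_I]

namespace DiscMap

variable {Γ : Set ℂ} {c : ℝ} {K : ℂ → ℂ}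

lemma exists_small_crosscut (h : DiscMap Γ c K) (hne : Γ.Nonempty) {x₀ : ℂ} (hx₀ : ‖x₀‖ = 1)
    {lam : ℝ} (hlam : 0 < lam) {r₀ : ℝ} (hr₀ : 0 < r₀) :
    ∃ r, 0 < r ∧ r < 1 ∧ r < r₀ ∧ ∀ x ∈ Metric.ball (0 : ℂ) 1 \ {0},
      ∀ y ∈ Metric.ball (0 : ℂ) 1 \ {0}, logDistSq x₀ x = r ^ 2 → logDistSq x₀ y = r ^ 2 →
        dist (K x / x) (K y / y) ≤ lam := by
  have hx00 : x₀ ≠ 0 := by rintro rfl; simp at hx₀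
  obtain ⟨B, hB⟩ := h.exists_bound hne (Real.exp_pos (-1))
  set U : Set ℂ := {ξ : ℂ | ξ.re < 0 ∧ |ξ.im| < Real.pi / 2} with hU
  set E : ℂ → ℂ := fun ξ => x₀ * Complex.exp (-Complex.exp ξ) with hE
  have hre : ∀ ξ : ℂ, |ξ.im| < Real.pi / 2 → 0 < (Complex.exp ξ).re := by
    intro ξ hξ
    rw [Complex.exp_re]
    exact mul_pos (Real.exp_pos _) (Real.cos_pos_of_mem_Ioo (abs_lt.1 hξ))
  have hnorm : ∀ ξ : ℂ, ξ.re < 0 → ‖Complex.exp ξ‖ < 1 := by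
    intro ξ hξ
    rw [Complex.norm_exp]
    exact Real.exp_lt_one_iff.2 hξ
  have hEn : ∀ ξ : ℂ, ‖E ξ‖ = Real.exp (-(Complex.exp ξ).re) := by
    intro ξ
    rw [hE]
    simp only
    rw [norm_mul, hx₀, one_mul, Complex.norm_exp, Complex.neg_re]
  have hE0 : ∀ ξ, E ξ ≠ 0 := fun ξ => mul_ne_zero hx00 (Complex.exp_ne_zero _)
  have hEU : MapsTo E U (Metric.ball (0 : ℂ) 1 \ {0}) := by
    intro ξ hξ
    refine ⟨?_, hE0 ξ⟩
    rw [mem_ball_zero_iff, hEn]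
    exact Real.exp_lt_one_iff.2 (neg_neg_of_pos (hre ξ hξ.2))
  have hEd : Differentiable ℂ E := by
    rw [hE]; fun_prop
  have hEi : InjOn E U := by
    intro ξ hξ ξ' hξ' heq
    have h1 := mul_left_cancel₀ hx00 heq
    have him : ∀ ξ ∈ U, |(-Complex.exp ξ).im| < Real.pi := by
      intro ξ hξ
      refine (Complex.abs_im_le_norm _).trans_lt ?_
      rw [norm_neg]
      linarith [hnorm ξ hξ.1, Real.pi_gt_three]
    have h2 := Complex.exp_inj_of_neg_pi_lt_of_le_pi (abs_lt.1 (him ξ hξ)).1 (abs_lt.1 (him ξ hξ)).2.le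
      (abs_lt.1 (him ξ' hξ')).1 (abs_lt.1 (him ξ' hξ')).2.le h1
    have h3 := neg_injective h2
    have hp := Real.pi_pos
    have hξ2 := abs_lt.1 hξ.2
    have hξ2' := abs_lt.1 hξ'.2
    exact Complex.exp_inj_of_neg_pi_lt_of_le_pi (by linarith) (by linarith) (by linarith)
      (by linarith) h3
  obtain ⟨t, ht, hta⟩ := length_area (t₀ := 0) (B := B) (h := fun ξ => K (E ξ) / E ξ)
    (h.differentiableOn_div.comp hEd.differentiableOn hEU) (h.inj.comp hEi hEU)
    (fun ξ h1 h2 => by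
      refine hB _ (hEU ⟨h1, h2⟩).1 ?_
      rw [hEn]
      refine Real.exp_le_exp.2 (neg_le_neg ?_)
      exact (Complex.re_le_norm _).trans (hnorm ξ h1).le)
    (lam := lam / (Real.pi + 1)) (by positivity) (Real.log r₀)
  rw [lt_min_iff] at ht
  have hrep : ∀ x ∈ Metric.ball (0 : ℂ) 1 \ {0}, logDistSq x₀ x = Real.exp t ^ 2 →
      ∃ α ∈ Ioo (-(Real.pi / 2)) (Real.pi / 2), x = E (t + α * Complex.I) := by
    rintro x ⟨hx, hx0⟩ hxt
    set u := -Complex.log (x / x₀) with hu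
    have hun : ‖u‖ = Real.exp t := by
      rw [hu, norm_neg]
      exact (pow_left_inj₀ (norm_nonneg _) (Real.exp_pos _).le two_ne_zero).1 hxt
    have hure : 0 < u.re := by
      rw [hu, Complex.neg_re, Complex.log_re, norm_div, hx₀, div_one]
      have := Real.log_neg (norm_pos_iff.2 hx0) (mem_ball_zero_iff.1 hx)
      linarith
    obtain ⟨h1, h2⟩ := exists_arg_of_re_pos hure
    refine ⟨u.arg, h2, ?_⟩
    rw [hun, Real.log_exp] at h1
    rw [hE]
    simp only
    rw [← h1, hu, neg_neg, Complex.exp_log (div_ne_zero hx0 hx00)]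
    field_simp
  refine ⟨Real.exp t, Real.exp_pos t, Real.exp_lt_one_iff.2 ht.1, ?_, ?_⟩
  · rw [← Real.exp_log hr₀]
    exact Real.exp_lt_exp.2 ht.2
  · intro x hx y hy hxt hyt
    obtain ⟨α, hα, rfl⟩ := hrep x hx hxt
    obtain ⟨α', hα', rfl⟩ := hrep y hy hyt
    rw [dist_eq_norm]
    refine (hta α hα α' hα').trans (le_of_eq ?_)
    field_simp

lemma exists_small_osc (h : DiscMap Γ c K) (hΓ : IsJordanCurve Γ) {x₀ : ℂ} (hx₀ : ‖x₀‖ = 1)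
    {ε : ℝ} (hε : 0 < ε) : ∃ δ > 0, ∃ q, ∀ x ∈ Metric.ball (0 : ℂ) 1 \ {0}, dist x x₀ < δ →
      dist (K x / x) q ≤ ε := by
  have hx00 : x₀ ≠ 0 := by rintro rfl; simp at hx₀
  have hne : Γ.Nonempty := by
    obtain ⟨f, -, -, -, rfl⟩ := hΓ
    exact range_nonempty f
  set U := Metric.ball (0 : ℂ) 1 \ {0} with hU
  set κ : ℂ → ℂ := fun x => K x / x with hκ
  have hexp : ∀ s : ℝ, 0 < s → x₀ * Complex.exp (-s : ℝ) ∈ U ∧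
      (s < Real.pi → logDistSq x₀ (x₀ * Complex.exp (-s : ℝ)) = s ^ 2) ∧
      ‖x₀ * Complex.exp (-s : ℝ)‖ = Real.exp (-s) := by
    intro s hs
    have hn : ‖x₀ * Complex.exp (-s : ℝ)‖ = Real.exp (-s) := by
      rw [norm_mul, hx₀, one_mul, Complex.norm_exp, Complex.ofReal_re]
    refine ⟨⟨?_, mul_ne_zero hx00 (Complex.exp_ne_zero _)⟩, fun hsπ => ?_, hn⟩
    · rw [mem_ball_zero_iff, hn]
      exact Real.exp_lt_one_iff.2 (by linarith)
    · rw [logDistSq, mul_div_cancel_left₀ _ hx00, ← Complex.ofReal_exp, ← Complex.ofReal_log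
        (Real.exp_pos _).le, Real.log_exp, Complex.norm_real, Real.norm_eq_abs, sq_abs, neg_sq]
  set y := x₀ * Complex.exp (-(2 : ℝ) : ℝ) with hy
  obtain ⟨hyU, hyN, -⟩ := hexp 2 two_pos
  rw [← hy] at hyU hyN
  replace hyN := hyN (by linarith [Real.pi_gt_three])
  have hκy := h.mem_exteriorDomain hyU
  set d := Metric.infDist (K y / y) Γ with hd
  have hdpos : 0 < d := (h.compact.isClosed.notMem_iff_infDist_pos hne).1 hκy.1
  set e := min (ε / 2) (d / 4) with he
  have hepos : 0 < e := lt_min (by linarith) (by linarith)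
  have he1 : 2 * e ≤ ε := by linarith [min_le_left (ε / 2) (d / 4)]
  have he2 : 4 * e ≤ d := by linarith [min_le_right (ε / 2) (d / 4)]
  obtain ⟨η, hη, harc⟩ := IsJordanCurve.exists_small_arc hΓ hepos
  obtain ⟨ρ, hρ0, hρ1, hρ⟩ := h.bdry e hepos
  obtain ⟨r, hr0, hr1, hrρ, hr⟩ := h.exists_small_crosscut hne hx₀ (lam := min e (η / 2))
    (lt_min hepos (by linarith)) (r₀ := -Real.log ρ) (by linarith [Real.log_neg hρ0 hρ1])
  set Q : Set ℂ := κ '' {x | x ∈ U ∧ logDistSq x₀ x = r ^ 2} with hQ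
  set q := κ (x₀ * Complex.exp (-r : ℝ)) with hq
  obtain ⟨hqU, hqN, hqn⟩ := hexp r hr0
  have hqQ : q ∈ Q := mem_image_of_mem _ ⟨hqU, hqN (by linarith [Real.pi_gt_three])⟩
  have hQd : ∀ p ∈ closure Q, ∀ p' ∈ closure Q, dist p p' ≤ min e (η / 2) := by
    have h0 : ∀ p ∈ Q, ∀ p' ∈ Q, dist p p' ≤ min e (η / 2) := by
      rintro _ ⟨x, hx, rfl⟩ _ ⟨x', hx', rfl⟩
      exact hr x hx.1 x' hx'.1 hx.2 hx'.2
    intro p hp p' hp'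
    have hbdd : Metric.diam (closure Q) ≤ min e (η / 2) := by
      rw [Metric.diam_closure]
      exact Metric.diam_le_of_forall_dist_le (by positivity) h0
    have hb : Bornology.IsBounded (closure Q) :=
      (Metric.isBounded_iff.2 ⟨_, fun p hp p' hp' => h0 p hp p' hp'⟩).closure
    exact (Metric.dist_le_diam_of_mem hb hp hp').trans hbdd
  have hqcl : q ∈ closure Q := subset_closure hqQ
  have hQc : IsCompact (closure Q) := by
    refine Metric.isCompact_of_isClosed_isBounded isClosed_closure
      (Metric.isBounded_iff.2 ⟨_, fun p hp p' hp' => hQd p hp p' hp'⟩)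
  obtain ⟨A, hAc, hAp, hAΓ, hSA, hAS⟩ := harc (closure Q ∩ Γ) inter_subset_right
    (fun p hp p' hp' => (hQd p hp.1 p' hp'.1).trans_lt
      ((min_le_right _ _).trans_lt (by linarith)))
  set Y := closure Q ∪ A with hY
  have hYball : ∀ p ∈ Y, dist p q ≤ 2 * e := by
    rintro p (hp | hp)
    · linarith [hQd p hp q hqcl, min_le_left e (η / 2)]
    · obtain ⟨p', hp', hpp'⟩ := hAS p hp
      linarith [hQd p' hp'.1 q hqcl, min_le_left e (η / 2), dist_triangle p p' q]
  have hqΓ : Metric.infDist q Γ < e := by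
    refine hρ _ hqU.1 ?_
    rw [hqn, ← Real.exp_log hρ0]
    exact Real.exp_lt_exp.2 (by linarith)
  have hyfar : 2 * e < dist (κ y) q := by
    have : d ≤ Metric.infDist q Γ + dist (κ y) q := Metric.infDist_le_infDist_add_dist
    linarith
  have hΓY : Γ ∩ Y = A := by
    ext p
    constructor
    · rintro ⟨hp, hp' | hp'⟩
      · exact hSA ⟨hp', hp⟩
      · exact hp'
    · exact fun hp => ⟨hAΓ hp, Or.inr hp⟩
  have hΩ := exteriorDomain_eq h.compact hκy
  have hkey : ∀ x ∈ U, logDistSq x₀ x < r ^ 2 → dist (κ x) q ≤ ε := by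
    intro x hx hxr
    by_contra! hcon
    have hκx := h.mem_exteriorDomain hx
    have hfar : 2 * e < dist (κ x) q := he1.trans_lt hcon
    have hc : IsPreconnected {p : ℂ | 2 * e < dist p q} := by
      have := (isPreconnected_compl_closedBall (2 * e) (by positivity)).image (fun z => z + q)
        (by fun_prop)
      convert this using 1
      ext p
      simp only [mem_ofPred_eq, mem_image, dist_eq_norm]
      exact ⟨fun hp => ⟨p - q, hp, by ring⟩, by rintro ⟨z, hz, rfl⟩; simpa using hz⟩
    have hcY : {p : ℂ | 2 * e < dist p q} ⊆ Yᶜ := fun p hp hpY => not_lt.2 (hYball p hpY) hp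
    have hjan := janiszewski h.compact (hQc.union hAc) (a := κ x) (b := κ y)
      (by rw [hΓY]; exact hAp) hκx.1 (hcY hfar)
      (by
        rw [← exteriorDomain_eq h.compact hκx]
        exact hκy)
      (hc.subset_connectedComponentIn hfar hcY hyfar)
    have hsub := connectedComponentIn_subset (Γ ∪ Y)ᶜ (κ x)
    have hxmem : κ x ∈ (Γ ∪ Y)ᶜ := by
      rintro (hx' | hx')
      · exact hκx.1 hx'
      · exact hcY hfar hx'
    obtain ⟨u, hu, hur, huC⟩ := h.separation
      ((continuousOn_logDistSq hx₀).mono fun x hx => hx.2) isPreconnected_connectedComponentIn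
      (subset_exteriorDomain isPreconnected_connectedComponentIn
        (hsub.trans (compl_subset_compl.2 subset_union_left))
        (mem_connectedComponentIn hxmem) hκx) hx hyU
      (mem_connectedComponentIn hxmem) hjan hxr.le
      (by rw [hyN]; nlinarith)
    exact hsub huC (Or.inr (Or.inl (subset_closure ⟨u, ⟨hu, hur⟩, rfl⟩)))
  have hcont : ContinuousAt (logDistSq x₀) x₀ :=
    (continuousOn_logDistSq hx₀).continuousAt (isOpen_compl_singleton.mem_nhds hx00)
  have h0 : logDistSq x₀ x₀ < r ^ 2 := by
    rw [logDistSq, div_self hx00, Complex.log_one, norm_zero]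
    nlinarith
  obtain ⟨δ, hδ, hδx⟩ := Metric.eventually_nhds_iff.1 (hcont.eventually_lt_const h0)
  exact ⟨δ, hδ, q, fun x hx hxx => hkey x hx (hδx hxx)⟩

end DiscMap

namespace DiscMap

variable {Γ : Set ℂ} {c : ℝ} {K : ℂ → ℂ}

lemma congr (h : DiscMap Γ c K) {K' : ℂ → ℂ} (hK : EqOn K' K (Metric.ball 0 1)) :
    DiscMap Γ c K' := by
  have hU : EqOn (fun x => K' x / x) (fun x => K x / x) (Metric.ball 0 1 \ {0}) := fun x hx => by
    simp only [hK hx.1]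
  refine ⟨h.cpos, h.compact, h.diff.congr hK, ?_, h.inj.congr hU.symm, ?_, ?_, ?_⟩
  · rw [hK (Metric.mem_ball_self one_pos), h.zero]
  · rw [hU.image_eq, h.image]
  · intro x hx
    rw [hK hx, (hK.eventuallyEq_of_mem (Metric.isOpen_ball.mem_nhds hx)).deriv_eq]
    exact h.deriv_ne x hx
  · intro ε hε
    obtain ⟨ρ, h0, h1, h2⟩ := h.bdry ε hε
    exact ⟨ρ, h0, h1, fun x hx hxρ => by rw [hK hx]; exact h2 x hx hxρ⟩

lemma exists_tendsto (h : DiscMap Γ c K) (hΓ : IsJordanCurve Γ) {x₀ : ℂ}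
    (hx₀ : x₀ ∈ Metric.closedBall (0 : ℂ) 1) :
    ∃ y, Tendsto K (𝓝[Metric.ball 0 1] x₀) (𝓝 y) := by
  rcases lt_or_eq_of_le (mem_closedBall_zero_iff.1 hx₀) with hlt | heq
  · exact ⟨_, h.diff.continuousOn x₀ (mem_ball_zero_iff.2 hlt)⟩
  have hx00 : x₀ ≠ 0 := by rintro rfl; simp at heq
  have hnb : (𝓝[Metric.ball (0 : ℂ) 1] x₀).NeBot := by
    rw [← mem_closure_iff_nhdsWithin_neBot, closure_ball _ one_ne_zero]
    exact hx₀
  have hcau : Cauchy (map (fun x => K x / x) (𝓝[Metric.ball (0 : ℂ) 1] x₀)) := by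
    refine Metric.cauchy_iff.2 ⟨hnb.map _, fun ε hε => ?_⟩
    obtain ⟨δ, hδ, q, hq⟩ := h.exists_small_osc hΓ heq (ε := ε / 3) (by linarith)
    refine ⟨(fun x => K x / x) '' (Metric.ball 0 1 ∩ (Metric.ball x₀ δ ∩ {0}ᶜ)),
      image_mem_map (inter_mem self_mem_nhdsWithin (mem_nhdsWithin_of_mem_nhds (inter_mem
        (Metric.ball_mem_nhds _ hδ) (isOpen_compl_singleton.mem_nhds hx00)))), ?_⟩
    rintro _ ⟨x, ⟨hx1, hx2, hx3⟩, rfl⟩ _ ⟨y, ⟨hy1, hy2, hy3⟩, rfl⟩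
    have h1 := hq x ⟨hx1, hx3⟩ hx2
    have h2 := hq y ⟨hy1, hy3⟩ hy2
    calc _ ≤ dist (K x / x) q + dist (K y / y) q := dist_triangle_right _ _ _
      _ < ε := by linarith
  obtain ⟨y, hy⟩ := cauchy_map_iff_exists_tendsto.1 hcau
  refine ⟨y * x₀, (hy.mul (tendsto_id.mono_left nhdsWithin_le_nhds)).congr' ?_⟩
  filter_upwards [mem_nhdsWithin_of_mem_nhds (isOpen_compl_singleton.mem_nhds hx00)] with x hx
  simp only [id]
  exact div_mul_cancel₀ _ hx

end DiscMap

/-- A `DiscMap` that extends continuously to the closed disc. -/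
structure ContDiscMap (Γ : Set ℂ) (c : ℝ) (K : ℂ → ℂ) : Prop extends DiscMap Γ c K where
  jordan : IsJordanCurve Γ
  cont : ContinuousOn K (Metric.closedBall 0 1)

lemma DiscMap.exists_contDiscMap {Γ : Set ℂ} {c : ℝ} {K : ℂ → ℂ} (h : DiscMap Γ c K)
    (hΓ : IsJordanCurve Γ) : ∃ K', ContDiscMap Γ c K' := by
  refine ⟨extendFrom (Metric.ball 0 1) K, h.congr fun x hx => ?_, hΓ, ?_⟩
  · exact extendFrom_eq (subset_closure hx) (h.diff.continuousOn x hx)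
  · refine continuousOn_extendFrom ?_ fun x hx => h.exists_tendsto hΓ hx
    rw [closure_ball _ one_ne_zero]

namespace ContDiscMap

variable {Γ : Set ℂ} {c : ℝ} {K : ℂ → ℂ}

lemma continuousOn_div (h : ContDiscMap Γ c K) :
    ContinuousOn (fun x => K x / x) (Metric.closedBall 0 1 \ {0}) :=
  (h.cont.mono sdiff_subset).div continuousOn_id fun _ hx => hx.2

lemma nonempty (h : ContDiscMap Γ c K) : Γ.Nonempty := by
  obtain ⟨f, -, -, -, rfl⟩ := h.jordan
  exact range_nonempty f

lemma ne_zero_of_sphere {x : ℂ} (hx : ‖x‖ = 1) : x ≠ 0 := by rintro rfl; simp at hx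

lemma sphere_mem (h : ContDiscMap Γ c K) {x : ℂ} (hx : ‖x‖ = 1) : K x / x ∈ Γ := by
  have hx0 := ne_zero_of_sphere hx
  rw [h.compact.isClosed.mem_iff_infDist_zero h.nonempty]
  refine le_antisymm (le_of_forall_pos_le_add fun ε hε => ?_) Metric.infDist_nonneg
  obtain ⟨ρ, -, h1, h2⟩ := h.bdry ε hε
  have hxc : x ∈ Metric.closedBall (0 : ℂ) 1 \ {0} := ⟨mem_closedBall_zero_iff.2 hx.le, hx0⟩
  have hc : Tendsto (fun x => K x / x) (𝓝[Metric.ball 0 1 \ {0}] x) (𝓝 (K x / x)) :=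
    (h.continuousOn_div x hxc).mono_left
      (nhdsWithin_mono _ (sdiff_subset_sdiff_left Metric.ball_subset_closedBall))
  have hnb : (𝓝[Metric.ball (0 : ℂ) 1 \ {0}] x).NeBot := by
    have : 𝓝[Metric.ball (0 : ℂ) 1 \ {0}] x = 𝓝[Metric.ball (0 : ℂ) 1] x := by
      rw [sdiff_eq]
      exact nhdsWithin_inter_of_mem' (mem_nhdsWithin_of_mem_nhds
        (isOpen_compl_singleton.mem_nhds hx0))
    rw [this, ← mem_closure_iff_nhdsWithin_neBot, closure_ball _ one_ne_zero]
    exact hxc.1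
  have hc' := (Metric.continuous_infDist_pt Γ).continuousAt.tendsto.comp hc
  refine le_of_tendsto hc' ?_
  filter_upwards [self_mem_nhdsWithin, mem_nhdsWithin_of_mem_nhds
    ((isOpen_lt continuous_const continuous_norm).mem_nhds (show ρ < ‖x‖ by rw [hx]; exact h1))]
    with y hy hyρ
  rw [zero_add]
  exact (h2 y hy.1 hyρ).le

/-- If the boundary map is constant on a nonempty relatively open part of the circle,
then we reach a contradiction. -/
lemma not_const_near (h : ContDiscMap Γ c K) {x₀ p : ℂ} (hx₀ : ‖x₀‖ = 1) {δ : ℝ} (hδ : 0 < δ)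
    (hp : ∀ x : ℂ, ‖x‖ = 1 → dist x x₀ < δ → K x / x = p) : False := by
  have hcov : Metric.sphere (0 : ℂ) 1 ⊆ ⋃ r : Metric.sphere (0 : ℂ) 1,
      (fun x => (r : ℂ) * x) ⁻¹' Metric.ball x₀ δ := by
    intro x hx
    have hx' := mem_sphere_zero_iff_norm.1 hx
    refine mem_iUnion.2 ⟨⟨x₀ / x, ?_⟩, ?_⟩
    · rw [mem_sphere_zero_iff_norm, norm_div, hx', hx₀, div_one]
    · simp only [mem_preimage]
      rw [div_mul_cancel₀ _ (ne_zero_of_sphere hx')]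
      exact Metric.mem_ball_self hδ
  obtain ⟨t, ht⟩ := (isCompact_sphere (0 : ℂ) 1).elim_finite_subcover _
    (fun r => Metric.isOpen_ball.preimage (continuous_const.mul continuous_id)) hcov
  have hr : ∀ r : Metric.sphere (0 : ℂ) 1, ∀ x : ℂ, ‖(r : ℂ) * x‖ = ‖x‖ := fun r x => by
    rw [norm_mul, mem_sphere_zero_iff_norm.1 r.2, one_mul]
  set H : ℂ → ℂ := fun x => ∏ r ∈ t, (K (r * x) - p * (r * x)) with hH
  have hHd : DiffContOnCl ℂ H (Metric.ball 0 1) := by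
    refine ⟨DifferentiableOn.fun_finsetProd fun r _ => ?_, ?_⟩
    · refine DifferentiableOn.sub (h.diff.comp (by fun_prop) fun x hx => ?_) (by fun_prop)
      rw [mem_ball_zero_iff, hr]
      exact mem_ball_zero_iff.1 hx
    · rw [closure_ball _ one_ne_zero]
      refine continuousOn_finsetProd _ fun r _ => ?_
      refine ContinuousOn.sub (h.cont.comp (by fun_prop) fun x hx => ?_) (by fun_prop)
      rw [mem_closedBall_zero_iff, hr]
      exact mem_closedBall_zero_iff.1 hx
  have hH0 : H 0 ≠ 0 := by
    simp only [hH, mul_zero, sub_zero, Finset.prod_const, h.zero]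
    exact pow_ne_zero _ (Complex.ofReal_ne_zero.2 h.cpos.ne')
  have hHs : ∀ x ∈ frontier (Metric.ball (0 : ℂ) 1), ‖H x‖ ≤ 0 := by
    intro x hx
    rw [frontier_ball _ one_ne_zero] at hx
    obtain ⟨r, hrt, hrx⟩ := mem_iUnion₂.1 (ht hx)
    have h1 : ‖(r : ℂ) * x‖ = 1 := by rw [hr, mem_sphere_zero_iff_norm.1 hx]
    have h2 := hp _ h1 hrx
    rw [div_eq_iff (ne_zero_of_sphere h1)] at h2
    rw [hH]
    simp only
    rw [Finset.prod_eq_zero hrt (by rw [h2, sub_self]), norm_zero]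
  have := Complex.norm_le_of_forall_mem_frontier_norm_le Metric.isBounded_ball hHd hHs
    (subset_closure (Metric.mem_ball_self one_pos))
  exact hH0 (norm_le_zero_iff.1 this)

end ContDiscMap

lemma IsJordanCurve.isPreconnected_sdiff_singleton {Γ : Set ℂ} (hΓ : IsJordanCurve Γ) {p : ℂ}
    (hp : p ∈ Γ) : IsPreconnected (Γ \ {p}) := by
  obtain ⟨f, hf, hper, hinj, rfl⟩ := hΓ
  obtain ⟨s₀, rfl⟩ := hp
  have h2π : 0 < 2 * Real.pi := by positivity
  have : range f \ {f s₀} = f '' Ioo s₀ (s₀ + 2 * Real.pi) := by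
    ext q
    constructor
    · rintro ⟨⟨s', rfl⟩, hq⟩
      obtain ⟨s, hs, hss⟩ := hper.exists_mem_Ico h2π s' s₀
      rw [hss] at hq ⊢
      refine ⟨s, ⟨lt_of_le_of_ne hs.1 ?_, hs.2⟩, rfl⟩
      rintro rfl
      exact hq rfl
    · rintro ⟨s, hs, rfl⟩
      refine ⟨mem_range_self _, fun h => ?_⟩
      obtain ⟨n, hn⟩ := hinj _ _ (mem_singleton_iff.1 h)
      have h1 : 0 < (-n : ℝ) * (2 * Real.pi) := by linarith [hs.1]
      have h2 : (-n : ℝ) * (2 * Real.pi) < 1 * (2 * Real.pi) := by linarith [hs.2]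
      have h3 : (0 : ℝ) < -n := pos_of_mul_pos_left h1 h2π.le
      have h4 : (-n : ℝ) < 1 := lt_of_mul_lt_mul_right h2 h2π.le
      have h5 : (0 : ℤ) < -n := by exact_mod_cast h3
      have h6 : (-n : ℤ) < 1 := by exact_mod_cast h4
      omega
  rw [this]
  exact isPreconnected_Ioo.image _ hf.continuousOn

namespace ContDiscMap

variable {Γ : Set ℂ} {c : ℝ} {K : ℂ → ℂ}

/-- One of the two boundary arcs cut off by a cross-cut is mapped to a single point when the
end points of the cross-cut have the same image. -/
lemma const_on_side (h : ContDiscMap Γ c K) {N : ℂ → ℝ} (hN : Continuous N) (hN0 : N 0 ≠ 0)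
    {p : ℂ} (hp : ∀ x : ℂ, ‖x‖ = 1 → N x = 0 → K x / x = p) (hpΓ : p ∈ Γ)
    {x₁ x₂ : ℂ} (hx₁ : ‖x₁‖ = 1) (hx₂ : ‖x₂‖ = 1) (hN₁ : N x₁ < 0) (hN₂ : 0 < N x₂)
    (hκ₁ : K x₁ / x₁ ≠ p) (hκ₂ : K x₂ / x₂ ≠ p) : False := by
  set κ : ℂ → ℂ := fun x => K x / x with hκ
  set Z : Set ℂ := {x | x ∈ Metric.closedBall (0 : ℂ) 1 ∧ N x = 0} with hZ
  have hZ0 : Z ⊆ Metric.closedBall 0 1 \ {0} := fun x hx => ⟨hx.1, by rintro rfl; exact hN0 hx.2⟩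
  have hZc : IsCompact Z := (isCompact_closedBall _ _).inter_right
    (isClosed_eq hN continuous_const)
  set J := κ '' (Z) with hJ
  have hJc : IsCompact J := hZc.image_of_continuousOn (h.continuousOn_div.mono hZ0)
  have hΓJ : ∀ z ∈ Γ, z ∈ J → z = p := by
    rintro _ hzΓ ⟨x, hx, rfl⟩
    rcases lt_or_eq_of_le (mem_closedBall_zero_iff.1 hx.1) with hlt | heq
    · exact absurd hzΓ (h.mem_exteriorDomain ⟨mem_ball_zero_iff.2 hlt, (hZ0 hx).2⟩).1
    · exact hp x heq hx.2
  have hΓJpre : IsPreconnected (Γ ∩ J) := by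
    refine Set.Subsingleton.isPreconnected fun z hz w hw => ?_
    rw [hΓJ z hz.1 hz.2, hΓJ w hw.1 hw.2]
  have hside : Γ \ {p} ⊆ Jᶜ := fun z hz hzJ => hz.2 (hΓJ z hz.1 hzJ)
  have hnear : ∀ x : ℂ, ‖x‖ = 1 → κ x ≠ p → ∀ S ∈ 𝓝 x, ∃ y ∈ S, y ∈ Metric.ball (0 : ℂ) 1 \ {0} ∧
      κ y ∈ connectedComponentIn Jᶜ (κ x) := by
    intro x hx hxp S hS
    have hx0 := ne_zero_of_sphere hx
    have hxJ : κ x ∈ Jᶜ := hside ⟨h.sphere_mem hx, hxp⟩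
    have ho : connectedComponentIn Jᶜ (κ x) ∈ 𝓝 (κ x) :=
      hJc.isClosed.isOpen_compl.connectedComponentIn.mem_nhds (mem_connectedComponentIn hxJ)
    have hxc : x ∈ Metric.closedBall (0 : ℂ) 1 \ {0} := ⟨mem_closedBall_zero_iff.2 hx.le, hx0⟩
    have h1 := h.continuousOn_div x hxc ho
    rw [mem_map, mem_nhdsWithin] at h1
    obtain ⟨W, hWo, hxW, hW⟩ := h1
    have hcl : x ∈ closure (Metric.ball (0 : ℂ) 1) := by
      rw [closure_ball _ one_ne_zero]; exact hxc.1
    obtain ⟨y, hy, hyb⟩ := mem_closure_iff_nhds.1 hcl _ (inter_mem (inter_mem hS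
      (hWo.mem_nhds hxW)) (isOpen_compl_singleton.mem_nhds hx0))
    exact ⟨y, hy.1.1, ⟨hyb, hy.2⟩, hW ⟨hy.1.2, Metric.ball_subset_closedBall hyb, hy.2⟩⟩
  obtain ⟨y₁, hy₁N, hy₁, hy₁J⟩ := hnear x₁ hx₁ hκ₁ _ (hN.continuousAt.eventually_lt_const hN₁)
  obtain ⟨y₂, hy₂N, hy₂, hy₂J⟩ := hnear x₂ hx₂ hκ₂ _ (hN.continuousAt.eventually_const_lt hN₂)
  have h12 : κ x₂ ∈ connectedComponentIn Jᶜ (κ x₁) :=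
    (IsJordanCurve.isPreconnected_sdiff_singleton h.jordan hpΓ).subset_connectedComponentIn
      ⟨h.sphere_mem hx₁, hκ₁⟩ hside ⟨h.sphere_mem hx₂, hκ₂⟩
  have hy12 : κ y₂ ∈ connectedComponentIn Jᶜ (κ y₁) := by
    rw [← connectedComponentIn_eq hy₁J, connectedComponentIn_eq h12]
    exact hy₂J
  have hy₁Ω := h.mem_exteriorDomain hy₁
  have hy₂Ω := h.mem_exteriorDomain hy₂
  have hy₁J' : κ y₁ ∉ J := connectedComponentIn_subset _ _ hy₁J
  have hjan := janiszewski h.compact hJc hΓJpre hy₁Ω.1 hy₁J' (b := κ y₂)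
    (by rw [← exteriorDomain_eq h.compact hy₁Ω]; exact hy₂Ω) hy12
  have hsub := connectedComponentIn_subset (Γ ∪ J)ᶜ (κ y₁)
  have hmem : κ y₁ ∈ connectedComponentIn (Γ ∪ J)ᶜ (κ y₁) :=
    mem_connectedComponentIn (by rintro (h' | h'); exacts [hy₁Ω.1 h', hy₁J' h'])
  obtain ⟨u, hu, huN, huC⟩ := h.separation hN.continuousOn isPreconnected_connectedComponentIn
    (subset_exteriorDomain isPreconnected_connectedComponentIn
      (hsub.trans (compl_subset_compl.2 subset_union_left)) hmem hy₁Ω) hy₁ hy₂ hmem hjan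
    (le_of_lt hy₁N) (le_of_lt hy₂N)
  exact hsub huC (Or.inr ⟨u, ⟨Metric.ball_subset_closedBall hu.1, huN⟩, rfl⟩)

lemma const_side_false (h : ContDiscMap Γ c K) {N : ℂ → ℝ} (hN : Continuous N) {p : ℂ}
    {x₁ : ℂ} (hx₁ : ‖x₁‖ = 1) (hN₁ : 0 < N x₁)
    (hp : ∀ x : ℂ, ‖x‖ = 1 → 0 < N x → K x / x = p) : False := by
  obtain ⟨δ, hδ, hδ'⟩ := Metric.eventually_nhds_iff.1 (hN.continuousAt.eventually_const_lt hN₁)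
  exact h.not_const_near hx₁ hδ fun x hx hxd => hp x hx (hδ' hxd)

lemma sphere_injOn (h : ContDiscMap Γ c K) {x₁ x₂ : ℂ} (hx₁ : ‖x₁‖ = 1) (hx₂ : ‖x₂‖ = 1)
    (heq : K x₁ / x₁ = K x₂ / x₂) : x₁ = x₂ := by
  by_contra hne
  have hx₁0 := ne_zero_of_sphere hx₁
  have hx₂0 := ne_zero_of_sphere hx₂
  have hconj : ∀ y : ℂ, ‖y‖ = 1 → (starRingEnd ℂ) y = y⁻¹ := fun y hy =>
    (Complex.inv_eq_conj hy).symm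
  set v : ℂ := Complex.I * (x₂ - x₁) with hv
  have hvc : (starRingEnd ℂ) v = -Complex.I * (x₂⁻¹ - x₁⁻¹) := by
    rw [hv, map_mul, map_sub, Complex.conj_I, hconj _ hx₁, hconj _ hx₂]
  set a : ℝ := 2 * ((starRingEnd ℂ) v * x₁).re with ha
  set N : ℂ → ℝ := fun y => 2 * ((starRingEnd ℂ) v * y).re - a + (1 + |a|) * (1 - ‖y‖ ^ 2) with hN
  have hNc : Continuous N := by
    have : Continuous fun y : ℂ => ((starRingEnd ℂ) v * y).re :=
      Complex.continuous_re.comp (continuous_const.mul continuous_id)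
    rw [hN]; fun_prop
  have hN0 : N 0 ≠ 0 := by
    have : N 0 = 1 + |a| - a := by simp [hN]; ring
    rw [this]
    linarith [le_abs_self a]
  have h2re : ∀ z : ℂ, ((2 * z.re : ℝ) : ℂ) = z + (starRingEnd ℂ) z := fun z => by
    rw [Complex.add_conj]
  have hkey : ∀ y : ℂ, ‖y‖ = 1 →
      (N y : ℂ) = -Complex.I * (x₁ - x₂) / (x₁ * x₂) * (y - x₁) * (y - x₂) / y := by
    intro y hy
    have hy0 := ne_zero_of_sphere hy
    have : N y = 2 * ((starRingEnd ℂ) v * y).re - a := by simp [hN, hy]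
    rw [this, ha, Complex.ofReal_sub, h2re, h2re, map_mul _ _ y, map_mul _ _ x₁,
      Complex.conj_conj, hvc, hconj _ hy, hconj _ hx₁, hv]
    field_simp
    ring
  have hzero : ∀ y : ℂ, ‖y‖ = 1 → N y = 0 → K y / y = K x₁ / x₁ := by
    intro y hy hNy
    have hk := hkey y hy
    rw [hNy, Complex.ofReal_zero, eq_comm, div_eq_zero_iff] at hk
    rcases hk with hk | hk
    · rcases mul_eq_zero.1 hk with hk | hk
      · rcases mul_eq_zero.1 hk with hk | hk
        · exfalso
          rw [div_eq_zero_iff] at hk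
          rcases hk with hk | hk
          · rcases mul_eq_zero.1 hk with hk | hk
            · exact Complex.I_ne_zero (neg_eq_zero.1 hk)
            · exact hne (sub_eq_zero.1 hk)
          · exact mul_ne_zero hx₁0 hx₂0 hk
        · rw [sub_eq_zero.1 hk]
      · rw [sub_eq_zero.1 hk, heq]
    · exact absurd hk (ne_zero_of_sphere hy)
  obtain ⟨w, hw⟩ := IsAlgClosed.exists_pow_nat_eq (x₁ * x₂) two_pos
  have hwn : ‖w‖ = 1 := by
    have : ‖w‖ ^ 2 = 1 := by rw [← norm_pow, hw, norm_mul, hx₁, hx₂, one_mul]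
    exact (pow_eq_one_iff_of_nonneg (norm_nonneg _) two_ne_zero).1 this
  have hprod : N w * N (-w) < 0 := by
    have hw0 := ne_zero_of_sphere hwn
    have h1 : ((N w * N (-w) : ℝ) : ℂ) = -((x₁ - x₂) ^ 2 / (x₁ * x₂)) ^ 2 := by
      rw [Complex.ofReal_mul, hkey w hwn, hkey (-w) (by rw [norm_neg, hwn])]
      have h2 : -Complex.I * (x₁ - x₂) / (x₁ * x₂) * (w - x₁) * (w - x₂) / w *
          (-Complex.I * (x₁ - x₂) / (x₁ * x₂) * (-w - x₁) * (-w - x₂) / -w) =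
          Complex.I ^ 2 * (x₁ - x₂) ^ 2 / (x₁ * x₂) ^ 2 * (w ^ 2 - x₁ ^ 2) * (w ^ 2 - x₂ ^ 2) /
            (-w ^ 2) := by
        field_simp
        ring
      rw [h2, hw, Complex.I_sq]
      field_simp
      ring
    have h3 : (x₁ - x₂) ^ 2 / (x₁ * x₂) = -((‖x₁ - x₂‖ ^ 2 : ℝ) : ℂ) := by
      rw [← Complex.normSq_eq_norm_sq, ← Complex.mul_conj, map_sub, hconj _ hx₁, hconj _ hx₂]
      field_simp
      ring
    rw [h3, neg_sq, ← Complex.ofReal_pow, ← Complex.ofReal_neg] at h1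
    have h4 := Complex.ofReal_injective h1
    have h5 : 0 < ‖x₁ - x₂‖ := norm_pos_iff.2 (sub_ne_zero.2 hne)
    rw [h4]
    exact neg_neg_of_pos (by positivity)
  have hmain : ∀ u : ℂ, ‖u‖ = 1 → ‖-u‖ = 1 → 0 < N u → N (-u) < 0 → False := by
    intro u hu hu' h1 h2
    by_cases hpos : ∀ x : ℂ, ‖x‖ = 1 → 0 < N x → K x / x = K x₁ / x₁
    · exact h.const_side_false hNc hu h1 hpos
    by_cases hneg : ∀ x : ℂ, ‖x‖ = 1 → 0 < -N x → K x / x = K x₁ / x₁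
    · exact h.const_side_false hNc.neg hu' (neg_pos.2 h2) hneg
    push Not at hpos hneg
    obtain ⟨y₂, hy₂, hy₂N, hy₂κ⟩ := hpos
    obtain ⟨y₁, hy₁, hy₁N, hy₁κ⟩ := hneg
    exact h.const_on_side hNc hN0 hzero (h.sphere_mem hx₁) hy₁ hy₂ (neg_pos.1 hy₁N) hy₂N hy₁κ hy₂κ
  rcases mul_neg_iff.1 hprod with ⟨h1, h2⟩ | ⟨h1, h2⟩
  · exact hmain w hwn (by rw [norm_neg, hwn]) h1 h2
  · exact hmain (-w) (by rw [norm_neg, hwn]) (by rw [neg_neg, hwn]) h2 (by rwa [neg_neg])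

end ContDiscMap

lemma continuousOn_of_comp_continuousOn {X Y Z : Type*} [TopologicalSpace X] [TopologicalSpace Y]
    [TopologicalSpace Z] [T2Space Z] {C : Set Y} (hC : IsCompact C) {f : Y → Z}
    (hf : ContinuousOn f C) (hi : InjOn f C) {g : X → Y} {S : Set X} (hg : MapsTo g S C)
    (hfg : ContinuousOn (f ∘ g) S) : ContinuousOn g S := by
  have : CompactSpace C := isCompact_iff_compactSpace.1 hC
  have he : IsClosedEmbedding (C.domRestrict f) :=
    (continuousOn_iff_continuous_domRestrict.1 hf).isClosedEmbedding
      (injOn_iff_injective.1 hi)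
  have h1 : Continuous (fun x : S => (⟨g x, hg x.2⟩ : C)) := by
    rw [he.isInducing.continuous_iff]
    exact continuousOn_iff_continuous_domRestrict.1 hfg
  rw [continuousOn_iff_continuous_domRestrict]
  exact continuous_subtype_val.comp h1

/-- The boundary parametrization `θ ↦ κ(e^{iθ})`, where `κ x = K x / x`. -/
def bdryParam (K : ℂ → ℂ) (θ : ℝ) : ℂ :=
  K (Complex.exp (θ * Complex.I)) / Complex.exp (θ * Complex.I)

lemma exp_add_two_pi_mul_I (θ : ℝ) :
    Complex.exp ((θ + 2 * Real.pi : ℝ) * Complex.I) = Complex.exp (θ * Complex.I) := by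
  push_cast
  rw [add_mul, Complex.exp_add, Complex.exp_two_pi_mul_I, mul_one]

lemma bdryParam_periodic (K : ℂ → ℂ) : Function.Periodic (bdryParam K) (2 * Real.pi) := by
  intro θ
  simp only [bdryParam, exp_add_two_pi_mul_I]

namespace ContDiscMap

variable {Γ : Set ℂ} {c : ℝ} {K : ℂ → ℂ}

lemma continuous_bdryParam (h : ContDiscMap Γ c K) : Continuous (bdryParam K) := by
  have h1 := h.continuousOn_div.comp_continuous
    (f := fun θ : ℝ => Complex.exp (θ * Complex.I)) (by fun_prop) (fun θ => ⟨by
      rw [mem_closedBall_zero_iff, Complex.norm_exp_ofReal_mul_I], Complex.exp_ne_zero _⟩)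
  exact h1

lemma bdryParam_mem (h : ContDiscMap Γ c K) (θ : ℝ) : bdryParam K θ ∈ Γ :=
  h.sphere_mem (Complex.norm_exp_ofReal_mul_I θ)

lemma exp_eq_of_bdryParam_eq (h : ContDiscMap Γ c K) {θ θ' : ℝ}
    (heq : bdryParam K θ = bdryParam K θ') :
    Complex.exp (θ * Complex.I) = Complex.exp (θ' * Complex.I) :=
  h.sphere_injOn (Complex.norm_exp_ofReal_mul_I θ) (Complex.norm_exp_ofReal_mul_I θ') heq

lemma eq_add_of_bdryParam_eq (h : ContDiscMap Γ c K) {θ θ' : ℝ}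
    (heq : bdryParam K θ = bdryParam K θ') : ∃ n : ℤ, θ = θ' + n * (2 * Real.pi) := by
  obtain ⟨n, hn⟩ := Complex.exp_eq_exp_iff_exists_int.1 (h.exp_eq_of_bdryParam_eq heq)
  refine ⟨n, ?_⟩
  have : ((θ : ℂ)) * Complex.I = (θ' + n * (2 * Real.pi)) * Complex.I := by rw [hn]; ring
  exact_mod_cast mul_right_cancel₀ Complex.I_ne_zero this

lemma range_bdryParam (h : ContDiscMap Γ c K) : range (bdryParam K) = Γ := by
  refine Subset.antisymm (range_subset_iff.2 h.bdryParam_mem) fun p hp => ?_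
  by_contra hcon
  obtain ⟨f, hf, hper, hinj, hΓ⟩ := h.jordan
  have hpi := Real.pi_pos
  have h2π : 0 < 2 * Real.pi := by positivity
  obtain ⟨s₀, rfl⟩ := hΓ ▸ hp
  have hrc : IsCompact (range (bdryParam K)) := by
    rw [← (bdryParam_periodic K).image_Icc h2π 0]
    exact isCompact_Icc.image h.continuous_bdryParam
  set C : Set ℝ := Icc s₀ (s₀ + 2 * Real.pi) ∩ f ⁻¹' range (bdryParam K) with hC
  have hCc : IsCompact C := isCompact_Icc.inter_right (hrc.isClosed.preimage hf)
  have hCo : ∀ s ∈ C, s₀ < s ∧ s < s₀ + 2 * Real.pi := by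
    rintro s ⟨hs, hs'⟩
    refine ⟨lt_of_le_of_ne hs.1 ?_, lt_of_le_of_ne hs.2 ?_⟩
    · rintro rfl; exact hcon hs'
    · rintro rfl
      rw [mem_preimage, hper s₀] at hs'
      exact hcon hs'
  have hCi : InjOn f C := by
    intro s hs t ht hst
    obtain ⟨n, hn⟩ := hinj s t hst
    have hs' := hCo s hs
    have ht' := hCo t ht
    have h1 : (n : ℝ) < 1 := by
      by_contra! hge
      nlinarith
    have h2 : (-1 : ℝ) < n := by
      by_contra! hge
      nlinarith
    have h3 : n < 1 := by exact_mod_cast h1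
    have h4 : -1 < n := by exact_mod_cast h2
    obtain rfl : n = 0 := by omega
    simp at hn
    linarith
  have hr : ∀ θ, ∃ s ∈ C, f s = bdryParam K θ := by
    intro θ
    obtain ⟨s', hs'⟩ := hΓ ▸ h.bdryParam_mem θ
    obtain ⟨s, hs, hss⟩ := hper.exists_mem_Ico h2π s' s₀
    exact ⟨s, ⟨Ico_subset_Icc_self hs, θ, by rw [← hss, hs']⟩, by rw [← hss, hs']⟩
  choose r hrC hrf using hr
  have hrcont : Continuous r := by
    rw [← continuousOn_univ]
    refine continuousOn_of_comp_continuousOn hCc hf.continuousOn hCi (fun θ _ => hrC θ) ?_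
    have : f ∘ r = bdryParam K := funext hrf
    rw [this]
    exact h.continuous_bdryParam.continuousOn
  have hrper : ∀ θ, r (θ + 2 * Real.pi) = r θ := fun θ =>
    hCi (hrC _) (hrC _) (by rw [hrf, hrf, bdryParam_periodic K θ])
  set d : ℝ → ℝ := fun t => r t - r (t + Real.pi) with hd
  have hdc : Continuous d := by rw [hd]; fun_prop
  have hdpi : d Real.pi = -d 0 := by
    have := hrper 0
    simp only [hd, zero_add] at this ⊢
    rw [show Real.pi + Real.pi = 2 * Real.pi by ring, this]
    ring
  have hz : ∃ t, d t = 0 := by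
    rcases le_total (d 0) 0 with h0 | h0
    · obtain ⟨t, -, ht⟩ := intermediate_value_Icc hpi.le hdc.continuousOn
        (show (0 : ℝ) ∈ Icc (d 0) (d Real.pi) from ⟨h0, by rw [hdpi]; linarith⟩)
      exact ⟨t, ht⟩
    · obtain ⟨t, -, ht⟩ := intermediate_value_Icc' hpi.le hdc.continuousOn
        (show (0 : ℝ) ∈ Icc (d Real.pi) (d 0) from ⟨by rw [hdpi]; linarith, h0⟩)
      exact ⟨t, ht⟩
  obtain ⟨t, ht⟩ := hz
  have h1 : bdryParam K t = bdryParam K (t + Real.pi) := by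
    rw [← hrf, ← hrf, sub_eq_zero.1 ht]
  have h2 := h.exp_eq_of_bdryParam_eq h1
  push_cast at h2
  rw [add_mul, Complex.exp_add, Complex.exp_pi_mul_I] at h2
  have h4 : (2 : ℂ) * Complex.exp (t * Complex.I) = 0 := by linear_combination h2
  simp at h4

end ContDiscMap

lemma norm_sub_le_of_frequently {E : ℝ → ℂ} {m : ℝ → ℝ} {a b : ℝ} (hab : a ≤ b)
    (hE : ContinuousOn E (Icc a b)) (hm : ContinuousOn m (Icc a b))
    (h : ∀ t ∈ Ico a b, ∃ᶠ y in 𝓝[>] t, ‖E y - E t‖ ≤ m y - m t) :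
    ‖E b - E a‖ ≤ m b - m a := by
  set S : Set ℝ := {t | ‖E t - E a‖ ≤ m t - m a} with hS
  have hcl : IsClosed (S ∩ Icc a b) := by
    have h1 : IsClosed (Icc a b ∩ {t | ‖E t - E a‖ ≤ m t - m a}) :=
      isClosed_Icc.isClosed_le (hE.sub continuousOn_const).norm (hm.sub continuousOn_const)
    rwa [inter_comm] at h1
  have := hcl.Icc_subset_of_forall_exists_gt (a := a) (b := b) (by simp [hS]) ?_
  · exact this (right_mem_Icc.2 hab)
  · rintro x ⟨hx, hxab⟩ y hy
    have h2 := (h x hxab).and_eventually (Ioc_mem_nhdsGT hy)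
    obtain ⟨w, hw, hwy⟩ := h2.exists
    refine ⟨w, ?_, hwy⟩
    change ‖E w - E a‖ ≤ m w - m a
    calc ‖E w - E a‖ = ‖(E w - E x) + (E x - E a)‖ := by congr 1; ring
      _ ≤ ‖E w - E x‖ + ‖E x - E a‖ := norm_add_le _ _
      _ ≤ (m w - m x) + (m x - m a) := add_le_add hw hx
      _ = _ := by ring

lemma _root_.IsDiniSmoothArc.reverse {γ γ' : ℝ → ℂ} {a b : ℝ} (h : IsDiniSmoothArc γ γ' a b) :
    IsDiniSmoothArc (fun s => γ (-s)) (fun s => -γ' (-s)) (-b) (-a) := by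
  have hm : ∀ s ∈ Icc (-b) (-a), -s ∈ Icc a b := fun s hs => ⟨by linarith [hs.2], by linarith [hs.1]⟩
  refine ⟨by linarith [h.lt], ?_, ?_, ?_, ?_, ?_⟩
  · intro s hs t ht hst
    exact neg_injective (h.inj (hm s hs) (hm t ht) hst)
  · intro s hs
    have h1 := (h.deriv (-s) (hm s hs)).scomp s (hasDerivAt_neg s).hasDerivWithinAt hm
    rw [neg_one_smul] at h1
    exact h1
  · exact (h.cont.comp continuousOn_neg hm).neg
  · intro s hs
    exact neg_ne_zero.2 (h.nonzero _ (hm s hs))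
  · have : modCont (fun s => -γ' (-s)) (-b) (-a) = modCont γ' a b := by
      funext t
      unfold modCont
      congr 1
      ext d
      constructor
      · rintro ⟨s₁, h1, s₂, h2, h3, rfl⟩
        refine ⟨-s₁, hm _ h1, -s₂, hm _ h2, ?_, ?_⟩
        · rw [← abs_neg]; convert h3 using 2; ring
        · rw [← norm_neg]; congr 1; ring
      · rintro ⟨s₁, h1, s₂, h2, h3, rfl⟩
        refine ⟨-s₁, ⟨by linarith [h1.2], by linarith [h1.1]⟩, -s₂,
          ⟨by linarith [h2.2], by linarith [h2.1]⟩, ?_, ?_⟩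
        · rw [← abs_neg]; convert h3 using 2; ring
        · rw [← norm_neg]; simp only [neg_neg]; congr 1; ring
    rw [this]
    exact h.dini

/-- A Dini-smooth arc together with its increasing lift through the boundary parametrization. -/
structure Piece (K : ℂ → ℂ) where
  γ : ℝ → ℂ
  γ' : ℝ → ℂ
  a : ℝ
  b : ℝ
  τ : ℝ → ℝ
  σ : ℝ → ℝ
  arc : IsDiniSmoothArc γ γ' a b
  τ_cont : ContinuousOn τ (Icc a b)
  τ_mono : StrictMonoOn τ (Icc a b)
  β_τ : ∀ s ∈ Icc a b, bdryParam K (τ s) = γ s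
  σ_cont : Continuous σ
  σ_mono : Monotone σ
  σ_mem : ∀ θ, σ θ ∈ Icc a b
  σ_τ : ∀ s ∈ Icc a b, σ (τ s) = s
  τ_σ : ∀ θ ∈ Icc (τ a) (τ b), τ (σ θ) = θ

namespace Piece

variable {K : ℂ → ℂ}

/-- Shift the lift of a piece by a multiple of the period. -/
def shift (P : Piece K) (n : ℤ) : Piece K where
  γ := P.γ
  γ' := P.γ'
  a := P.a
  b := P.b
  τ := fun s => P.τ s + n * (2 * Real.pi)
  σ := fun θ => P.σ (θ - n * (2 * Real.pi))
  arc := P.arc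
  τ_cont := P.τ_cont.add continuousOn_const
  τ_mono := fun s hs t ht hst => by simpa using P.τ_mono hs ht hst
  β_τ := fun s hs => by
    rw [← P.β_τ s hs]
    exact (bdryParam_periodic K).int_mul n (P.τ s)
  σ_cont := P.σ_cont.comp (by fun_prop)
  σ_mono := fun θ θ' h => P.σ_mono (by linarith)
  σ_mem := fun θ => P.σ_mem _
  σ_τ := fun s hs => by rw [add_sub_cancel_right]; exact P.σ_τ s hs
  τ_σ := fun θ hθ => by
    rw [P.τ_σ _ ⟨by linarith [hθ.1], by linarith [hθ.2]⟩]
    ring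

lemma left_mem (P : Piece K) : P.a ∈ Icc P.a P.b := left_mem_Icc.2 P.arc.lt.le

lemma right_mem (P : Piece K) : P.b ∈ Icc P.a P.b := right_mem_Icc.2 P.arc.lt.le

lemma image_τ (P : Piece K) : P.τ '' Icc P.a P.b = Icc (P.τ P.a) (P.τ P.b) := by
  refine Subset.antisymm ?_ (intermediate_value_Icc P.arc.lt.le P.τ_cont)
  rintro _ ⟨s, hs, rfl⟩
  exact ⟨P.τ_mono.monotoneOn P.left_mem hs hs.1, P.τ_mono.monotoneOn hs P.right_mem hs.2⟩

lemma β_eq (P : Piece K) {θ : ℝ} (hθ : θ ∈ Icc (P.τ P.a) (P.τ P.b)) :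
    bdryParam K θ = P.γ (P.σ θ) := by
  rw [← P.β_τ _ (P.σ_mem θ), P.τ_σ θ hθ]

lemma exists_lipschitz (P : Piece K) : ∃ L : ℝ, 0 ≤ L ∧ ∀ s ∈ Icc P.a P.b, ∀ t ∈ Icc P.a P.b,
    ‖P.γ s - P.γ t‖ ≤ L * |s - t| := by
  obtain ⟨L, hL⟩ := isCompact_Icc.exists_bound_of_continuousOn P.arc.cont
  refine ⟨max L 0, le_max_right _ _, fun s hs t ht => ?_⟩
  rw [← Real.norm_eq_abs]
  exact (convex_Icc P.a P.b).norm_image_sub_le_of_norm_hasDerivWithin_le P.arc.deriv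
    (fun x hx => (hL x hx).trans (le_max_left _ _)) ht hs

end Piece

lemma ContDiscMap.exists_lift {Γ : Set ℂ} {c : ℝ} {K : ℂ → ℂ} (h : ContDiscMap Γ c K)
    {γ γ' : ℝ → ℂ} {a b : ℝ} (hγ : IsDiniSmoothArc γ γ' a b) (hγΓ : γ '' Icc a b ⊆ Γ) :
    ∃ τ : ℝ → ℝ, ContinuousOn τ (Icc a b) ∧ ∀ s ∈ Icc a b, bdryParam K (τ s) = γ s := by
  have hch : ∀ s, ∃ θ : ℝ, s ∈ Icc a b → bdryParam K θ = γ s := by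
    intro s
    by_cases hs : s ∈ Icc a b
    · have := hγΓ (mem_image_of_mem γ hs)
      rw [← h.range_bdryParam] at this
      obtain ⟨θ, hθ⟩ := this
      exact ⟨θ, fun _ => hθ⟩
    · exact ⟨0, fun h' => absurd h' hs⟩
  choose ϑ hϑ using hch
  set x : ℝ → ℂ := fun s => Complex.exp (ϑ s * Complex.I) with hx
  have hxs : ∀ s, ‖x s‖ = 1 := fun s => Complex.norm_exp_ofReal_mul_I _
  have hxc : ContinuousOn x (Icc a b) := by
    refine continuousOn_of_comp_continuousOn (C := Metric.sphere (0 : ℂ) 1)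
      (f := fun x => K x / x) (isCompact_sphere _ _) (h.continuousOn_div.mono fun y hy => ?_) ?_
      (fun s _ => mem_sphere_zero_iff_norm.2 (hxs s)) ?_
    · exact ⟨Metric.sphere_subset_closedBall hy, ne_zero_of_sphere (mem_sphere_zero_iff_norm.1 hy)⟩
    · exact fun y hy z hz hyz => h.sphere_injOn (mem_sphere_zero_iff_norm.1 hy)
        (mem_sphere_zero_iff_norm.1 hz) hyz
    · have hc : ContinuousOn γ (Icc a b) := fun s hs => (hγ.deriv s hs).continuousWithinAt
      exact hc.congr fun s hs => hϑ s hs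
  obtain ⟨L, hL, hLx⟩ := exists_log_univ (F := IccExtend hγ.lt.le ((Icc a b).domRestrict x))
    ((continuousOn_iff_continuous_domRestrict.1 hxc).Icc_extend')
    (fun s => Complex.exp_ne_zero _)
  have hLx' : ∀ s ∈ Icc a b, Complex.exp (L s) = x s := fun s hs => by
    rw [hLx, IccExtend_of_mem _ _ hs]
    rfl
  refine ⟨fun s => (L s).im, (Complex.continuous_im.comp hL).continuousOn, fun s hs => ?_⟩
  have hre : (L s).re = 0 := by
    have h1 := hxs s
    rw [← hLx' s hs, Complex.norm_exp] at h1
    exact Real.exp_eq_one_iff _ |>.1 h1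
  have h2 : Complex.exp ((L s).im * Complex.I) = x s := by
    rw [← hLx' s hs]
    congr 1
    apply Complex.ext <;> simp [hre]
  rw [bdryParam, h2]
  exact hϑ s hs

lemma ContDiscMap.exists_piece {Γ : Set ℂ} {c : ℝ} {K : ℂ → ℂ} (h : ContDiscMap Γ c K)
    {γ γ' : ℝ → ℂ} {a b : ℝ} (hγ : IsDiniSmoothArc γ γ' a b) (hγΓ : γ '' Icc a b ⊆ Γ) :
    ∃ P : Piece K, P.γ '' Icc P.a P.b = γ '' Icc a b := by
  obtain ⟨τ, hτc, hτ⟩ := h.exists_lift hγ hγΓ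
  have hτi : InjOn τ (Icc a b) := fun s hs t ht hst => hγ.inj hs ht (by
    rw [← hτ s hs, ← hτ t ht, hst])
  have hmono : ∃ (δ δ' : ℝ → ℂ) (a' b' : ℝ) (ρ : ℝ → ℝ), IsDiniSmoothArc δ δ' a' b' ∧
      ContinuousOn ρ (Icc a' b') ∧ StrictMonoOn ρ (Icc a' b') ∧
      (∀ s ∈ Icc a' b', bdryParam K (ρ s) = δ s) ∧ δ '' Icc a' b' = γ '' Icc a b := by
    rcases hτc.strictMonoOn_of_injOn_Icc' hγ.lt.le hτi with hm | hm
    · exact ⟨γ, γ', a, b, τ, hγ, hτc, hm, hτ, rfl⟩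
    · have hmem : ∀ s ∈ Icc (-b) (-a), -s ∈ Icc a b := fun s hs =>
        ⟨by linarith [hs.2], by linarith [hs.1]⟩
      refine ⟨_, _, -b, -a, fun s => τ (-s), hγ.reverse, hτc.comp continuousOn_neg hmem,
        fun s hs t ht hst => hm (hmem t ht) (hmem s hs) (neg_lt_neg hst),
        fun s hs => hτ _ (hmem s hs), ?_⟩
      change (γ ∘ Neg.neg) '' Icc (-b) (-a) = _
      rw [image_comp, image_neg_eq_neg, neg_Icc, neg_neg, neg_neg]
  obtain ⟨δ, δ', a', b', ρ, hδ, hρc, hρm, hρ, him⟩ := hmono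
  have hle := hδ.lt.le
  have hρab : ρ a' ≤ ρ b' := hρm.monotoneOn (left_mem_Icc.2 hle) (right_mem_Icc.2 hle) hle
  have hsurj : Icc (ρ a') (ρ b') ⊆ ρ '' Icc a' b' := intermediate_value_Icc hle hρc
  have hσ : ∀ θ : ℝ, ∃ s ∈ Icc a' b', ρ s = projIcc (ρ a') (ρ b') hρab θ := fun θ =>
    hsurj (projIcc (ρ a') (ρ b') hρab θ).2
  choose σ hσm hσe using hσ
  refine ⟨⟨δ, δ', a', b', ρ, σ, hδ, hρc, hρm, hρ, ?_, ?_, hσm, ?_, ?_⟩, him⟩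
  · rw [← continuousOn_univ]
    refine continuousOn_of_comp_continuousOn isCompact_Icc hρc hρm.injOn (fun θ _ => hσm θ) ?_
    have : ρ ∘ σ = fun θ => (projIcc (ρ a') (ρ b') hρab θ : ℝ) := funext hσe
    rw [this]
    exact (continuous_subtype_val.comp continuous_projIcc).continuousOn
  · intro θ θ' hθ
    rw [← hρm.le_iff_le (hσm θ) (hσm θ'), hσe, hσe]
    exact monotone_projIcc hρab hθ
  · intro s hs
    refine hρm.injOn (hσm _) hs ?_
    rw [hσe, projIcc_of_mem hρab ⟨hρm.monotoneOn (left_mem_Icc.2 hle) hs hs.1,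
      hρm.monotoneOn hs (right_mem_Icc.2 hle) hs.2⟩]
  · intro θ hθ
    rw [hσe, projIcc_of_mem hρab hθ]

/-- Finitely many pieces cover any bounded window. -/
lemma ContDiscMap.exists_pieces {Γ : Set ℂ} {c : ℝ} {K : ℂ → ℂ} (h : ContDiscMap Γ c K)
    (hΓ : IsPiecewiseDiniSmoothJordanCurve Γ) (M : ℝ) :
    ∃ (ι : Type) (_ : Fintype ι) (P : ι → Piece K),
      ∀ θ ∈ Icc (-M) M, ∃ i, θ ∈ Icc ((P i).τ (P i).a) ((P i).τ (P i).b) := by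
  obtain ⟨-, N, γ, γ', a, b, harc, hun⟩ := hΓ
  have hsub : ∀ i, γ i '' Icc (a i) (b i) ⊆ Γ := fun i => by
    rw [hun]; exact subset_iUnion (fun i => γ i '' Icc (a i) (b i)) i
  choose P hP using fun i => h.exists_piece (harc i) (hsub i)
  have hbd : ∃ B : ℝ, ∀ i, ∀ s ∈ Icc (P i).a (P i).b, |(P i).τ s| ≤ B := by
    choose B hB using fun i => isCompact_Icc.exists_bound_of_continuousOn (P i).τ_cont
    refine ⟨∑ i, |B i|, fun i s hs => (hB i s hs).trans ((le_abs_self _).trans ?_)⟩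
    exact Finset.single_le_sum (f := fun i => |B i|) (fun i _ => abs_nonneg _) (Finset.mem_univ i)
  obtain ⟨B, hB⟩ := hbd
  obtain ⟨m, hm⟩ := exists_nat_gt (M + B)
  refine ⟨Fin N × (Finset.Icc (-(m : ℤ)) m), inferInstance, fun j => (P j.1).shift j.2, ?_⟩
  intro θ hθ
  have hβ : bdryParam K θ ∈ ⋃ i, γ i '' Icc (a i) (b i) := hun ▸ h.bdryParam_mem θ
  obtain ⟨i, hi⟩ := mem_iUnion.1 hβ
  rw [← hP i] at hi
  obtain ⟨s, hs, hsθ⟩ := hi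
  rw [← (P i).β_τ s hs] at hsθ
  obtain ⟨n, hn⟩ := h.eq_add_of_bdryParam_eq hsθ.symm
  have hnm : |(n : ℝ)| ≤ m := by
    have h1 : |(n : ℝ) * (2 * Real.pi)| ≤ M + B := by
      rw [show (n : ℝ) * (2 * Real.pi) = θ - (P i).τ s by rw [hn]; ring]
      exact (abs_sub _ _).trans (add_le_add (abs_le.2 hθ) (hB i s hs))
    rw [abs_mul, abs_of_pos (by positivity : 0 < 2 * Real.pi)] at h1
    nlinarith [abs_nonneg (n : ℝ), Real.pi_gt_three]
  have hn' : n ∈ Finset.Icc (-(m : ℤ)) m := by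
    rw [abs_le] at hnm
    rw [Finset.mem_Icc]
    exact ⟨by exact_mod_cast hnm.1, by exact_mod_cast hnm.2⟩
  refine ⟨(i, ⟨n, hn'⟩), ?_⟩
  rw [← Piece.image_τ]
  exact ⟨s, hs, hn.symm⟩

/-- The boundary parametrization is dominated by a continuous monotone function. -/
lemma ContDiscMap.exists_dominating {Γ : Set ℂ} {c : ℝ} {K : ℂ → ℂ} (h : ContDiscMap Γ c K)
    (hΓ : IsPiecewiseDiniSmoothJordanCurve Γ) (M : ℝ) :
    ∃ g : ℝ → ℝ, Continuous g ∧ Monotone g ∧ ∀ θ ∈ Icc (-M) M, ∀ θ' ∈ Icc (-M) M, θ ≤ θ' →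
      ‖bdryParam K θ' - bdryParam K θ‖ ≤ g θ' - g θ := by
  obtain ⟨ι, _, P, hP⟩ := h.exists_pieces hΓ M
  choose L hL0 hL using fun i => (P i).exists_lipschitz
  refine ⟨fun θ => ∑ i, L i * (P i).σ θ, ?_, ?_, ?_⟩
  · exact continuous_finsetSum _ fun i _ => continuous_const.mul (P i).σ_cont
  · exact fun θ θ' hθ => Finset.sum_le_sum fun i _ =>
      mul_le_mul_of_nonneg_left ((P i).σ_mono hθ) (hL0 i)
  intro θ hθ θ' hθ' hle
  refine norm_sub_le_of_frequently hle h.continuous_bdryParam.continuousOn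
    (continuous_finsetSum _ fun i _ => continuous_const.mul (P i).σ_cont).continuousOn ?_
  intro t ht
  have hex : ∃ i, ∃ᶠ y in 𝓝[>] t, y ∈ Icc ((P i).τ (P i).a) ((P i).τ (P i).b) := by
    by_contra! hcon
    have h1 : ∀ᶠ y in 𝓝[>] t, ∀ i, y ∉ Icc ((P i).τ (P i).a) ((P i).τ (P i).b) :=
      eventually_all.2 hcon
    obtain ⟨y, hy, hyt⟩ := (h1.and (Ioc_mem_nhdsGT ht.2)).exists
    obtain ⟨i, hi⟩ := hP y ⟨by linarith [hθ.1, ht.1, hyt.1], by linarith [hθ'.2, hyt.2]⟩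
    exact hy i hi
  obtain ⟨i, hi⟩ := hex
  have hti : t ∈ Icc ((P i).τ (P i).a) ((P i).τ (P i).b) := by
    refine isClosed_Icc.mem_of_frequently_of_tendsto hi ?_
    exact tendsto_id.mono_left nhdsWithin_le_nhds
  refine (hi.and_eventually self_mem_nhdsWithin).mono fun y hy => ?_
  have hty : t ≤ y := le_of_lt hy.2
  rw [(P i).β_eq hy.1, (P i).β_eq hti, ← Finset.sum_sub_distrib]
  have hσ := (P i).σ_mono hty
  calc _ ≤ L i * |(P i).σ y - (P i).σ t| := hL i _ ((P i).σ_mem _) _ ((P i).σ_mem _)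
    _ = L i * (P i).σ y - L i * (P i).σ t := by rw [abs_of_nonneg (by linarith)]; ring
    _ ≤ _ := Finset.single_le_sum (f := fun i => L i * (P i).σ y - L i * (P i).σ t)
        (fun j _ => sub_nonneg.2 (mul_le_mul_of_nonneg_left ((P j).σ_mono hty) (hL0 j)))
        (Finset.mem_univ i)

lemma exists_log_ball {f : ℂ → ℂ} (hf : DifferentiableOn ℂ f (Metric.ball 0 1))
    (h0 : ∀ x ∈ Metric.ball (0 : ℂ) 1, f x ≠ 0) :
    ∃ L : ℂ → ℂ, DifferentiableOn ℂ L (Metric.ball 0 1) ∧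
      ∀ x ∈ Metric.ball (0 : ℂ) 1, Complex.exp (L x) = f x := by
  have hd : DifferentiableOn ℂ (fun x => deriv f x / f x) (Metric.ball 0 1) :=
    (hf.deriv Metric.isOpen_ball).div hf h0
  obtain ⟨g, hg⟩ := hd.isExactOn_ball
  have h00 : (0 : ℂ) ∈ Metric.ball (0 : ℂ) 1 := by simp
  have hq : ∀ x ∈ Metric.ball (0 : ℂ) 1,
      HasDerivAt (fun x => f x * Complex.exp (-g x)) 0 x := by
    intro x hx
    have h1 := (hf.differentiableAt (Metric.isOpen_ball.mem_nhds hx)).hasDerivAt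
    have h2 := h1.mul (hg x hx).neg.cexp
    refine h2.congr_deriv ?_
    have := h0 x hx
    field_simp
    simp
  have hconst : ∀ x ∈ Metric.ball (0 : ℂ) 1,
      f x * Complex.exp (-g x) = f 0 * Complex.exp (-g 0) := by
    intro x hx
    exact Metric.isOpen_ball.is_const_of_deriv_eq_zero (convex_ball _ _).isPreconnected
      (fun y hy => (hq y hy).differentiableAt.differentiableWithinAt)
      (fun y hy => (hq y hy).deriv) hx h00
  refine ⟨fun x => g x + (Complex.log (f 0 * Complex.exp (-g 0))), fun x hx =>
    ((hg x hx).differentiableAt.add_const _).differentiableWithinAt, fun x hx => ?_⟩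
  have hne : f 0 * Complex.exp (-g 0) ≠ 0 := mul_ne_zero (h0 0 h00) (Complex.exp_ne_zero _)
  rw [Complex.exp_add, Complex.exp_log hne, ← hconst x hx, Complex.exp_neg]
  have := Complex.exp_ne_zero (g x)
  field_simp

lemma integral_exp_pow_mul_conj (j k : ℕ) :
    ∫ θ in (0 : ℝ)..2 * Real.pi, Complex.exp (θ * Complex.I) ^ j *
      (starRingEnd ℂ) (Complex.exp (θ * Complex.I) ^ k) = if j = k then 2 * (Real.pi : ℂ) else 0 := by
  have h1 : ∀ θ : ℝ, Complex.exp (θ * Complex.I) ^ j *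
      (starRingEnd ℂ) (Complex.exp (θ * Complex.I) ^ k)
      = Complex.exp ((((j : ℂ) - k) * Complex.I) * θ) := by
    intro θ
    rw [map_pow, ← Complex.exp_conj, ← Complex.exp_nat_mul, ← Complex.exp_nat_mul,
      ← Complex.exp_add]
    congr 1
    simp
    ring
  simp_rw [h1]
  split_ifs with h
  · subst h; simp
  · have hjk : ((j : ℂ) - k) * Complex.I ≠ 0 := by
      refine mul_ne_zero (sub_ne_zero.2 ?_) Complex.I_ne_zero
      exact_mod_cast h
    rw [integral_exp_mul_complex hjk]
    have : Complex.exp (((j : ℂ) - k) * Complex.I * ((2 * Real.pi : ℝ) : ℂ)) = 1 := by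
      rw [Complex.exp_eq_one_iff]
      exact ⟨(j : ℤ) - k, by push_cast; ring⟩
    rw [this]; simp

lemma hasSum_integral_mul {a : ℕ → ℂ} (ha : Summable fun k => ‖a k‖) {f S : ℝ → ℂ}
    (hf : Continuous f)
    (hS : ∀ θ : ℝ, HasSum (fun k => a k * Complex.exp (θ * Complex.I) ^ k) (S θ)) :
    HasSum (fun k => ∫ θ in (0 : ℝ)..2 * Real.pi, f θ * (a k * Complex.exp (θ * Complex.I) ^ k))
      (∫ θ in (0 : ℝ)..2 * Real.pi, f θ * S θ) := by
  refine intervalIntegral.hasSum_integral_of_dominated_convergence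
    (fun k θ => ‖f θ‖ * ‖a k‖) (fun k => ?_) (fun k => ?_) ?_ ?_ ?_
  · exact (by fun_prop : Continuous fun θ : ℝ =>
      f θ * (a k * Complex.exp (θ * Complex.I) ^ k)).aestronglyMeasurable
  · refine Eventually.of_forall fun θ _ => ?_
    simp [Complex.norm_exp_ofReal_mul_I]
  · exact Eventually.of_forall fun θ _ => ha.mul_left _
  · simp_rw [tsum_mul_left]
    exact (hf.norm.mul continuous_const).intervalIntegrable _ _
  · exact Eventually.of_forall fun θ _ => (hS θ).mul_left _

lemma hasSum_integral_norm_sq {a : ℕ → ℂ} (ha : Summable fun k => ‖a k‖) {S : ℝ → ℂ}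
    (hc : Continuous S)
    (hS : ∀ θ : ℝ, HasSum (fun k => a k * Complex.exp (θ * Complex.I) ^ k) (S θ)) :
    HasSum (fun k => 2 * Real.pi * ‖a k‖ ^ 2)
      (∫ θ in (0 : ℝ)..2 * Real.pi, ‖S θ‖ ^ 2) := by
  have hcoef : ∀ k : ℕ, ∫ θ in (0 : ℝ)..2 * Real.pi,
      (starRingEnd ℂ) (Complex.exp (θ * Complex.I) ^ k) * S θ = 2 * Real.pi * a k := by
    intro k
    have h1 := hasSum_integral_mul ha (f := fun θ : ℝ =>
      (starRingEnd ℂ) (Complex.exp (θ * Complex.I) ^ k)) (by fun_prop) hS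
    refine h1.unique ?_
    have h2 : ∀ j : ℕ, (∫ θ in (0 : ℝ)..2 * Real.pi,
        (starRingEnd ℂ) (Complex.exp (θ * Complex.I) ^ k) *
          (a j * Complex.exp (θ * Complex.I) ^ j)) = a j * if j = k then 2 * (Real.pi : ℂ) else 0 := by
      intro j
      rw [← integral_exp_pow_mul_conj, ← intervalIntegral.integral_const_mul]
      congr 1; ext θ; ring
    simp_rw [h2]
    have h3 := hasSum_single (f := fun j => a j * if j = k then 2 * (Real.pi : ℂ) else 0) k
      (by intro j hj; simp [hj])
    simpa [mul_comm] using h3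
  have h4 := hasSum_integral_mul ha (f := fun θ : ℝ => (starRingEnd ℂ) (S θ))
    (Complex.continuous_conj.comp hc) hS
  have h5 : ∀ k : ℕ, (∫ θ in (0 : ℝ)..2 * Real.pi,
      (starRingEnd ℂ) (S θ) * (a k * Complex.exp (θ * Complex.I) ^ k)) =
      ((2 * Real.pi * ‖a k‖ ^ 2 : ℝ) : ℂ) := by
    intro k
    have h6 : ∀ θ : ℝ, (starRingEnd ℂ) (S θ) * (a k * Complex.exp (θ * Complex.I) ^ k) =
        a k * (starRingEnd ℂ) ((starRingEnd ℂ) (Complex.exp (θ * Complex.I) ^ k) * S θ) := by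
      intro θ
      simp only [map_mul, Complex.conj_conj]; ring
    simp_rw [h6]
    rw [intervalIntegral.integral_const_mul, intervalIntegral.intervalIntegral_conj, hcoef]
    simp only [map_mul, Complex.conj_ofReal]
    have : (starRingEnd ℂ) 2 = 2 := Complex.conj_ofNat 2
    rw [this]
    push_cast
    rw [← Complex.conj_mul' (a k)]
    ring
  have h7 : (∫ θ in (0 : ℝ)..2 * Real.pi, (starRingEnd ℂ) (S θ) * S θ) =
      ((∫ θ in (0 : ℝ)..2 * Real.pi, ‖S θ‖ ^ 2 : ℝ) : ℂ) := by
    rw [← intervalIntegral.integral_ofReal]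
    congr 1; ext θ
    rw [Complex.conj_mul']; push_cast; rfl
  simp_rw [h5] at h4
  rw [h7] at h4
  exact_mod_cast h4

lemma exists_L1_limit {F : ℝ → ℝ → ℂ} {a b : ℝ}
    (hint : ∀ r ∈ Ioo (0 : ℝ) 1, IntegrableOn (F r) (Ioc a b))
    (hc : ∀ ε > 0, ∃ ρ, 0 < ρ ∧ ρ < 1 ∧ ∀ r ∈ Ioo ρ 1, ∀ s ∈ Ioo ρ 1,
      ∫ θ in Ioc a b, ‖F r θ - F s θ‖ < ε) :
    ∃ d : ℝ → ℂ, IntegrableOn d (Ioc a b) ∧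
      Tendsto (fun r => ∫ θ in Ioc a b, ‖F r θ - d θ‖) (𝓝[<] 1) (𝓝 0) := by
  classical
  let μ : Measure ℝ := volume.restrict (Ioc a b)
  let Φ : ℝ → (ℝ →₁[μ] ℂ) := fun r => if h : r ∈ Ioo (0 : ℝ) 1 then (hint r h).toL1 (F r) else 0
  have hdist : ∀ (f g : ℝ → ℂ) (hf : Integrable f μ) (hg : Integrable g μ),
      dist (hf.toL1 f) (hg.toL1 g) = ∫ θ, ‖f θ - g θ‖ ∂μ := by
    intro f g hf hg
    rw [dist_eq_norm, ← Integrable.toL1_sub f g hf hg, L1.norm_eq_integral_norm]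
    refine integral_congr_ae ?_
    filter_upwards [(hf.sub hg).coeFn_toL1] with θ hθ
    rw [hθ]; rfl
  have hcau : Cauchy (map Φ (𝓝[<] 1)) := by
    rw [Metric.cauchy_iff]
    refine ⟨inferInstance, fun ε hε => ?_⟩
    obtain ⟨ρ, h0, h1, h⟩ := hc ε hε
    refine ⟨Φ '' Ioo ρ 1, image_mem_map (Ioo_mem_nhdsLT h1), ?_⟩
    rintro _ ⟨r, hr, rfl⟩ _ ⟨s, hs, rfl⟩
    have hr' : r ∈ Ioo (0 : ℝ) 1 := ⟨h0.trans hr.1, hr.2⟩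
    have hs' : s ∈ Ioo (0 : ℝ) 1 := ⟨h0.trans hs.1, hs.2⟩
    simp only [Φ, dif_pos hr', dif_pos hs']
    exact (hdist _ _ _ _).trans_lt (h r hr s hs)
  obtain ⟨d, hd⟩ := cauchy_map_iff_exists_tendsto.1 hcau
  refine ⟨d, L1.integrable_coeFn d, ?_⟩
  have h1 := tendsto_iff_dist_tendsto_zero.1 hd
  refine h1.congr' ?_
  filter_upwards [Ioo_mem_nhdsLT (zero_lt_one (α := ℝ))] with r hr
  simp only [Φ, dif_pos hr]
  conv_lhs => rw [← Integrable.toL1_coeFn d (L1.integrable_coeFn d)]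
  exact hdist _ _ _ _

lemma exists_hasSum_circle {G : ℂ → ℂ} (hG : DifferentiableOn ℂ G (Metric.ball 0 1)) :
    ∃ g : ℕ → ℂ, ∀ r : ℝ, 0 < r → r < 1 → (Summable fun k => ‖g k * (r : ℂ) ^ k‖) ∧
      ∀ θ : ℝ, HasSum (fun k => (g k * (r : ℂ) ^ k) * Complex.exp (θ * Complex.I) ^ k)
        (G (r * Complex.exp (θ * Complex.I))) := by
  refine ⟨fun k => ((k.factorial : ℂ))⁻¹ * iteratedDeriv k G 0, fun r hr0 hr1 => ?_⟩
  have key : ∀ θ : ℝ, HasSum (fun k => (((k.factorial : ℂ))⁻¹ * iteratedDeriv k G 0 * (r : ℂ) ^ k) *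
      Complex.exp (θ * Complex.I) ^ k) (G (r * Complex.exp (θ * Complex.I))) := by
    intro θ
    have hz : (r : ℂ) * Complex.exp (θ * Complex.I) ∈ Metric.ball (0 : ℂ) 1 := by
      simp [Complex.norm_exp_ofReal_mul_I, abs_of_pos hr0, hr1]
    have h := Complex.hasSum_taylorSeries_on_ball hG hz
    simp only [sub_zero, smul_eq_mul] at h
    have hk : (fun k => (((k.factorial : ℂ))⁻¹ * iteratedDeriv k G 0 * (r : ℂ) ^ k) *
        Complex.exp (θ * Complex.I) ^ k) = fun n : ℕ => ((n.factorial : ℂ))⁻¹ *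
        (((r : ℂ) * Complex.exp (θ * Complex.I)) ^ n * iteratedDeriv n G 0) := by
      ext k; ring
    rw [hk]; exact h
  refine ⟨?_, key⟩
  have h := (key 0).summable.norm
  simpa using h

lemma circle_mem {r : ℝ} (hr0 : 0 < r) (hr1 : r < 1) (θ : ℝ) :
    (r : ℂ) * Complex.exp (θ * Complex.I) ∈ Metric.ball (0 : ℂ) 1 := by
  simp [Complex.norm_exp_ofReal_mul_I, abs_of_pos hr0, hr1]

lemma continuous_circle {G : ℂ → ℂ} (hG : ContinuousOn G (Metric.ball 0 1)) {r : ℝ}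
    (hr0 : 0 < r) (hr1 : r < 1) : Continuous fun θ : ℝ => G (r * Complex.exp (θ * Complex.I)) :=
  hG.comp_continuous (by fun_prop) (circle_mem hr0 hr1)

lemma H2_cauchy {G : ℂ → ℂ} (hG : DifferentiableOn ℂ G (Metric.ball 0 1)) {C : ℝ}
    (hC : ∀ r : ℝ, 0 < r → r < 1 →
      ∫ θ in (0 : ℝ)..2 * Real.pi, ‖G (r * Complex.exp (θ * Complex.I))‖ ^ 2 ≤ C) :
    ∀ ε > 0, ∃ ρ : ℝ, 0 < ρ ∧ ρ < 1 ∧ ∀ r ∈ Ioo ρ 1, ∀ s ∈ Ioo ρ 1,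
      ∫ θ in (0 : ℝ)..2 * Real.pi, ‖G (r * Complex.exp (θ * Complex.I)) -
        G (s * Complex.exp (θ * Complex.I))‖ ^ 2 < ε := by
  obtain ⟨g, hg⟩ := exists_hasSum_circle hG
  have hpi := Real.pi_pos
  have hsum : Summable fun k => 2 * Real.pi * ‖g k‖ ^ 2 := by
    refine summable_of_sum_le (c := C) (fun k => by positivity) fun u => ?_
    have h1 : ∀ᶠ r : ℝ in 𝓝[<] 1, ∑ k ∈ u, 2 * Real.pi * ‖g k * (r : ℂ) ^ k‖ ^ 2 ≤ C := by
      filter_upwards [Ioo_mem_nhdsLT (zero_lt_one (α := ℝ))] with r hr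
      have h2 := hasSum_integral_norm_sq (hg r hr.1 hr.2).1
        (continuous_circle hG.continuousOn hr.1 hr.2) (hg r hr.1 hr.2).2
      exact (sum_le_hasSum u (fun k _ => by positivity) h2).trans (hC r hr.1 hr.2)
    have h3 : Tendsto (fun r : ℝ => ∑ k ∈ u, 2 * Real.pi * ‖g k * (r : ℂ) ^ k‖ ^ 2) (𝓝[<] 1)
        (𝓝 (∑ k ∈ u, 2 * Real.pi * ‖g k * ((1 : ℝ) : ℂ) ^ k‖ ^ 2)) :=
      tendsto_nhdsWithin_of_tendsto_nhds
        ((by fun_prop : Continuous fun r : ℝ => ∑ k ∈ u, 2 * Real.pi * ‖g k * (r : ℂ) ^ k‖ ^ 2).tendsto 1)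
    have h4 := le_of_tendsto h3 h1
    simpa using h4
  have hlim : Tendsto (fun p : ℝ × ℝ => ∑' k, 2 * Real.pi *
      ‖g k * (p.1 : ℂ) ^ k - g k * (p.2 : ℂ) ^ k‖ ^ 2) (𝓝[<] 1 ×ˢ 𝓝[<] 1) (𝓝 (∑' _ : ℕ, (0 : ℝ))) := by
    refine tendsto_tsum_of_dominated_convergence (hsum.mul_left 4) (fun k => ?_) ?_
    · have hc : Continuous fun p : ℝ × ℝ => 2 * Real.pi *
        ‖g k * (p.1 : ℂ) ^ k - g k * (p.2 : ℂ) ^ k‖ ^ 2 := by fun_prop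
      have := hc.tendsto (1, 1)
      simp only [sub_self, norm_zero] at this
      simp only [ne_eq, OfNat.ofNat_ne_zero, not_false_eq_true, zero_pow, mul_zero] at this
      refine this.mono_left ?_
      rw [nhds_prod_eq]
      exact Filter.prod_mono nhdsWithin_le_nhds nhdsWithin_le_nhds
    · have hm : Ioo (0 : ℝ) 1 ×ˢ Ioo (0 : ℝ) 1 ∈ (𝓝[<] (1 : ℝ)) ×ˢ (𝓝[<] (1 : ℝ)) :=
        prod_mem_prod (Ioo_mem_nhdsLT zero_lt_one) (Ioo_mem_nhdsLT zero_lt_one)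
      filter_upwards [hm] with p hp k
      obtain ⟨⟨h1, h2⟩, h3, h4⟩ := hp
      have hb : ∀ q : ℝ, 0 < q → q < 1 → ‖g k * (q : ℂ) ^ k‖ ≤ ‖g k‖ := by
        intro q hq0 hq1
        rw [norm_mul, norm_pow, Complex.norm_real, Real.norm_eq_abs, abs_of_pos hq0]
        exact mul_le_of_le_one_right (norm_nonneg _) (pow_le_one₀ hq0.le hq1.le)
      have h5 : ‖g k * (p.1 : ℂ) ^ k - g k * (p.2 : ℂ) ^ k‖ ≤ 2 * ‖g k‖ :=
        (norm_sub_le _ _).trans (by linarith [hb p.1 h1 h2, hb p.2 h3 h4])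
      rw [Real.norm_of_nonneg (by positivity)]
      have h6 := pow_le_pow_left₀ (norm_nonneg _) h5 2
      nlinarith
  rw [tsum_zero] at hlim
  intro ε hε
  have h1 := hlim.eventually_lt_const hε
  rw [Filter.eventually_iff, mem_prod_iff] at h1
  obtain ⟨t₁, ht₁, t₂, ht₂, hsub⟩ := h1
  obtain ⟨l, hl, hl'⟩ := (mem_nhdsLT_iff_exists_Ioo_subset' (zero_lt_one (α := ℝ))).1 (inter_mem ht₁ ht₂)
  refine ⟨max l (1 / 2), by positivity, max_lt hl (by norm_num), fun r hr s hs => ?_⟩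
  have hr' := hl' (⟨(le_max_left _ _).trans_lt hr.1, hr.2⟩ : r ∈ Ioo l 1)
  have hs' := hl' (⟨(le_max_left _ _).trans_lt hs.1, hs.2⟩ : s ∈ Ioo l 1)
  have h2 : ((r, s) : ℝ × ℝ) ∈ t₁ ×ˢ t₂ := ⟨hr'.1, hs'.2⟩
  have h3 := hsub h2
  simp only [mem_ofPred_eq] at h3
  have hr0 : 0 < r := lt_of_lt_of_le (by norm_num) ((le_max_right l (1 / 2)).trans hr.1.le)
  have hs0 : 0 < s := lt_of_lt_of_le (by norm_num) ((le_max_right l (1 / 2)).trans hs.1.le)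
  obtain ⟨ha, ha'⟩ := hg r hr0 hr.2
  obtain ⟨hb, hb'⟩ := hg s hs0 hs.2
  have h4 := hasSum_integral_norm_sq (a := fun k => g k * (r : ℂ) ^ k - g k * (s : ℂ) ^ k)
    (S := fun θ => G (r * Complex.exp (θ * Complex.I)) - G (s * Complex.exp (θ * Complex.I)))
    (Summable.of_nonneg_of_le (fun _ => norm_nonneg _) (fun _ => norm_sub_le _ _) (ha.add hb))
    ((continuous_circle hG.continuousOn hr0 hr.2).sub (continuous_circle hG.continuousOn hs0 hs.2))
    (fun θ => by simpa only [sub_mul] using (ha' θ).sub (hb' θ))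
  rw [← h4.tsum_eq]
  exact h3

lemma exists_L1_boundary {D : ℂ → ℂ} (hD : DifferentiableOn ℂ D (Metric.ball 0 1))
    (h0 : ∀ x ∈ Metric.ball (0 : ℂ) 1, D x ≠ 0) {C : ℝ}
    (hC : ∀ r : ℝ, 0 < r → r < 1 →
      ∫ θ in (0 : ℝ)..2 * Real.pi, ‖D (r * Complex.exp (θ * Complex.I))‖ ≤ C) :
    ∃ d : ℝ → ℂ, IntervalIntegrable d volume 0 (2 * Real.pi) ∧
      Tendsto (fun r : ℝ => ∫ θ in (0 : ℝ)..2 * Real.pi,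
        ‖D (r * Complex.exp (θ * Complex.I)) - d θ‖) (𝓝[<] 1) (𝓝 0) := by
  obtain ⟨L, hL, hLD⟩ := exists_log_ball hD h0
  have hpi := Real.pi_pos
  let G : ℂ → ℂ := fun x => Complex.exp (L x / 2)
  have hG : DifferentiableOn ℂ G (Metric.ball 0 1) := (hL.div_const 2).cexp
  have hGD : ∀ x ∈ Metric.ball (0 : ℂ) 1, G x ^ 2 = D x := by
    intro x hx
    rw [← hLD x hx, ← Complex.exp_nat_mul]; congr 1; push_cast; ring
  clear_value G
  have hC' : ∀ r : ℝ, 0 < r → r < 1 →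
      ∫ θ in (0 : ℝ)..2 * Real.pi, ‖G (r * Complex.exp (θ * Complex.I))‖ ^ 2 ≤ C := by
    intro r hr0 hr1
    refine le_trans (le_of_eq ?_) (hC r hr0 hr1)
    congr 1; ext θ
    rw [← norm_pow, hGD _ (circle_mem hr0 hr1 θ)]
  have hcau := H2_cauchy hG hC'
  have hCnn : 0 ≤ C := le_trans (intervalIntegral.integral_nonneg (by positivity)
    fun _ _ => norm_nonneg _) (hC (1 / 2) (by norm_num) (by norm_num))
  have hlim := exists_L1_limit (F := fun r θ => D (r * Complex.exp (θ * Complex.I)))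
    (a := 0) (b := 2 * Real.pi)
    (fun r hr => ((continuous_circle hD.continuousOn hr.1 hr.2).integrableOn_Icc (a := 0)
      (b := 2 * Real.pi)).mono_set Ioc_subset_Icc_self) ?_
  · obtain ⟨d, hd, hd'⟩ := hlim
    refine ⟨d, (intervalIntegrable_iff_integrableOn_Ioc_of_le (by positivity)).2 hd, ?_⟩
    simpa only [intervalIntegral.integral_of_le (show (0 : ℝ) ≤ 2 * Real.pi by positivity)] using hd'
  · intro ε hε
    set t : ℝ := (4 * C + 1) / ε with ht
    have ht0 : 0 < t := by positivity
    obtain ⟨ρ, hρ0, hρ1, hρ⟩ := hcau (ε / t / 2) (by positivity)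
    refine ⟨ρ, hρ0, hρ1, fun r hr s hs => ?_⟩
    have hr0 := hρ0.trans hr.1
    have hs0 := hρ0.trans hs.1
    have h1 := hρ r hr s hs
    have cGr := continuous_circle hG.continuousOn hr0 hr.2
    have cGs := continuous_circle hG.continuousOn hs0 hs.2
    have cDr := continuous_circle hD.continuousOn hr0 hr.2
    have cDs := continuous_circle hD.continuousOn hs0 hs.2
    rw [← intervalIntegral.integral_of_le (show (0 : ℝ) ≤ 2 * Real.pi by positivity)]
    have c1 : Continuous fun θ : ℝ => t / 2 * ‖G (r * Complex.exp (θ * Complex.I)) -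
        G (s * Complex.exp (θ * Complex.I))‖ ^ 2 :=
      continuous_const.mul ((cGr.sub cGs).norm.pow 2)
    have c2 : Continuous fun θ : ℝ => ‖G (r * Complex.exp (θ * Complex.I))‖ ^ 2 := cGr.norm.pow 2
    have c3 : Continuous fun θ : ℝ => ‖G (s * Complex.exp (θ * Complex.I))‖ ^ 2 := cGs.norm.pow 2
    have c4 : Continuous fun θ : ℝ => 1 / t * (‖G (r * Complex.exp (θ * Complex.I))‖ ^ 2 +
        ‖G (s * Complex.exp (θ * Complex.I))‖ ^ 2) := continuous_const.mul (c2.add c3)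
    have h2 : ∫ θ in (0 : ℝ)..2 * Real.pi, ‖D (r * Complex.exp (θ * Complex.I)) -
        D (s * Complex.exp (θ * Complex.I))‖ ≤
        ∫ θ in (0 : ℝ)..2 * Real.pi, (t / 2 * ‖G (r * Complex.exp (θ * Complex.I)) -
          G (s * Complex.exp (θ * Complex.I))‖ ^ 2 + (1 / t) *
          (‖G (r * Complex.exp (θ * Complex.I))‖ ^ 2 +
            ‖G (s * Complex.exp (θ * Complex.I))‖ ^ 2)) := by
      refine intervalIntegral.integral_mono (by positivity)
        ((cDr.sub cDs).norm.intervalIntegrable _ _)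
        ((c1.add c4).intervalIntegrable _ _) fun θ => ?_
      rw [← hGD _ (circle_mem hr0 hr.2 θ), ← hGD _ (circle_mem hs0 hs.2 θ)]
      generalize G (r * Complex.exp (θ * Complex.I)) = u
      generalize G (s * Complex.exp (θ * Complex.I)) = v
      have e1 : u ^ 2 - v ^ 2 = (u - v) * (u + v) := by ring
      rw [e1, norm_mul]
      have e2 : ‖u + v‖ ≤ ‖u‖ + ‖v‖ := norm_add_le _ _
      have e3 : ‖u - v‖ * ‖u + v‖ ≤ ‖u - v‖ * (‖u‖ + ‖v‖) :=
        mul_le_mul_of_nonneg_left e2 (norm_nonneg _)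
      refine e3.trans ?_
      generalize ‖u - v‖ = p
      generalize ‖u‖ = x
      generalize ‖v‖ = y
      have e4 : t / 2 * p ^ 2 + 1 / t * (x ^ 2 + y ^ 2) - p * (x + y) =
        ((t * p - (x + y)) ^ 2 + (x - y) ^ 2) / (2 * t) := by field_simp; ring
      have e5 : 0 ≤ ((t * p - (x + y)) ^ 2 + (x - y) ^ 2) / (2 * t) := by positivity
      linarith
    refine h2.trans_lt ?_
    rw [intervalIntegral.integral_add (c1.intervalIntegrable _ _)
      (c4.intervalIntegrable _ _), intervalIntegral.integral_const_mul,
      intervalIntegral.integral_const_mul, intervalIntegral.integral_add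
      (c2.intervalIntegrable _ _)
      (c3.intervalIntegrable _ _)]
    have h3 := hC' r hr0 hr.2
    have h4 := hC' s hs0 hs.2
    have h5 : t / 2 * (∫ θ in (0 : ℝ)..2 * Real.pi, ‖G (r * Complex.exp (θ * Complex.I)) -
        G (s * Complex.exp (θ * Complex.I))‖ ^ 2) < t / 2 * (ε / t / 2) :=
      mul_lt_mul_of_pos_left h1 (by positivity)
    have h6 : t / 2 * (ε / t / 2) = ε / 4 := by field_simp; norm_num
    have h7 : 1 / t * ((∫ θ in (0 : ℝ)..2 * Real.pi, ‖G (r * Complex.exp (θ * Complex.I))‖ ^ 2) +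
        ∫ θ in (0 : ℝ)..2 * Real.pi, ‖G (s * Complex.exp (θ * Complex.I))‖ ^ 2) ≤
        1 / t * (2 * C) := mul_le_mul_of_nonneg_left (by linarith) (by positivity)
    have h8 : 1 / t * (2 * C) ≤ ε / 2 := by
      have : 1 / t * (2 * C) = ε * (2 * C) / (4 * C + 1) := by rw [ht]; field_simp
      rw [this, div_le_iff₀ (by positivity)]
      nlinarith
    linarith

lemma exists_unimodular_mul (w : ℂ) : ∃ u : ℂ, ‖u‖ ≤ 1 ∧ u * w = ‖w‖ := by
  by_cases hw : w = 0
  · exact ⟨0, by simp, by simp [hw]⟩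
  · refine ⟨(starRingEnd ℂ) w / ‖w‖, ?_, ?_⟩
    · simp [hw]
    · have : (‖w‖ : ℂ) ≠ 0 := by simpa using hw
      rw [div_mul_eq_mul_div, Complex.conj_mul', pow_two]
      field_simp

lemma exp_norm_one (θ : ℝ) : ‖Complex.exp (θ * Complex.I)‖ = 1 := Complex.norm_exp_ofReal_mul_I θ

lemma exp_add_mul_I (s t : ℝ) : Complex.exp ((s + t : ℝ) * Complex.I) =
    Complex.exp (s * Complex.I) * Complex.exp (t * Complex.I) := by
  rw [← Complex.exp_add]; push_cast; ring_nf

lemma sum_increment_le {K : ℂ → ℂ} (hK : DiffContOnCl ℂ K (Metric.ball 0 1)) {g : ℝ → ℝ}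
    (hg : Monotone g)
    (hdom : ∀ θ ∈ Icc (-(4 * Real.pi)) (4 * Real.pi), ∀ θ' ∈ Icc (-(4 * Real.pi)) (4 * Real.pi),
      θ ≤ θ' → ‖bdryParam K θ' - bdryParam K θ‖ ≤ g θ' - g θ)
    {t : ℕ → ℝ} (ht : Monotone t) (ht0 : 0 ≤ t 0) {N : ℕ} (htN : t N ≤ 2 * Real.pi) {x : ℂ}
    (hx : x ∈ Metric.ball (0 : ℂ) 1) :
    ∑ j ∈ Finset.range N, ‖K (x * Complex.exp (t (j + 1) * Complex.I)) /
      Complex.exp (t (j + 1) * Complex.I) - K (x * Complex.exp (t j * Complex.I)) /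
      Complex.exp (t j * Complex.I)‖ ≤ g (4 * Real.pi) - g (-(4 * Real.pi)) := by
  have hpi := Real.pi_pos
  let f : ℕ → ℂ → ℂ := fun j x => K (x * Complex.exp (t (j + 1) * Complex.I)) /
      Complex.exp (t (j + 1) * Complex.I) - K (x * Complex.exp (t j * Complex.I)) /
      Complex.exp (t j * Complex.I)
  choose u hu1 hu2 using fun j => exists_unimodular_mul (f j x)
  have hrot : ∀ s : ℝ, DiffContOnCl ℂ (fun x => K (x * Complex.exp (s * Complex.I)))
      (Metric.ball 0 1) := by
    intro s
    refine hK.comp (g := fun x => x * Complex.exp (s * Complex.I))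
      (Differentiable.diffContOnCl (by fun_prop)) ?_
    intro y hy
    simpa [exp_norm_one] using hy
  have hf : ∀ j, DiffContOnCl ℂ (f j) (Metric.ball 0 1) := by
    intro j
    refine DiffContOnCl.sub ?_ ?_
    · exact ⟨(hrot (t (j + 1))).differentiableOn.div_const _, (hrot (t (j + 1))).continuousOn.div_const _⟩
    · exact ⟨(hrot (t j)).differentiableOn.div_const _, (hrot (t j)).continuousOn.div_const _⟩
  have hF : DiffContOnCl ℂ (fun y => ∑ j ∈ Finset.range N, u j * f j y) (Metric.ball 0 1) := by
    refine ⟨DifferentiableOn.fun_sum fun j _ => (hf j).differentiableOn.const_mul _, ?_⟩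
    exact continuousOn_finsetSum _ fun j _ => (hf j).continuousOn.const_mul _
  have hbd : ∀ y ∈ frontier (Metric.ball (0 : ℂ) 1), ‖∑ j ∈ Finset.range N, u j * f j y‖ ≤
      g (4 * Real.pi) - g (-(4 * Real.pi)) := by
    intro y hy
    rw [frontier_ball _ one_ne_zero, mem_sphere_zero_iff_norm] at hy
    have hy' : y = Complex.exp (y.arg * Complex.I) := by
      conv_lhs => rw [← Complex.norm_mul_exp_arg_mul_I y, hy]
      simp
    have hlow := Complex.neg_pi_lt_arg y
    have hup := Complex.arg_le_pi y
    have htb : ∀ j ≤ N, 0 ≤ t j ∧ t j ≤ 2 * Real.pi := fun j hj =>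
      ⟨ht0.trans (ht (Nat.zero_le j)), (ht hj).trans htN⟩
    have hfj : ∀ j < N, ‖u j * f j y‖ ≤ g (y.arg + t (j + 1)) - g (y.arg + t j) := by
      intro j hj
      have h1 : f j y = y * (bdryParam K (y.arg + t (j + 1)) - bdryParam K (y.arg + t j)) := by
        simp only [bdryParam, exp_add_mul_I, ← hy', f]
        have hy0 : y ≠ 0 := by rintro rfl; simp at hy
        have e1 := Complex.exp_ne_zero (t (j + 1) * Complex.I)
        have e2 := Complex.exp_ne_zero (t j * Complex.I)
        field_simp
      rw [norm_mul, h1, norm_mul, hy, one_mul]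
      obtain ⟨a1, a2⟩ := htb j hj.le
      obtain ⟨a3, a4⟩ := htb (j + 1) hj
      refine (mul_le_of_le_one_left (norm_nonneg _) (hu1 j)).trans (hdom _ ?_ _ ?_ ?_)
      · constructor <;> linarith
      · constructor <;> linarith
      · have := ht (Nat.le_succ j); simp only [Nat.succ_eq_add_one] at this; linarith
    refine (norm_sum_le _ _).trans ((Finset.sum_le_sum fun j hj => hfj j (Finset.mem_range.1 hj)).trans ?_)
    rw [Finset.sum_range_sub (fun j => g (y.arg + t j))]
    obtain ⟨a1, a2⟩ := htb N le_rfl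
    have := hg (show y.arg + t N ≤ 4 * Real.pi by linarith)
    have := hg (show -(4 * Real.pi) ≤ y.arg + t 0 by linarith)
    linarith
  have h1 := Complex.norm_le_of_forall_mem_frontier_norm_le Metric.isBounded_ball hF hbd
    (subset_closure hx)
  have h2 : ∑ j ∈ Finset.range N, u j * f j x = ((∑ j ∈ Finset.range N, ‖f j x‖ : ℝ) : ℂ) := by
    push_cast
    exact Finset.sum_congr rfl fun j _ => hu2 j
  have h1' : ‖∑ j ∈ Finset.range N, u j * f j x‖ ≤ g (4 * Real.pi) - g (-(4 * Real.pi)) := h1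
  rw [h2, Complex.norm_real, Real.norm_eq_abs] at h1'
  exact (le_abs_self _).trans h1'

lemma integral_norm_deriv_le {E E' : ℝ → ℂ} (hE : ∀ θ, HasDerivAt E (E' θ) θ)
    (hE' : Continuous E') {T V : ℝ} (hT : 0 < T)
    (hV : ∀ N : ℕ, 0 < N → ∑ j ∈ Finset.range N,
      ‖E (((j + 1 : ℕ) : ℝ) * (T / N)) - E ((j : ℝ) * (T / N))‖ ≤ V) :
    ∫ θ in (0 : ℝ)..T, ‖E' θ‖ ≤ V := by
  refine le_of_forall_pos_le_add fun ε hε => ?_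
  have huc := isCompact_Icc (a := (0 : ℝ)) (b := T) |>.uniformContinuousOn_of_continuous
    hE'.continuousOn
  obtain ⟨δ, hδ, hδ'⟩ := Metric.uniformContinuousOn_iff_le.1 huc (ε / (2 * T)) (by positivity)
  obtain ⟨n, hn⟩ := exists_nat_gt (T / δ)
  have hn0 : (0 : ℝ) < n := lt_trans (by positivity) hn
  set h := T / n with hh
  have hh0 : 0 < h := by positivity
  have hhδ : h ≤ δ := by
    rw [hh, div_le_iff₀ hn0]; rw [div_lt_iff₀ hδ] at hn; linarith
  have hpiece : ∀ j < n, ∫ θ in ((j : ℝ) * h)..(((j + 1 : ℕ) : ℝ) * h), ‖E' θ‖ ≤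
      ‖E (((j + 1 : ℕ) : ℝ) * h) - E ((j : ℝ) * h)‖ + ε / n := by
    intro j hj
    set p := (j : ℝ) * h
    have hq : ((j + 1 : ℕ) : ℝ) * h = p + h := by push_cast; ring
    rw [hq]
    have hp0 : 0 ≤ p := by positivity
    have hpT : p + h ≤ T := by
      rw [← hq]
      have : ((j + 1 : ℕ) : ℝ) ≤ n := by exact_mod_cast hj
      calc _ ≤ (n : ℝ) * h := mul_le_mul_of_nonneg_right this hh0.le
        _ = T := by rw [hh]; field_simp
    have hclose : ∀ θ ∈ Icc p (p + h), ‖E' θ - E' p‖ ≤ ε / (2 * T) := by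
      intro θ hθ
      rw [← dist_eq_norm]
      refine hδ' θ ⟨hp0.trans hθ.1, hθ.2.trans hpT⟩ p ⟨hp0, by linarith⟩ ?_
      rw [Real.dist_eq, abs_of_nonneg (by linarith [hθ.1])]
      linarith [hθ.2]
    have hftc : ∫ θ in p..(p + h), E' θ = E (p + h) - E p :=
      intervalIntegral.integral_eq_sub_of_hasDerivAt (fun θ _ => hE θ) (hE'.intervalIntegrable _ _)
    have h1 : ‖(∫ θ in p..(p + h), (E' θ - E' p))‖ ≤ ε / (2 * T) * |p + h - p| := by
      refine intervalIntegral.norm_integral_le_of_norm_le_const fun θ hθ => hclose θ ?_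
      rw [uIoc_of_le (by linarith)] at hθ
      exact ⟨hθ.1.le, hθ.2⟩
    rw [intervalIntegral.integral_sub (hE'.intervalIntegrable _ _) intervalIntegrable_const, hftc,
      intervalIntegral.integral_const] at h1
    simp only [add_sub_cancel_left, abs_of_pos hh0] at h1
    have h2 : h * ‖E' p‖ ≤ ‖E (p + h) - E p‖ + ε / (2 * T) * h := by
      have h3 : ‖h • E' p‖ = h * ‖E' p‖ := by rw [norm_smul, Real.norm_of_nonneg hh0.le]
      have h4 := norm_sub_norm_le (h • E' p) (E (p + h) - E p)
      rw [norm_sub_rev (h • E' p)] at h4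
      linarith
    have h5 : ∫ θ in p..(p + h), ‖E' θ‖ ≤ ∫ θ in p..(p + h), (‖E' p‖ + ε / (2 * T)) := by
      refine intervalIntegral.integral_mono_on (by linarith) (hE'.norm.intervalIntegrable _ _)
        intervalIntegrable_const fun θ hθ => ?_
      have := norm_sub_norm_le (E' θ) (E' p)
      linarith [hclose θ hθ]
    rw [intervalIntegral.integral_const] at h5
    simp only [add_sub_cancel_left, smul_eq_mul] at h5
    have h6 : ε / (2 * T) * h + h * (ε / (2 * T)) = ε / n := by rw [hh]; field_simp; norm_num
    linarith [mul_add h ‖E' p‖ (ε / (2 * T))]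
  have hsum := intervalIntegral.sum_integral_adjacent_intervals (f := fun θ => ‖E' θ‖)
    (μ := volume) (a := fun j : ℕ => (j : ℝ) * h) (n := n)
    (fun k _ => hE'.norm.intervalIntegrable _ _)
  have hnT : (n : ℝ) * h = T := by rw [hh]; field_simp
  simp only [Nat.cast_zero, zero_mul, hnT] at hsum
  rw [← hsum]
  refine (Finset.sum_le_sum fun j hj => hpiece j (Finset.mem_range.1 hj)).trans ?_
  rw [Finset.sum_add_distrib, Finset.sum_const, Finset.card_range, nsmul_eq_mul]
  have := hV n (by exact_mod_cast hn0)
  have h7 : (n : ℝ) * (ε / n) = ε := by field_simp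
  linarith

def radialDeriv (K : ℂ → ℂ) (r θ : ℝ) : ℂ :=
  -Complex.I * (K (r * Complex.exp (θ * Complex.I)) - r * Complex.exp (θ * Complex.I) *
    deriv K (r * Complex.exp (θ * Complex.I))) / Complex.exp (θ * Complex.I)

lemma hasDerivAt_radial {K : ℂ → ℂ} (hK : DifferentiableOn ℂ K (Metric.ball 0 1)) {r : ℝ}
    (hr0 : 0 < r) (hr1 : r < 1) (θ : ℝ) :
    HasDerivAt (fun θ : ℝ => K (r * Complex.exp (θ * Complex.I)) / Complex.exp (θ * Complex.I))
      (radialDeriv K r θ) θ := by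
  have h1 : HasDerivAt (fun θ : ℝ => Complex.exp (θ * Complex.I))
      (Complex.exp (θ * Complex.I) * Complex.I) θ := by
    have := ((Complex.ofRealCLM.hasDerivAt (x := θ)).mul_const Complex.I).cexp
    simpa using this
  have h2 := (hK.differentiableAt (Metric.isOpen_ball.mem_nhds (circle_mem hr0 hr1 θ))).hasDerivAt
  have h3 : HasDerivAt (fun θ : ℝ => K (r * Complex.exp (θ * Complex.I)))
      (deriv K (r * Complex.exp (θ * Complex.I)) * (r * (Complex.exp (θ * Complex.I) * Complex.I))) θ :=
    HasDerivAt.comp θ h2 (h1.const_mul (r : ℂ))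
  have hne := Complex.exp_ne_zero (θ * Complex.I)
  refine (h3.div h1 hne).congr_deriv ?_
  unfold radialDeriv
  field_simp
  ring

lemma continuous_radialDeriv {K : ℂ → ℂ} (hK : DifferentiableOn ℂ K (Metric.ball 0 1)) {r : ℝ}
    (hr0 : 0 < r) (hr1 : r < 1) : Continuous (radialDeriv K r) := by
  have h1 := continuous_circle hK.continuousOn hr0 hr1
  have h2 := continuous_circle (hK.deriv Metric.isOpen_ball).continuousOn hr0 hr1
  unfold radialDeriv
  refine Continuous.div (continuous_const.mul (h1.sub (Continuous.mul (by fun_prop) h2)))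
    (by fun_prop) fun θ => Complex.exp_ne_zero _

theorem ContDiscMap.exists_bdry_deriv {Γ : Set ℂ} {c : ℝ} {K : ℂ → ℂ} (h : ContDiscMap Γ c K)
    (hΓ : IsPiecewiseDiniSmoothJordanCurve Γ) :
    ∃ b : ℝ → ℂ, Function.Periodic b (2 * Real.pi) ∧
      (∀ s t, IntervalIntegrable b volume s t) ∧
      (∀ s t, ∫ θ in s..t, b θ = bdryParam K t - bdryParam K s) ∧
      Tendsto (fun r => ∫ θ in (0 : ℝ)..2 * Real.pi, ‖radialDeriv K r θ - b θ‖) (𝓝[<] 1) (𝓝 0) := by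
  have hpi := Real.pi_pos
  obtain ⟨g, -, hgm, hdom⟩ := h.exists_dominating hΓ (4 * Real.pi)
  have hdiff := h.diff
  have hcl : DiffContOnCl ℂ K (Metric.ball 0 1) := ⟨hdiff, by
    rw [closure_ball _ one_ne_zero]; exact h.cont⟩
  have hD : DifferentiableOn ℂ (fun x => K x - x * deriv K x) (Metric.ball 0 1) :=
    hdiff.sub (differentiableOn_id.mul (hdiff.deriv Metric.isOpen_ball))
  have hnorm : ∀ r θ : ℝ, ‖radialDeriv K r θ‖ = ‖K (r * Complex.exp (θ * Complex.I)) -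
      r * Complex.exp (θ * Complex.I) * deriv K (r * Complex.exp (θ * Complex.I))‖ := by
    intro r θ
    simp [radialDeriv]
  obtain ⟨d, hd, hd'⟩ := exists_L1_boundary hD h.deriv_ne
    (C := g (4 * Real.pi) - g (-(4 * Real.pi))) (by
      intro r hr0 hr1
      simp_rw [← hnorm]
      refine integral_norm_deriv_le (hasDerivAt_radial hdiff hr0 hr1)
        (continuous_radialDeriv hdiff hr0 hr1) (by positivity) fun N hN => ?_
      have hN' : (0 : ℝ) < N := by exact_mod_cast hN
      refine sum_increment_le hcl hgm hdom (t := fun j => (j : ℝ) * (2 * Real.pi / N)) ?_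
        (by simp) (N := N) ?_ (x := (r : ℂ)) (by simpa [abs_of_pos hr0] using hr1)
      · intro i j hij
        have : (i : ℝ) ≤ j := by exact_mod_cast hij
        exact mul_le_mul_of_nonneg_right this (by positivity)
      · exact le_of_eq (by field_simp))
  let b₀ : ℝ → ℂ := fun θ => -Complex.I * d θ / Complex.exp (θ * Complex.I)
  have hb₀ : IntervalIntegrable b₀ volume 0 (2 * Real.pi) := by
    have := hd.continuousOn_mul (g := fun θ : ℝ => -Complex.I / Complex.exp (θ * Complex.I))
      (Continuous.continuousOn (Continuous.div (by fun_prop) (by fun_prop)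
        fun θ => Complex.exp_ne_zero _))
    refine this.congr ?_
    exact fun θ _ => by simp only [b₀]; ring
  have htp : (0 : ℝ) < 2 * Real.pi := by positivity
  let b : ℝ → ℂ := fun θ => b₀ (toIocMod htp 0 θ)
  have hbper : Function.Periodic b (2 * Real.pi) := fun θ => by
    simp only [b]; rw [toIocMod_periodic htp 0 θ]
  have hbb : ∀ θ ∈ Ioc 0 (2 * Real.pi), b θ = b₀ θ := by
    intro θ hθ
    simp only [b]
    rw [(toIocMod_eq_self htp).2 (by simpa using hθ)]
  have hbint : IntervalIntegrable b volume 0 (2 * Real.pi) := by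
    refine hb₀.congr fun θ hθ => ?_
    rw [uIoc_of_le htp.le] at hθ
    exact (hbb θ hθ).symm
  have hball := hbper.intervalIntegrable₀ htp.ne' hbint
  have hlim : Tendsto (fun r => ∫ θ in (0 : ℝ)..2 * Real.pi, ‖radialDeriv K r θ - b θ‖)
      (𝓝[<] 1) (𝓝 0) := by
    refine hd'.congr fun r => ?_
    refine intervalIntegral.integral_congr_ae (Eventually.of_forall fun θ hθ => ?_)
    rw [uIoc_of_le htp.le] at hθ
    rw [hbb θ hθ]
    simp only [b₀, radialDeriv, ← sub_div, ← mul_sub, norm_div, norm_mul, exp_norm_one]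
    simp
  have hbase : ∀ t ∈ Icc 0 (2 * Real.pi), ∫ θ in (0 : ℝ)..t, b θ = bdryParam K t - bdryParam K 0 := by
    intro t ht
    have hsub : Ioc 0 t ⊆ Ioc 0 (2 * Real.pi) := Ioc_subset_Ioc_right ht.2
    have h1 : Tendsto (fun r => ∫ θ in (0 : ℝ)..t, radialDeriv K r θ) (𝓝[<] 1)
        (𝓝 (∫ θ in (0 : ℝ)..t, b θ)) := by
      rw [tendsto_iff_norm_sub_tendsto_zero]
      refine squeeze_zero' (Eventually.of_forall fun r => norm_nonneg _) ?_ hlim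
      filter_upwards [Ioo_mem_nhdsLT (zero_lt_one (α := ℝ))] with r hr
      have hc := continuous_radialDeriv hdiff hr.1 hr.2
      rw [← intervalIntegral.integral_sub (hc.intervalIntegrable _ _) (hball _ _)]
      refine (intervalIntegral.norm_integral_le_integral_norm ht.1).trans ?_
      exact intervalIntegral.integral_mono_interval le_rfl ht.1 ht.2
        (Eventually.of_forall fun _ => norm_nonneg _)
        ((hc.intervalIntegrable _ _).sub (hball _ _)).norm
    have hK1 : ∀ s : ℝ, Tendsto (fun r : ℝ => K (r * Complex.exp (s * Complex.I)) /
        Complex.exp (s * Complex.I)) (𝓝[<] 1) (𝓝 (bdryParam K s)) := by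
      intro s
      unfold bdryParam
      refine Tendsto.div_const ?_ _
      have hcw := h.cont (Complex.exp (s * Complex.I)) (by simp)
      refine hcw.tendsto.comp (tendsto_nhdsWithin_iff.2 ⟨?_, ?_⟩)
      · have : Tendsto (fun r : ℝ => (r : ℂ) * Complex.exp (s * Complex.I)) (𝓝 1)
            (𝓝 (((1 : ℝ) : ℂ) * Complex.exp (s * Complex.I))) :=
          (by fun_prop : Continuous fun r : ℝ => (r : ℂ) * Complex.exp (s * Complex.I)).tendsto 1
        simp only [Complex.ofReal_one, one_mul] at this
        exact this.mono_left nhdsWithin_le_nhds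
      · filter_upwards [Ioo_mem_nhdsLT (zero_lt_one (α := ℝ))] with r hr
        exact Metric.ball_subset_closedBall (circle_mem hr.1 hr.2 s)
    refine tendsto_nhds_unique h1 (((hK1 t).sub (hK1 0)).congr' ?_)
    filter_upwards [Ioo_mem_nhdsLT (zero_lt_one (α := ℝ))] with r hr
    exact (intervalIntegral.integral_eq_sub_of_hasDerivAt
      (fun θ _ => hasDerivAt_radial hdiff hr.1 hr.2 θ)
      ((continuous_radialDeriv hdiff hr.1 hr.2).intervalIntegrable _ _)).symm
  have hzero : ∫ θ in (0 : ℝ)..2 * Real.pi, b θ = 0 := by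
    rw [hbase _ ⟨htp.le, le_rfl⟩]
    have := bdryParam_periodic K 0
    rw [zero_add] at this
    rw [this, sub_self]
  have hper : Function.Periodic (fun t => (∫ θ in (0 : ℝ)..t, b θ) - bdryParam K t) (2 * Real.pi) := by
    intro t
    have h1 := hbper.intervalIntegral_add_eq t 0
    beta_reduce
    rw [bdryParam_periodic K t, ← intervalIntegral.integral_add_adjacent_intervals (hball 0 t)
      (hball t (t + 2 * Real.pi)), h1, zero_add, hzero, add_zero]
  have hall : ∀ t, ∫ θ in (0 : ℝ)..t, b θ = bdryParam K t - bdryParam K 0 := by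
    intro t
    obtain ⟨y, hy, hy'⟩ := hper.exists_mem_Ico₀ htp t
    have := hbase y ⟨hy.1, hy.2.le⟩
    rw [this] at hy'
    linear_combination hy'
  refine ⟨b, hbper, hball, fun s t => ?_, hlim⟩
  rw [← intervalIntegral.integral_interval_sub_left (hball 0 t) (hball 0 s), hall, hall]
  ring

def homogEval (P : Polynomial ℂ) (n : ℕ) (w x : ℂ) : ℂ :=
  ∑ k ∈ Finset.range (n + 1), P.coeff k * w ^ k * x ^ (n - k)

lemma homogEval_eq {P : Polynomial ℂ} {n : ℕ} (hP : P.natDegree ≤ n) (w : ℂ) {x : ℂ} (hx : x ≠ 0) :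
    homogEval P n w x = x ^ n * P.eval (w / x) := by
  rw [Polynomial.eval_eq_sum_range' (Nat.lt_succ_of_le hP), Finset.mul_sum, homogEval]
  refine Finset.sum_congr rfl fun k hk => ?_
  have hk' : k ≤ n := Nat.lt_succ_iff.1 (Finset.mem_range.1 hk)
  have : x ^ n = x ^ (n - k) * x ^ k := by rw [← pow_add, Nat.sub_add_cancel hk']
  rw [this, div_pow]
  field_simp

lemma homogEval_zero (P : Polynomial ℂ) (n : ℕ) (w : ℂ) :
    homogEval P n w 0 = P.coeff n * w ^ n := by
  rw [homogEval, Finset.sum_eq_single n]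
  · simp
  · intro k hk hkn
    have : n - k ≠ 0 := by
      have := Finset.mem_range.1 hk; omega
    simp [this]
  · simp

lemma ContDiscMap.diffContOnCl {Γ : Set ℂ} {c : ℝ} {K : ℂ → ℂ} (h : ContDiscMap Γ c K) :
    DiffContOnCl ℂ K (Metric.ball 0 1) :=
  ⟨h.diff, by rw [closure_ball _ one_ne_zero]; exact h.cont⟩

lemma ContDiscMap.norm_coeff_mul_pow_le {Γ : Set ℂ} {c : ℝ} {K : ℂ → ℂ} (h : ContDiscMap Γ c K)
    {P : Polynomial ℂ} {n : ℕ} (hP : P.natDegree ≤ n) {M : ℝ} (hM : ∀ z ∈ Γ, ‖P.eval z‖ ≤ M) :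
    ‖P.coeff n‖ * c ^ n ≤ M := by
  have hF : DiffContOnCl ℂ (fun x => homogEval P n (K x) x) (Metric.ball 0 1) := by
    have hK := h.diffContOnCl
    refine ⟨DifferentiableOn.fun_sum fun k _ => ?_, continuousOn_finsetSum _ fun k _ => ?_⟩
    · exact ((hK.differentiableOn.pow k).const_mul _).mul (by fun_prop)
    · exact (continuousOn_const.mul (hK.continuousOn.pow k)).mul (by fun_prop)
  have h1 := Complex.norm_le_of_forall_mem_frontier_norm_le Metric.isBounded_ball hF (C := M)
    (fun x hx => ?_) (subset_closure (Metric.mem_ball_self one_pos))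
  · simpa [homogEval_zero, h.zero, abs_of_pos h.cpos] using h1
  · rw [frontier_ball _ one_ne_zero, mem_sphere_zero_iff_norm] at hx
    have hx0 := ne_zero_of_sphere hx
    rw [homogEval_eq hP _ hx0, norm_mul, norm_pow, hx, one_pow, one_mul]
    exact hM _ (h.sphere_mem hx)

section

lemma exists_polynomial_part {K : ℂ → ℂ} {c : ℝ} (hK : DifferentiableOn ℂ K (Metric.ball 0 1))
    (hK0 : K 0 = c) (hc : c ≠ 0) (n : ℕ) : ∀ H : ℂ → ℂ, DifferentiableOn ℂ H (Metric.ball 0 1) →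
    ∃ P : Polynomial ℂ, P.natDegree ≤ n ∧ P.coeff n = H 0 / c ^ n ∧
      ∃ R : ℂ → ℂ, DifferentiableOn ℂ R (Metric.ball 0 1) ∧ R 0 = 0 ∧
        ∀ x ∈ Metric.ball (0 : ℂ) 1, x ≠ 0 → H x = x ^ n * (P.eval (K x / x) + R x) := by
  induction n with
  | zero =>
    intro H hH
    exact ⟨Polynomial.C (H 0), by simp, by simp, fun x => H x - H 0, hH.sub_const _, by simp,
      fun x _ _ => by simp⟩
  | succ n ih =>
    intro H hH
    have hc' : (c : ℂ) ≠ 0 := by exact_mod_cast hc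
    set a : ℂ := H 0 / c ^ (n + 1) with ha
    let H₀ : ℂ → ℂ := fun x => H x - a * K x ^ (n + 1)
    have hH₀ : DifferentiableOn ℂ H₀ (Metric.ball 0 1) := hH.sub ((hK.pow _).const_mul a)
    have h00 : H₀ 0 = 0 := by simp only [H₀, hK0, ha]; field_simp; ring
    have hd : DifferentiableOn ℂ (dslope H₀ 0) (Metric.ball 0 1) :=
      (Complex.differentiableOn_dslope (Metric.ball_mem_nhds _ one_pos)).2 hH₀
    obtain ⟨P, hPd, -, R, hR, hR0, hPR⟩ := ih _ hd
    refine ⟨Polynomial.C a * Polynomial.X ^ (n + 1) + P, ?_, ?_, R, hR, hR0, fun x hx hx0 => ?_⟩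
    · exact (Polynomial.natDegree_add_le _ _).trans
        (max_le (Polynomial.natDegree_C_mul_X_pow_le _ _) (hPd.trans (Nat.le_succ n)))
    · rw [Polynomial.coeff_add, Polynomial.coeff_C_mul_X_pow, if_pos rfl,
        Polynomial.coeff_eq_zero_of_natDegree_lt (Nat.lt_succ_of_le hPd), add_zero]
    · have h1 := hPR x hx hx0
      rw [dslope_of_ne _ hx0, slope_def_field, h00, sub_zero, sub_zero, div_eq_iff hx0] at h1
      have h2 : H x = a * K x ^ (n + 1) + H₀ x := by simp only [H₀]; ring
      rw [h2, h1]
      simp only [Polynomial.eval_add, Polynomial.eval_mul, Polynomial.eval_C, Polynomial.eval_pow,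
        Polynomial.eval_X, div_pow]
      field_simp
      ring

lemma integral_circle_eq {A : ℂ → ℂ} (hA : DifferentiableOn ℂ A (Metric.ball 0 1)) {r : ℝ}
    (hr0 : 0 < r) (hr1 : r < 1) :
    ∫ θ in (0 : ℝ)..2 * Real.pi, A (r * Complex.exp (θ * Complex.I)) = 2 * Real.pi * A 0 := by
  have h1 : DiffContOnCl ℂ A (Metric.ball 0 |r|) := by
    rw [abs_of_pos hr0]
    exact hA.diffContOnCl_ball (Metric.closedBall_subset_ball hr1)
  have h2 := h1.circleAverage
  rw [Real.circleAverage_def] at h2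
  simp only [circleMap_zero] at h2
  rw [← h2, Complex.real_smul]
  push_cast
  have := Real.pi_pos.ne'
  have : (Real.pi : ℂ) ≠ 0 := by exact_mod_cast this
  rw [mul_inv_cancel_left₀ (by simp [this])]

variable {Γ : Set ℂ} {c : ℝ} {K : ℂ → ℂ}

lemma DiscMap.sub_mul_ne_zero (h : DiscMap Γ c K) {z : ℂ} (hz : z ∉ exteriorDomain Γ) {x : ℂ}
    (hx : x ∈ Metric.ball (0 : ℂ) 1) : K x - z * x ≠ 0 := by
  intro h0
  by_cases hx0 : x = 0
  · subst hx0
    simp [h.zero, h.cpos.ne'] at h0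
  · apply hz
    rw [← h.image]
    refine ⟨x, ⟨hx, hx0⟩, ?_⟩
    simp only
    rw [div_eq_iff hx0]
    linear_combination h0

def logKernel (K : ℂ → ℂ) (z x : ℂ) : ℂ := (K x - x * deriv K x) / (K x - z * x)

lemma DiscMap.differentiableOn_logKernel (h : DiscMap Γ c K) {z : ℂ} (hz : z ∉ exteriorDomain Γ) :
    DifferentiableOn ℂ (logKernel K z) (Metric.ball 0 1) :=
  (h.diff.sub (differentiableOn_id.mul (h.diff.deriv Metric.isOpen_ball))).div
    (h.diff.sub (differentiableOn_id.const_mul z)) fun _ hx => h.sub_mul_ne_zero hz hx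

lemma DiscMap.logKernel_zero (h : DiscMap Γ c K) (z : ℂ) : logKernel K z 0 = 1 := by
  have : (c : ℂ) ≠ 0 := by exact_mod_cast h.cpos.ne'
  simp [logKernel, h.zero, this]

lemma integral_eval_mul_radialDeriv (hK : DifferentiableOn ℂ K (Metric.ball 0 1)) {r : ℝ}
    (hr0 : 0 < r) (hr1 : r < 1) (S : Polynomial ℂ) :
    ∫ θ in (0 : ℝ)..2 * Real.pi, S.eval (K (r * Complex.exp (θ * Complex.I)) /
      (r * Complex.exp (θ * Complex.I))) * (radialDeriv K r θ / r) = 0 := by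
  obtain ⟨g, hg⟩ := S.differentiable.isExactOn_univ
  have hE : ∀ θ : ℝ, K (r * Complex.exp (θ * Complex.I)) / (r * Complex.exp (θ * Complex.I)) =
      K (r * Complex.exp (θ * Complex.I)) / Complex.exp (θ * Complex.I) / r := by
    intro θ; rw [div_div, mul_comm (Complex.exp _)]
  simp_rw [hE]
  have hder : ∀ θ : ℝ, HasDerivAt (fun θ : ℝ => g (K (r * Complex.exp (θ * Complex.I)) /
      Complex.exp (θ * Complex.I) / r)) (S.eval (K (r * Complex.exp (θ * Complex.I)) /
      Complex.exp (θ * Complex.I) / r) * (radialDeriv K r θ / r)) θ := fun θ =>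
    HasDerivAt.comp θ (hg _ (mem_univ _)) ((hasDerivAt_radial hK hr0 hr1 θ).div_const _)
  have hc1 := continuous_circle hK.continuousOn hr0 hr1
  rw [intervalIntegral.integral_eq_sub_of_hasDerivAt (fun θ _ => hder θ)]
  · have : Complex.exp ((2 * Real.pi : ℝ) * Complex.I) = 1 := by
      push_cast; exact Complex.exp_two_pi_mul_I
    rw [this]; simp
  · refine Continuous.intervalIntegrable (Continuous.mul ?_ ?_) _ _
    · exact S.continuous.comp ((hc1.div (by fun_prop) fun θ => Complex.exp_ne_zero _).div_const _)
    · exact (continuous_radialDeriv hK hr0 hr1).div_const _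

lemma DiscMap.two_pi_mul_eval (h : DiscMap Γ c K) {z : ℂ} (hz : z ∉ exteriorDomain Γ) {n : ℕ}
    {H R : ℂ → ℂ} {P : Polynomial ℂ} (hR : DifferentiableOn ℂ R (Metric.ball 0 1)) (hR0 : R 0 = 0)
    (hH : ∀ x ∈ Metric.ball (0 : ℂ) 1, x ≠ 0 → H x = x ^ n * (P.eval (K x / x) + R x)) {r : ℝ}
    (hr0 : 0 < r) (hr1 : r < 1) :
    ∫ θ in (0 : ℝ)..2 * Real.pi, H (r * Complex.exp (θ * Complex.I)) /
      (r * Complex.exp (θ * Complex.I)) ^ n * logKernel K z (r * Complex.exp (θ * Complex.I)) =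
      2 * Real.pi * P.eval z := by
  obtain ⟨S, hS⟩ := Polynomial.X_sub_C_dvd_sub_C_eval (a := z) (p := P)
  have hS' : ∀ w, P.eval w = P.eval z + (w - z) * S.eval w := by
    intro w
    have := congrArg (Polynomial.eval w) hS
    simp only [Polynomial.eval_sub, Polynomial.eval_mul, Polynomial.eval_X, Polynomial.eval_C] at this
    linear_combination this
  have hLd := h.differentiableOn_logKernel hz
  have hrc : (r : ℂ) ≠ 0 := by exact_mod_cast hr0.ne'
  have hpt : ∀ θ : ℝ, H (r * Complex.exp (θ * Complex.I)) /
      (r * Complex.exp (θ * Complex.I)) ^ n * logKernel K z (r * Complex.exp (θ * Complex.I)) =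
      P.eval z * logKernel K z (r * Complex.exp (θ * Complex.I)) +
      Complex.I * (S.eval (K (r * Complex.exp (θ * Complex.I)) / (r * Complex.exp (θ * Complex.I))) *
        (radialDeriv K r θ / r)) +
      R (r * Complex.exp (θ * Complex.I)) * logKernel K z (r * Complex.exp (θ * Complex.I)) := by
    intro θ
    have hx := circle_mem hr0 hr1 θ
    have he := Complex.exp_ne_zero (θ * Complex.I)
    have hx0 : (r : ℂ) * Complex.exp (θ * Complex.I) ≠ 0 := mul_ne_zero hrc he
    have hD : radialDeriv K r θ / r = -Complex.I * ((K (r * Complex.exp (θ * Complex.I)) -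
        (r * Complex.exp (θ * Complex.I)) * deriv K (r * Complex.exp (θ * Complex.I))) /
        (r * Complex.exp (θ * Complex.I))) := by
      unfold radialDeriv; field_simp
    rw [hH _ hx hx0, hS', hD]
    have hk := h.sub_mul_ne_zero hz hx
    generalize (r : ℂ) * Complex.exp (θ * Complex.I) = x at *
    have e1 : K x / x - z = (K x - z * x) / x := by field_simp
    rw [e1, mul_div_cancel_left₀ _ (pow_ne_zero n hx0)]
    unfold logKernel
    generalize S.eval (K x / x) = s
    generalize K x - z * x = k at *
    generalize K x - x * deriv K x = N
    have e2 : Complex.I * (s * (-Complex.I * (N / x))) = s * (N / x) := by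
      linear_combination (-s * N / x) * Complex.I_sq
    rw [e2]
    field_simp
  simp_rw [hpt]
  have c1 := continuous_circle hLd.continuousOn hr0 hr1
  have c2 := continuous_circle hR.continuousOn hr0 hr1
  have c3 : Continuous fun θ : ℝ => K (r * Complex.exp (θ * Complex.I)) /
      (r * Complex.exp (θ * Complex.I)) := (continuous_circle h.diff.continuousOn hr0 hr1).div
    (g := fun θ : ℝ => (r : ℂ) * Complex.exp (θ * Complex.I)) (by fun_prop)
    (fun θ => mul_ne_zero hrc (Complex.exp_ne_zero _))
  have c4 : Continuous fun θ : ℝ => S.eval (K (r * Complex.exp (θ * Complex.I)) /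
      (r * Complex.exp (θ * Complex.I))) * (radialDeriv K r θ / r) := (S.continuous.comp c3).mul ((continuous_radialDeriv h.diff hr0 hr1).div_const r)
  have i1 := (c1.const_mul (P.eval z)).intervalIntegrable (μ := volume) 0 (2 * Real.pi)
  have i2 := (c4.const_mul Complex.I).intervalIntegrable (μ := volume) 0 (2 * Real.pi)
  have c5 : Continuous fun θ : ℝ => R (r * Complex.exp (θ * Complex.I)) *
      logKernel K z (r * Complex.exp (θ * Complex.I)) := c2.mul c1
  have i3 := c5.intervalIntegrable (μ := volume) 0 (2 * Real.pi)
  rw [intervalIntegral.integral_add (i1.add i2) i3, intervalIntegral.integral_add i1 i2,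
    intervalIntegral.integral_const_mul, intervalIntegral.integral_const_mul,
    integral_eval_mul_radialDeriv h.diff hr0 hr1, integral_circle_eq hLd hr0 hr1,
    integral_circle_eq (A := fun x => R x * logKernel K z x) (hR.mul hLd) hr0 hr1, hR0,
    h.logKernel_zero]
  ring

lemma integral_eval_mul_conj {A : ℂ → ℂ} (hA : DifferentiableOn ℂ A (Metric.ball 0 1))
    {Q : Polynomial ℂ} {n : ℕ} (hQ : Q.natDegree < n) {r : ℝ} (hr0 : 0 < r) (hr1 : r < 1) :
    ∫ θ in (0 : ℝ)..2 * Real.pi, Q.eval (r * Complex.exp (θ * Complex.I)) /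
      (r * Complex.exp (θ * Complex.I)) ^ n *
      (starRingEnd ℂ) (A (r * Complex.exp (θ * Complex.I))) = 0 := by
  have hrc : (r : ℂ) ≠ 0 := by exact_mod_cast hr0.ne'
  have c1 := continuous_circle hA.continuousOn hr0 hr1
  have hpt : ∀ θ : ℝ, Q.eval (r * Complex.exp (θ * Complex.I)) /
      (r * Complex.exp (θ * Complex.I)) ^ n *
      (starRingEnd ℂ) (A (r * Complex.exp (θ * Complex.I))) = ∑ j ∈ Finset.range n,
      Q.coeff j * ((r : ℂ) ^ (2 * (n - j)))⁻¹ * (starRingEnd ℂ)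
        ((r * Complex.exp (θ * Complex.I)) ^ (n - j) * A (r * Complex.exp (θ * Complex.I))) := by
    intro θ
    rw [Polynomial.eval_eq_sum_range' hQ, Finset.sum_div, Finset.sum_mul]
    refine Finset.sum_congr rfl fun j hj => ?_
    have hj' := (Finset.mem_range.1 hj).le
    have he := Complex.exp_ne_zero (θ * Complex.I)
    have hconj : (starRingEnd ℂ) (r * Complex.exp (θ * Complex.I)) =
        (r : ℂ) ^ 2 / (r * Complex.exp (θ * Complex.I)) := by
      rw [eq_div_iff (mul_ne_zero hrc he), Complex.conj_mul', norm_mul, exp_norm_one,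
        Complex.norm_real, Real.norm_of_nonneg hr0.le, mul_one]
    rw [map_mul, map_pow, hconj]
    have hx0 : (r : ℂ) * Complex.exp (θ * Complex.I) ≠ 0 := mul_ne_zero hrc he
    generalize (r : ℂ) * Complex.exp (θ * Complex.I) = x at *
    rw [div_pow, ← pow_mul]
    have : x ^ n = x ^ j * x ^ (n - j) := by rw [← pow_add, Nat.add_sub_cancel' hj']
    rw [this]
    field_simp
  simp_rw [hpt]
  rw [intervalIntegral.integral_finsetSum]
  · refine Finset.sum_eq_zero fun j hj => ?_
    rw [intervalIntegral.integral_const_mul, intervalIntegral.intervalIntegral_conj,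
      integral_circle_eq (A := fun x => x ^ (n - j) * A x)
        ((differentiableOn_id.pow _).mul hA) hr0 hr1]
    have : n - j ≠ 0 := by have := Finset.mem_range.1 hj; omega
    simp [this]
  · intro j hj
    refine Continuous.intervalIntegrable (continuous_const.mul
      (Complex.continuous_conj.comp (Continuous.mul (by fun_prop) c1))) _ _

end

section

lemma tendsto_L1_mul {u W : ℝ → ℝ → ℂ} {u₀ W₀ : ℝ → ℂ} {M T : ℝ}  (hT : 0 ≤ T)
    (hW : ∀ᶠ r in 𝓝[<] (1 : ℝ), IntervalIntegrable (W r) volume 0 T)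
    (hW₀ : IntervalIntegrable W₀ volume 0 T)
    (hL : Tendsto (fun r => ∫ θ in (0 : ℝ)..T, ‖W r θ - W₀ θ‖) (𝓝[<] 1) (𝓝 0))
    (hu : ∀ᶠ r in 𝓝[<] (1 : ℝ), Continuous (u r)) (hu₀ : Continuous u₀)
    (hM : ∀ᶠ r in 𝓝[<] (1 : ℝ), ∀ θ, ‖u r θ‖ ≤ M)
    (hlim : ∀ θ, Tendsto (fun r => u r θ) (𝓝[<] 1) (𝓝 (u₀ θ))) :
    Tendsto (fun r => ∫ θ in (0 : ℝ)..T, ‖u r θ * W r θ - u₀ θ * W₀ θ‖) (𝓝[<] 1) (𝓝 0) := by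
  have hM0 : ∀ θ, ‖u₀ θ‖ ≤ M := fun θ =>
    le_of_tendsto (hlim θ).norm (hM.mono fun r hr => hr θ)
  have h2 : Tendsto (fun r => ∫ θ in (0 : ℝ)..T, ‖(u r θ - u₀ θ) * W₀ θ‖) (𝓝[<] 1) (𝓝 0) := by
    have := intervalIntegral.tendsto_integral_filter_of_dominated_convergence
      (μ := volume) (a := 0) (b := T) (l := 𝓝[<] (1 : ℝ))
      (F := fun r θ => ‖(u r θ - u₀ θ) * W₀ θ‖) (f := fun _ => (0 : ℝ))
      (fun θ => 2 * M * ‖W₀ θ‖) ?_ ?_ ?_ ?_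
    · simpa using this
    · filter_upwards [hu] with r hr
      exact (((hr.sub hu₀).aestronglyMeasurable).mul hW₀.def'.aestronglyMeasurable).norm
    · filter_upwards [hM] with r hr
      refine Eventually.of_forall fun θ _ => ?_
      rw [norm_norm, norm_mul]
      refine mul_le_mul_of_nonneg_right ?_ (norm_nonneg _)
      have := norm_sub_le (u r θ) (u₀ θ)
      linarith [hr θ, hM0 θ]
    · exact hW₀.norm.const_mul _
    · refine Eventually.of_forall fun θ _ => ?_
      have := (((hlim θ).sub_const (u₀ θ)).mul_const (W₀ θ)).norm
      simpa using this
  have h3 := (hL.const_mul M).add h2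
  rw [mul_zero, add_zero] at h3
  refine squeeze_zero' (Eventually.of_forall fun r =>
    intervalIntegral.integral_nonneg hT fun θ _ => norm_nonneg _) ?_ h3
  filter_upwards [hW, hu, hM] with r hr1 hr2 hr3
  have i1 := (hr1.sub hW₀).norm
  have i2 : IntervalIntegrable (fun θ => ‖(u r θ - u₀ θ) * W₀ θ‖) volume 0 T :=
    (hW₀.continuousOn_mul (hr2.sub hu₀).continuousOn).norm
  have i3 : IntervalIntegrable (fun θ => ‖u r θ * W r θ - u₀ θ * W₀ θ‖) volume 0 T :=
    ((hr1.continuousOn_mul hr2.continuousOn).sub (hW₀.continuousOn_mul hu₀.continuousOn)).norm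
  rw [← intervalIntegral.integral_const_mul, ← intervalIntegral.integral_add (i1.const_mul M) i2]
  refine intervalIntegral.integral_mono_on hT i3 ((i1.const_mul M).add i2) fun θ _ => ?_
  have e : u r θ * W r θ - u₀ θ * W₀ θ = u r θ * (W r θ - W₀ θ) + (u r θ - u₀ θ) * W₀ θ := by ring
  rw [e]
  refine (norm_add_le _ _).trans (add_le_add_left ?_ _)
  rw [norm_mul]
  exact mul_le_mul_of_nonneg_right (hr3 θ) (norm_nonneg _)

lemma tendsto_integral_of_L1 {W : ℝ → ℝ → ℂ} {W₀ : ℝ → ℂ} {T : ℝ} (hT : 0 ≤ T)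
    (hW : ∀ᶠ r in 𝓝[<] (1 : ℝ), IntervalIntegrable (W r) volume 0 T)
    (hW₀ : IntervalIntegrable W₀ volume 0 T)
    (hL : Tendsto (fun r => ∫ θ in (0 : ℝ)..T, ‖W r θ - W₀ θ‖) (𝓝[<] 1) (𝓝 0)) :
    Tendsto (fun r => ∫ θ in (0 : ℝ)..T, W r θ) (𝓝[<] 1) (𝓝 (∫ θ in (0 : ℝ)..T, W₀ θ)) := by
  rw [tendsto_iff_norm_sub_tendsto_zero]
  refine squeeze_zero' (Eventually.of_forall fun r => norm_nonneg _) ?_ hL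
  filter_upwards [hW] with r hr
  rw [← intervalIntegral.integral_sub hr hW₀]
  exact intervalIntegral.norm_integral_le_integral_norm hT

structure IsBdryDeriv (K : ℂ → ℂ) (b : ℝ → ℂ) : Prop where
  periodic : Function.Periodic b (2 * Real.pi)
  int : ∀ s t, IntervalIntegrable b volume s t
  integral : ∀ s t, ∫ θ in s..t, b θ = bdryParam K t - bdryParam K s
  lim : Tendsto (fun r => ∫ θ in (0 : ℝ)..2 * Real.pi, ‖radialDeriv K r θ - b θ‖) (𝓝[<] 1) (𝓝 0)

lemma ContDiscMap.exists_isBdryDeriv {Γ : Set ℂ} {c : ℝ} {K : ℂ → ℂ} (h : ContDiscMap Γ c K)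
    (hΓ : IsPiecewiseDiniSmoothJordanCurve Γ) : ∃ b, IsBdryDeriv K b := by
  obtain ⟨b, h1, h2, h3, h4⟩ := h.exists_bdry_deriv hΓ
  exact ⟨b, h1, h2, h3, h4⟩

lemma eventually_mem_Ioo (ρ : ℝ) (hρ : ρ < 1) : ∀ᶠ r in 𝓝[<] (1 : ℝ), 0 < r ∧ ρ < r ∧ r < 1 := by
  have h1 : ∀ᶠ r in 𝓝[<] (1 : ℝ), max 0 ρ < r ∧ r < 1 :=
    Ioo_mem_nhdsLT (max_lt one_pos hρ)
  filter_upwards [h1] with r hr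
  exact ⟨(le_max_left _ _).trans_lt hr.1, (le_max_right _ _).trans_lt hr.1, hr.2⟩

lemma tendsto_circle_point {F : ℂ → ℂ} (hF : ContinuousOn F (Metric.closedBall 0 1)) (θ : ℝ) :
    Tendsto (fun r : ℝ => F (r * Complex.exp (θ * Complex.I))) (𝓝[<] 1)
      (𝓝 (F (Complex.exp (θ * Complex.I)))) := by
  have h1 : Tendsto (fun r : ℝ => (r : ℂ) * Complex.exp (θ * Complex.I)) (𝓝[<] 1)
      (𝓝[Metric.closedBall 0 1] (Complex.exp (θ * Complex.I))) := by
    refine tendsto_nhdsWithin_iff.2 ⟨?_, ?_⟩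
    · have : Continuous fun r : ℝ => (r : ℂ) * Complex.exp (θ * Complex.I) := by fun_prop
      have := this.tendsto 1
      simp only [Complex.ofReal_one, one_mul] at this
      exact this.mono_left nhdsWithin_le_nhds
    · filter_upwards [eventually_mem_Ioo 0 one_pos] with r hr
      exact Metric.ball_subset_closedBall (circle_mem hr.1 hr.2.2 θ)
  exact (hF _ (by simp)).tendsto.comp h1

variable {Γ : Set ℂ} {c : ℝ} {K : ℂ → ℂ} {b : ℝ → ℂ}

lemma ContDiscMap.exists_lower_bound (h : ContDiscMap Γ c K) {z : ℂ} (hz : z ∉ Γ) :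
    ∃ ρ : ℝ, ρ < 1 ∧ ∃ δ > 0, ∀ x : ℂ, ρ < ‖x‖ → ‖x‖ ≤ 1 → δ ≤ ‖K x - z * x‖ := by
  have hk : ContinuousOn (fun x => K x - z * x) (Metric.closedBall 0 1) :=
    h.cont.sub (by fun_prop)
  have hs : Metric.sphere (0 : ℂ) 1 ⊆ Metric.closedBall 0 1 := Metric.sphere_subset_closedBall
  obtain ⟨x₀, hx₀, hmin⟩ := (isCompact_sphere (0 : ℂ) 1).exists_isMinOn
    (NormedSpace.sphere_nonempty.2 zero_le_one) (hk.mono hs).norm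
  have hpos : 0 < ‖K x₀ - z * x₀‖ := by
    rw [norm_pos_iff]
    intro h0
    have hx1 : ‖x₀‖ = 1 := by simpa using hx₀
    have hx0 : x₀ ≠ 0 := by rintro rfl; simp at hx1
    apply hz
    have := h.sphere_mem hx1
    rwa [show K x₀ / x₀ = z by rw [div_eq_iff hx0]; linear_combination h0] at this
  set m := ‖K x₀ - z * x₀‖
  have huc := (isCompact_closedBall (0 : ℂ) 1).uniformContinuousOn_of_continuous hk
  obtain ⟨δ, hδ, hδ'⟩ := Metric.uniformContinuousOn_iff_le.1 huc (m / 2) (by positivity)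
  refine ⟨max (1 - δ) 0, max_lt (by linarith) one_pos, m / 2, by positivity, fun x hx hx1 => ?_⟩
  have hx0 : 0 < ‖x‖ := (le_max_right _ _).trans_lt hx
  have hxδ : 1 - δ < ‖x‖ := (le_max_left _ _).trans_lt hx
  have hxc : (‖x‖ : ℂ) ≠ 0 := by exact_mod_cast hx0.ne'
  have hy : ‖x / ‖x‖‖ = 1 := by rw [norm_div, Complex.norm_real, norm_norm, div_self hx0.ne']
  have h1 := hδ' x (by simpa using hx1) (x / ‖x‖) (mem_closedBall_zero_iff.2 hy.le) ?_
  · rw [dist_eq_norm, ← norm_neg, neg_sub] at h1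
    have h2 : m ≤ _ := hmin (show x / ‖x‖ ∈ Metric.sphere (0 : ℂ) 1 by simpa using hy)
    have h3 := norm_sub_norm_le (K (x / ‖x‖) - z * (x / ‖x‖)) (K x - z * x)
    linarith
  · rw [dist_eq_norm, show x - x / ‖x‖ = (x / ‖x‖) * ((‖x‖ - 1 : ℝ) : ℂ) by
      push_cast; field_simp, norm_mul, hy, one_mul, Complex.norm_real, Real.norm_eq_abs, abs_le]
    constructor <;> linarith

lemma ContDiscMap.bdryParam_sub_ne_zero (h : ContDiscMap Γ c K) {z : ℂ} (hz : z ∉ Γ) (θ : ℝ) :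
    bdryParam K θ - z ≠ 0 := fun h0 => hz (sub_eq_zero.1 h0 ▸ h.bdryParam_mem θ)

lemma ContDiscMap.intervalIntegrable_div (h : ContDiscMap Γ c K) (hb : IsBdryDeriv K b) {z : ℂ}
    (hz : z ∉ Γ) (s t : ℝ) :
    IntervalIntegrable (fun θ => b θ / (bdryParam K θ - z)) volume s t := by
  simp_rw [div_eq_mul_inv]
  exact (hb.int s t).mul_continuousOn
    ((h.continuous_bdryParam.sub continuous_const).inv₀ (h.bdryParam_sub_ne_zero hz)).continuousOn

lemma logKernel_eq (z : ℂ) (r θ : ℝ) : logKernel K z (r * Complex.exp (θ * Complex.I)) =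
    Complex.I * Complex.exp (θ * Complex.I) / (K (r * Complex.exp (θ * Complex.I)) -
      z * (r * Complex.exp (θ * Complex.I))) * radialDeriv K r θ := by
  unfold logKernel radialDeriv
  have := Complex.exp_ne_zero (θ * Complex.I)
  generalize Complex.exp (θ * Complex.I) = e at *
  generalize K (r * e) - z * (r * e) = k
  generalize K (r * e) - r * e * deriv K (r * e) = N
  have e1 : Complex.I * e / k * (-Complex.I * N / e) =
      (-(Complex.I * Complex.I)) * (N / k) * (e / e) := by ring
  rw [e1, div_self this, Complex.I_mul_I]
  ring

/-- The kernels on inner circles converge in `L¹` to the boundary kernel. -/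
lemma ContDiscMap.tendsto_logKernel (h : ContDiscMap Γ c K) (hb : IsBdryDeriv K b) {z : ℂ}
    (hz : z ∉ Γ) :
    (∀ᶠ r : ℝ in 𝓝[<] (1 : ℝ), Continuous fun θ : ℝ => logKernel K z (r * Complex.exp (θ * Complex.I))) ∧
    Tendsto (fun r : ℝ => ∫ θ in (0 : ℝ)..2 * Real.pi,
      ‖logKernel K z (r * Complex.exp (θ * Complex.I)) -
        Complex.I * (b θ / (bdryParam K θ - z))‖) (𝓝[<] 1) (𝓝 0) := by
  obtain ⟨ρ, hρ, δ, hδ, hlow⟩ := h.exists_lower_bound hz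
  have hx : ∀ r : ℝ, 0 < r → ∀ θ : ℝ, ‖(r : ℂ) * Complex.exp (θ * Complex.I)‖ = r := by
    intro r hr θ
    rw [norm_mul, exp_norm_one, mul_one, Complex.norm_real, Real.norm_of_nonneg hr.le]
  have hcu : ∀ r : ℝ, 0 < r → ρ < r → r < 1 → Continuous fun θ : ℝ =>
      Complex.I * Complex.exp (θ * Complex.I) / (K (r * Complex.exp (θ * Complex.I)) -
      z * (r * Complex.exp (θ * Complex.I))) := by
    intro r h0 h1 h2
    refine Continuous.div (by fun_prop) ((continuous_circle h.diff.continuousOn h0 h2).sub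
      (by fun_prop)) fun θ => ?_
    have := hlow _ ((hx r h0 θ).symm ▸ h1) ((hx r h0 θ).symm ▸ h2.le)
    exact norm_pos_iff.1 (hδ.trans_le this)
  have hcW : ∀ r : ℝ, 0 < r → r < 1 → Continuous (radialDeriv K r) := fun r h0 h2 =>
    continuous_radialDeriv h.diff h0 h2
  constructor
  · filter_upwards [eventually_mem_Ioo ρ hρ] with r ⟨h0, h1, h2⟩
    simp_rw [logKernel_eq]
    exact (hcu r h0 h1 h2).mul (hcW r h0 h2)
  · have hk0 : ∀ θ : ℝ, K (Complex.exp (θ * Complex.I)) - z * Complex.exp (θ * Complex.I) ≠ 0 := by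
      intro θ h0
      have := hlow (Complex.exp (θ * Complex.I)) (by rw [exp_norm_one]; exact hρ) (exp_norm_one θ).le
      rw [h0, norm_zero] at this
      linarith
    have hKc : Continuous fun θ : ℝ => K (Complex.exp (θ * Complex.I)) :=
      h.cont.comp_continuous (by fun_prop) fun θ => by simp
    have key := tendsto_L1_mul (M := δ⁻¹) (u := fun r θ =>
      Complex.I * Complex.exp (θ * Complex.I) / (K (r * Complex.exp (θ * Complex.I)) -
      z * (r * Complex.exp (θ * Complex.I)))) (W := radialDeriv K) (W₀ := b)
      (u₀ := fun θ => Complex.I * Complex.exp (θ * Complex.I) / (K (Complex.exp (θ * Complex.I)) -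
      z * Complex.exp (θ * Complex.I))) Real.two_pi_pos.le ?_ (hb.int _ _) hb.lim ?_ ?_ ?_ ?_
    · refine key.congr fun r => ?_
      refine intervalIntegral.integral_congr fun θ _ => ?_
      simp only [logKernel_eq, bdryParam]
      congr 2
      have h1 := Complex.exp_ne_zero (θ * Complex.I)
      have h2 := hk0 θ
      rw [show K (Complex.exp (θ * Complex.I)) / Complex.exp (θ * Complex.I) - z =
        (K (Complex.exp (θ * Complex.I)) - z * Complex.exp (θ * Complex.I)) /
          Complex.exp (θ * Complex.I) by field_simp]
      field_simp
    · filter_upwards [eventually_mem_Ioo ρ hρ] with r ⟨h0, h1, h2⟩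
      exact (hcW r h0 h2).intervalIntegrable _ _
    · filter_upwards [eventually_mem_Ioo ρ hρ] with r ⟨h0, h1, h2⟩
      exact hcu r h0 h1 h2
    · exact Continuous.div (by fun_prop) (hKc.sub (by fun_prop)) hk0
    · filter_upwards [eventually_mem_Ioo ρ hρ] with r ⟨h0, h1, h2⟩ θ
      have := hlow _ ((hx r h0 θ).symm ▸ h1) ((hx r h0 θ).symm ▸ h2.le)
      rw [norm_div, norm_mul, exp_norm_one, Complex.norm_I, one_mul, one_div]
      exact inv_anti₀ hδ this
    · intro θ
      exact (tendsto_const_nhds).div (tendsto_circle_point (F := fun x => K x - z * x)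
        (h.cont.sub (by fun_prop)) θ) (hk0 θ)

end

section

variable {Γ : Set ℂ} {c : ℝ} {K : ℂ → ℂ} {b : ℝ → ℂ}

lemma integral_div_sub (x₀ : ℂ) {r : ℝ} (hr : ‖x₀‖ < r) :
    ∫ θ in (0 : ℝ)..2 * Real.pi, (r * Complex.exp (θ * Complex.I)) /
      (r * Complex.exp (θ * Complex.I) - x₀) = 2 * Real.pi := by
  have h := circleIntegral.integral_sub_inv_of_mem_ball (c := 0) (w := x₀) (R := r) (by simpa using hr)
  rw [circleIntegral] at h
  simp only [deriv_circleMap, circleMap_zero, smul_eq_mul] at h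
  have e : ∀ θ : ℝ, (r * Complex.exp (θ * Complex.I)) * Complex.I *
      (r * Complex.exp (θ * Complex.I) - x₀)⁻¹ = Complex.I * ((r * Complex.exp (θ * Complex.I)) /
      (r * Complex.exp (θ * Complex.I) - x₀)) := fun θ => by ring
  simp_rw [e] at h
  rw [intervalIntegral.integral_const_mul] at h
  have := Complex.I_ne_zero
  apply mul_left_cancel₀ this
  linear_combination h

lemma ContDiscMap.integral_eq_zero (h : ContDiscMap Γ c K) (hb : IsBdryDeriv K b) {z : ℂ}
    (hz : z ∈ exteriorDomain Γ) :
    ∫ θ in (0 : ℝ)..2 * Real.pi, b θ / (bdryParam K θ - z) = 0 := by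
  have hzΓ : z ∉ Γ := hz.1
  obtain ⟨h1, h2⟩ := h.tendsto_logKernel hb hzΓ
  have h3 := tendsto_integral_of_L1 Real.two_pi_pos.le
    (h1.mono fun r hr => hr.intervalIntegrable _ _)
    ((h.intervalIntegrable_div hb hzΓ _ _).const_mul Complex.I) h2
  rw [intervalIntegral.integral_const_mul] at h3
  suffices hs : ∀ᶠ r : ℝ in 𝓝[<] (1 : ℝ), ∫ θ in (0 : ℝ)..2 * Real.pi,
      logKernel K z (r * Complex.exp (θ * Complex.I)) = 0 by
    have := tendsto_nhds_unique (h3.congr' hs) tendsto_const_nhds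
    exact (mul_eq_zero.1 this).resolve_left Complex.I_ne_zero
  have hz2 := hz
  rw [← h.image] at hz2
  obtain ⟨x₀, ⟨hx₀, hx00⟩, hxz⟩ := hz2
  have hx00 : x₀ ≠ 0 := hx00
  simp only at hxz
  let k : ℂ → ℂ := fun x => K x - z * x
  have hk : DifferentiableOn ℂ k (Metric.ball 0 1) := h.diff.sub (by fun_prop)
  have hk0 : k x₀ = 0 := by simp only [k]; rw [← hxz]; field_simp; ring
  have hKd : ∀ x ∈ Metric.ball (0 : ℂ) 1, HasDerivAt k (deriv K x - z) x := fun x hx => by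
    have := ((h.diff.differentiableAt (Metric.isOpen_ball.mem_nhds hx)).hasDerivAt).sub
      ((hasDerivAt_id' x).const_mul z)
    rw [mul_one] at this
    exact this
  let m := dslope k x₀
  have hm : DifferentiableOn ℂ m (Metric.ball 0 1) :=
    (Complex.differentiableOn_dslope (Metric.isOpen_ball.mem_nhds hx₀)).2 hk
  have hkm : ∀ x, k x = (x - x₀) * m x := by
    intro x
    have := sub_smul_dslope k x₀ x
    rw [hk0, sub_zero, smul_eq_mul] at this
    exact this.symm
  have hm0 : ∀ x ∈ Metric.ball (0 : ℂ) 1, m x ≠ 0 := by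
    intro x hx h0
    by_cases hxx : x = x₀
    · subst hxx
      have h5 : m x = deriv K x - z := by
        simp only [m, dslope_same]
        exact (hKd x hx).deriv
      apply h.deriv_ne x hx
      rw [h0] at h5
      rw [← hxz] at h5
      field_simp at h5
      linear_combination h5
    · have h6 : k x = 0 := by rw [hkm, h0, mul_zero]
      have hx0 : x ≠ 0 := by
        rintro rfl
        simp only [k, h.zero, mul_zero, sub_zero] at h6
        exact h.cpos.ne' (by exact_mod_cast h6)
      apply hxx
      refine h.inj ⟨hx, hx0⟩ ⟨hx₀, hx00⟩ ?_
      simp only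
      rw [hxz, div_eq_iff hx0]
      simp only [k] at h6
      linear_combination h6
  have hA : DifferentiableOn ℂ (fun x => 1 - x * (deriv m x / m x)) (Metric.ball 0 1) :=
    (differentiableOn_const _).sub (differentiableOn_id.mul
      ((hm.deriv Metric.isOpen_ball).div hm hm0))
  have hx₀1 : ‖x₀‖ < 1 := by simpa using hx₀
  filter_upwards [eventually_mem_Ioo ‖x₀‖ hx₀1] with r ⟨r0, r1, r2⟩
  have hne : ∀ θ : ℝ, (r : ℂ) * Complex.exp (θ * Complex.I) - x₀ ≠ 0 := by
    intro θ h0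
    have : ‖(r : ℂ) * Complex.exp (θ * Complex.I)‖ = r := by
      rw [norm_mul, exp_norm_one, mul_one, Complex.norm_real, Real.norm_of_nonneg r0.le]
    rw [sub_eq_zero.1 h0] at this
    exact r1.ne this
  have hpt : ∀ θ : ℝ, logKernel K z (r * Complex.exp (θ * Complex.I)) =
      (1 - (r * Complex.exp (θ * Complex.I)) * (deriv m (r * Complex.exp (θ * Complex.I)) /
        m (r * Complex.exp (θ * Complex.I)))) - (r * Complex.exp (θ * Complex.I)) /
      (r * Complex.exp (θ * Complex.I) - x₀) := by
    intro θ
    have hx := circle_mem r0 r2 θ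
    have hne := hne θ
    generalize (r : ℂ) * Complex.exp (θ * Complex.I) = x at *
    have hd1 := hKd x hx
    have hd2 : HasDerivAt k (1 * m x + (x - x₀) * deriv m x) x := by
      have := ((hasDerivAt_id x).sub_const x₀).mul
        (hm.differentiableAt (Metric.isOpen_ball.mem_nhds hx)).hasDerivAt
      refine this.congr_of_eventuallyEq (Eventually.of_forall fun y => ?_)
      simp [hkm]
    have hd3 := hd1.unique hd2
    have hm0 := hm0 x hx
    have hkx : K x - z * x = (x - x₀) * m x := hkm x
    have hKx : K x - x * deriv K x = (x - x₀) * m x - x * (m x + (x - x₀) * deriv m x) := by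
      linear_combination hkx - x * hd3
    unfold logKernel
    rw [hKx, hkx]
    field_simp
    ring
  simp_rw [hpt]
  have c1 := continuous_circle hA.continuousOn r0 r2
  have c2 : Continuous fun θ : ℝ => (r * Complex.exp (θ * Complex.I)) /
      (r * Complex.exp (θ * Complex.I) - x₀) := Continuous.div (by fun_prop) (by fun_prop) hne
  rw [intervalIntegral.integral_sub (c1.intervalIntegrable _ _) (c2.intervalIntegrable _ _),
    integral_circle_eq hA r0 r2, integral_div_sub x₀ r1]
  simp

/-- A Faber-type operator: a polynomial of degree `n` built from the weight `Q`. -/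
theorem ContDiscMap.exists_faber (h : ContDiscMap Γ c K) (hb : IsBdryDeriv K b) (Q : Polynomial ℂ)
    {n : ℕ} (hQ : Q.natDegree < n) : ∃ P : Polynomial ℂ, P.natDegree ≤ n ∧
      P.coeff n = Q.eval 0 / c ^ n ∧ ∀ z, z ∉ Γ → z ∉ exteriorDomain Γ →
      Real.pi * P.eval z = -∫ θ in (0 : ℝ)..2 * Real.pi,
        Q.eval (Complex.exp (θ * Complex.I)) / Complex.exp (θ * Complex.I) ^ n *
          ((b θ / (bdryParam K θ - z)).im : ℂ) := by
  obtain ⟨P, hP1, hP2, R, hR, hR0, hH⟩ := exists_polynomial_part h.diff h.zero h.cpos.ne' n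
    (fun x => Q.eval x) Q.differentiable.differentiableOn
  refine ⟨P, hP1, hP2, fun z hz hz' => ?_⟩
  obtain ⟨h1, h2⟩ := h.tendsto_logKernel hb hz
  set w₀ : ℝ → ℂ := fun θ => Complex.I * (b θ / (bdryParam K θ - z)) with hw₀
  have hw₀i : IntervalIntegrable w₀ volume 0 (2 * Real.pi) :=
    (h.intervalIntegrable_div hb hz _ _).const_mul Complex.I
  let w : ℝ → ℝ → ℂ := fun r θ => logKernel K z (r * Complex.exp (θ * Complex.I))
  have hwc : ∀ᶠ r : ℝ in 𝓝[<] (1 : ℝ), Continuous (w r) := h1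
  have hwl : Tendsto (fun r => ∫ θ in (0 : ℝ)..2 * Real.pi, ‖w r θ - w₀ θ‖) (𝓝[<] 1) (𝓝 0) := h2
  have hci : ∀ f : ℝ → ℂ, IntervalIntegrable f volume 0 (2 * Real.pi) →
      IntervalIntegrable (fun θ => (starRingEnd ℂ) (f θ)) volume 0 (2 * Real.pi) := fun f hf =>
    ⟨(Complex.conjLIE.integrable_comp_iff).2 hf.1, (Complex.conjLIE.integrable_comp_iff).2 hf.2⟩
  have hv₀i : IntervalIntegrable (fun θ => w₀ θ + (starRingEnd ℂ) (w₀ θ)) volume 0 (2 * Real.pi) :=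
    hw₀i.add (hci _ hw₀i)
  have hvl : Tendsto (fun r => ∫ θ in (0 : ℝ)..2 * Real.pi,
      ‖(w r θ + (starRingEnd ℂ) (w r θ)) - (w₀ θ + (starRingEnd ℂ) (w₀ θ))‖) (𝓝[<] 1) (𝓝 0) := by
    have h5 := hwl.const_mul 2
    rw [mul_zero] at h5
    refine squeeze_zero' (Eventually.of_forall fun r =>
      intervalIntegral.integral_nonneg Real.two_pi_pos.le fun θ _ => norm_nonneg _) ?_ h5
    filter_upwards [hwc] with r hr
    have i1 := hr.intervalIntegrable (μ := volume) 0 (2 * Real.pi)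
    rw [← intervalIntegral.integral_const_mul]
    refine intervalIntegral.integral_mono_on Real.two_pi_pos.le
      ((i1.add (hci _ i1)).sub hv₀i).norm ((i1.sub hw₀i).norm.const_mul 2) fun θ _ => ?_
    have e : (w r θ + (starRingEnd ℂ) (w r θ)) - (w₀ θ + (starRingEnd ℂ) (w₀ θ)) =
        (w r θ - w₀ θ) + (starRingEnd ℂ) (w r θ - w₀ θ) := by rw [map_sub]; ring
    rw [e]
    refine (norm_add_le _ _).trans ?_
    rw [RCLike.norm_conj, two_mul]
  have hQc : Continuous fun x : ℂ => Q.eval x := Q.continuous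
  have hne : ∀ r : ℝ, 0 < r → ∀ θ : ℝ, ((r : ℂ) * Complex.exp (θ * Complex.I)) ^ n ≠ 0 :=
    fun r hr θ => pow_ne_zero _ (mul_ne_zero (by exact_mod_cast hr.ne') (Complex.exp_ne_zero _))
  have huc : ∀ r : ℝ, 0 < r → Continuous fun θ : ℝ => Q.eval (r * Complex.exp (θ * Complex.I)) /
      (r * Complex.exp (θ * Complex.I)) ^ n := fun r hr =>
    Continuous.div (hQc.comp (by fun_prop)) (by fun_prop) (hne r hr)
  obtain ⟨M, hM⟩ := (isCompact_closedBall (0 : ℂ) 1).exists_bound_of_continuousOn hQc.continuousOn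
  have key := tendsto_L1_mul (M := M * 2 ^ n) (T := 2 * Real.pi)
    (u := fun r θ => Q.eval (r * Complex.exp (θ * Complex.I)) / (r * Complex.exp (θ * Complex.I)) ^ n)
    (u₀ := fun θ => Q.eval (Complex.exp (θ * Complex.I)) / Complex.exp (θ * Complex.I) ^ n)
    (W := fun r θ => w r θ + (starRingEnd ℂ) (w r θ))
    (W₀ := fun θ => w₀ θ + (starRingEnd ℂ) (w₀ θ)) Real.two_pi_pos.le
    (hwc.mono fun r hr => (hr.add (Complex.continuous_conj.comp hr)).intervalIntegrable _ _)
    hv₀i hvl ?_ ?_ ?_ ?_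
  rotate_left
  · filter_upwards [eventually_mem_Ioo 0 one_pos] with r hr using huc r hr.1
  · exact Continuous.div (hQc.comp (by fun_prop)) (by fun_prop)
      fun θ => pow_ne_zero _ (Complex.exp_ne_zero _)
  · filter_upwards [eventually_mem_Ioo (1 / 2) (by norm_num)] with r ⟨r0, r1, r2⟩ θ
    have h6 := hM _ (Metric.ball_subset_closedBall (circle_mem r0 r2 θ))
    have h7 : ‖((r : ℂ) * Complex.exp (θ * Complex.I)) ^ n‖ = r ^ n := by
      rw [norm_pow, norm_mul, exp_norm_one, mul_one, Complex.norm_real, Real.norm_of_nonneg r0.le]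
    rw [norm_div, h7, div_le_iff₀ (by positivity), mul_assoc, ← mul_pow]
    have h8 : 1 ≤ (2 * r) ^ n := one_le_pow₀ (by linarith)
    have h9 : 0 ≤ M := (norm_nonneg _).trans h6
    nlinarith
  · intro θ
    have e1 := tendsto_circle_point (F := fun x => Q.eval x) hQc.continuousOn θ
    have e2 := tendsto_circle_point (F := fun x => x ^ n) (by fun_prop) θ
    exact e1.div e2 (pow_ne_zero _ (Complex.exp_ne_zero _))
  have hu₀c : Continuous fun θ : ℝ => Q.eval (Complex.exp (θ * Complex.I)) /
      Complex.exp (θ * Complex.I) ^ n := Continuous.div (hQc.comp (by fun_prop)) (by fun_prop)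
      fun θ => pow_ne_zero _ (Complex.exp_ne_zero _)
  have hlim := tendsto_integral_of_L1 Real.two_pi_pos.le (W₀ := fun θ : ℝ =>
    Q.eval (Complex.exp (θ * Complex.I)) / Complex.exp (θ * Complex.I) ^ n *
      (w₀ θ + (starRingEnd ℂ) (w₀ θ))) ?_ (hv₀i.continuousOn_mul hu₀c.continuousOn) key
  swap
  · filter_upwards [hwc, eventually_mem_Ioo 0 one_pos] with r hr h0
    exact ((huc r h0.1).mul (hr.add (Complex.continuous_conj.comp hr))).intervalIntegrable _ _
  have hval : ∀ᶠ r : ℝ in 𝓝[<] (1 : ℝ), ∫ θ in (0 : ℝ)..2 * Real.pi,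
      Q.eval (r * Complex.exp (θ * Complex.I)) / (r * Complex.exp (θ * Complex.I)) ^ n *
        (w r θ + (starRingEnd ℂ) (w r θ)) = 2 * Real.pi * P.eval z := by
    filter_upwards [hwc, eventually_mem_Ioo 0 one_pos] with r hr ⟨r0, _, r1⟩
    have e1 := h.two_pi_mul_eval hz' hR hR0 hH r0 r1
    have e2 := integral_eval_mul_conj (h.differentiableOn_logKernel hz') hQ r0 r1
    have hc1 : Continuous fun θ : ℝ => Q.eval (r * Complex.exp (θ * Complex.I)) /
      (r * Complex.exp (θ * Complex.I)) ^ n * w r θ := (huc r r0).mul hr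
    have hc2 : Continuous fun θ : ℝ => Q.eval (r * Complex.exp (θ * Complex.I)) /
      (r * Complex.exp (θ * Complex.I)) ^ n * (starRingEnd ℂ) (w r θ) :=
      (huc r r0).mul (Complex.continuous_conj.comp hr)
    simp_rw [mul_add]
    rw [intervalIntegral.integral_add (hc1.intervalIntegrable _ _) (hc2.intervalIntegrable _ _)]
    simp only [w]
    rw [e1, e2, add_zero]
  have hfin := tendsto_nhds_unique (hlim.congr' hval) tendsto_const_nhds
  have e3 : ∀ θ : ℝ, Q.eval (Complex.exp (θ * Complex.I)) / Complex.exp (θ * Complex.I) ^ n *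
      (w₀ θ + (starRingEnd ℂ) (w₀ θ)) = (-2) * (Q.eval (Complex.exp (θ * Complex.I)) /
        Complex.exp (θ * Complex.I) ^ n * ((b θ / (bdryParam K θ - z)).im : ℂ)) := by
    intro θ
    rw [Complex.add_conj]
    simp only [hw₀, Complex.mul_re, Complex.I_re, Complex.I_im, zero_mul, one_mul, zero_sub]
    push_cast
    ring
  simp_rw [e3] at hfin
  rw [intervalIntegral.integral_const_mul] at hfin
  linear_combination (-1 / 2) * hfin

end

section Dini
variable {γ γ' : ℝ → ℂ} {a b : ℝ}

lemma _root_.IsDiniSmoothArc.exists_majorant (h : IsDiniSmoothArc γ γ' a b) : ∃ ω : ℝ → ℝ,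
    (∀ s ∈ Icc a b, ∀ t ∈ Icc a b, ∀ u, |s - t| ≤ u → ‖γ' s - γ' t‖ ≤ ω u) ∧
    MonotoneOn ω (Ici 0) ∧ (∀ t, 0 ≤ t → 0 ≤ ω t) ∧
    (∀ s t, IntervalIntegrable (fun u => ω |u| / |u|) volume s t) ∧
    ∀ ε > 0, ∃ δ > 0, ω δ ≤ ε ∧ ∫ u in (-δ)..δ, ω |u| / |u| ≤ ε := by
  obtain ⟨M, hM⟩ := isCompact_Icc.exists_bound_of_continuousOn h.cont
  have hbdd : ∀ t, BddAbove {d : ℝ | ∃ s₁ ∈ Icc a b, ∃ s₂ ∈ Icc a b, |s₁ - s₂| ≤ t ∧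
      d = ‖γ' s₁ - γ' s₂‖} := by
    intro t
    refine ⟨M + M, ?_⟩
    rintro d ⟨s₁, h1, s₂, h2, -, rfl⟩
    exact (norm_sub_le _ _).trans (add_le_add (hM _ h1) (hM _ h2))
  set ω := modCont γ' a b with hω
  have hmem : ∀ s ∈ Icc a b, ∀ t ∈ Icc a b, ∀ u, |s - t| ≤ u → ‖γ' s - γ' t‖ ≤ ω u :=
    fun s hs t ht u hu => le_csSup (hbdd u) ⟨s, hs, t, ht, hu, rfl⟩
  have ha : a ∈ Icc a b := left_mem_Icc.2 h.lt.le
  have hnn : ∀ t, 0 ≤ t → 0 ≤ ω t := fun t ht => by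
    have := hmem a ha a ha t (by simpa using ht)
    simpa using this
  have hle : ∀ t, 0 ≤ t → ∀ B, (∀ s ∈ Icc a b, ∀ s' ∈ Icc a b, |s - s'| ≤ t → ‖γ' s - γ' s'‖ ≤ B) →
      ω t ≤ B := by
    intro t ht B hB
    refine csSup_le ⟨_, a, ha, a, ha, by simpa using ht, rfl⟩ ?_
    rintro d ⟨s₁, h1, s₂, h2, h3, rfl⟩
    exact hB s₁ h1 s₂ h2 h3
  have hmono : MonotoneOn ω (Ici 0) := fun s hs t ht hst => hle s hs _ fun x hx y hy hxy =>
    hmem x hx y hy t (hxy.trans hst)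
  have hsmall : ∀ ε > 0, ∃ δ > 0, ω δ ≤ ε := by
    intro ε hε
    obtain ⟨δ, hδ, hδ'⟩ := Metric.uniformContinuousOn_iff_le.1
      (isCompact_Icc.uniformContinuousOn_of_continuous h.cont) ε hε
    refine ⟨δ, hδ, hle δ hδ.le ε fun x hx y hy hxy => ?_⟩
    rw [← dist_eq_norm]
    exact hδ' x hx y hy hxy
  have hpos : ∀ L, 1 ≤ L → IntervalIntegrable (fun u => ω |u| / |u|) volume 0 L := by
    intro L hL
    have h1 : IntervalIntegrable (fun u => ω |u| / |u|) volume 0 1 := by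
      rw [intervalIntegrable_iff_integrableOn_Ioc_of_le zero_le_one]
      refine h.dini.congr_fun (fun t ht => ?_) measurableSet_Ioc
      simp only [abs_of_pos ht.1]; rfl
    have h2 : IntervalIntegrable (fun u => ω |u| / |u|) volume 1 L := by
      have h3 : IntervalIntegrable ω volume 1 L := by
        refine MonotoneOn.intervalIntegrable (hmono.mono ?_)
        rw [uIcc_of_le hL]
        exact fun x hx => zero_le_one.trans hx.1
      have h4 : IntervalIntegrable (fun u => ω u * u⁻¹) volume 1 L := by
        refine h3.mul_continuousOn (continuousOn_id.inv₀ ?_)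
        rw [uIcc_of_le hL]
        exact fun x hx => (zero_lt_one.trans_le hx.1).ne'
      refine h4.congr fun t ht => ?_
      rw [uIoc_of_le hL] at ht
      have ht0 : 0 < t := zero_lt_one.trans ht.1
      simp only [abs_of_pos ht0]; rfl
    exact h1.trans h2
  have hint : ∀ L, 1 ≤ L → IntervalIntegrable (fun u => ω |u| / |u|) volume (-L) L := by
    intro L hL
    have h1 := hpos L hL
    have h2 := (IntervalIntegrable.iff_comp_neg).1 h1
    simp only [abs_neg, neg_zero] at h2
    exact h2.symm.trans h1
  have hall : ∀ s t, IntervalIntegrable (fun u => ω |u| / |u|) volume s t := by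
    intro s t
    have h1 := hint (max 1 (max |s| |t|)) (le_max_left _ _)
    have h2 : |s| ≤ max 1 (max |s| |t|) := (le_max_left _ _).trans (le_max_right _ _)
    have h3 : |t| ≤ max 1 (max |s| |t|) := (le_max_right _ _).trans (le_max_right _ _)
    refine h1.mono_set (uIcc_subset_uIcc ?_ ?_)
    · rw [uIcc_of_le (by linarith [abs_nonneg s])]
      exact abs_le.1 h2
    · rw [uIcc_of_le (by linarith [abs_nonneg t])]
      exact abs_le.1 h3
  refine ⟨ω, hmem, hmono, hnn, hall, fun ε hε => ?_⟩
  obtain ⟨δ₁, hδ₁, h1⟩ := hsmall ε hε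
  have hc := intervalIntegral.continuous_primitive hall 0
  have hc2 : Continuous fun δ : ℝ => ∫ u in (-δ)..δ, ω |u| / |u| := by
    have : ∀ δ : ℝ, ∫ u in (-δ)..δ, ω |u| / |u| =
        (∫ u in (0 : ℝ)..δ, ω |u| / |u|) - ∫ u in (0 : ℝ)..(-δ), ω |u| / |u| := fun δ =>
      (intervalIntegral.integral_interval_sub_left (hall _ _) (hall _ _)).symm
    simp_rw [this]
    exact hc.sub (hc.comp continuous_neg)
  have h2 : ∀ᶠ δ in 𝓝 (0 : ℝ), ∫ u in (-δ)..δ, ω |u| / |u| < ε := by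
    refine (hc2.tendsto 0).eventually_lt_const ?_
    simpa using hε
  obtain ⟨δ₂, hδ₂, h3⟩ := Metric.eventually_nhds_iff.1 h2
  refine ⟨min δ₁ (δ₂ / 2), by positivity, ?_, (h3 ?_).le⟩
  · exact (hmono (show (0 : ℝ) ≤ _ by positivity) hδ₁.le (min_le_left _ _)).trans h1
  · rw [Real.dist_eq, sub_zero, abs_of_pos (by positivity)]
    exact (min_le_right _ _).trans_lt (by linarith)

lemma integral_poisson_le (τ s₀ p q : ℝ) :
    ∫ s in p..q, |τ| / ((s - s₀) ^ 2 + τ ^ 2) ≤ Real.pi := by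
  rcases eq_or_ne τ 0 with rfl | hτ
  · simp [Real.pi_pos.le]
  · have hτ' : 0 < |τ| := abs_pos.2 hτ
    have hd : ∀ s, HasDerivAt (fun s => Real.arctan ((s - s₀) / |τ|))
        (|τ| / ((s - s₀) ^ 2 + τ ^ 2)) s := by
      intro s
      have h1 := (((hasDerivAt_id' s).sub_const s₀).div_const |τ|).arctan
      convert h1 using 1
      rw [← sq_abs τ]
      field_simp
      ring
    rw [intervalIntegral.integral_eq_sub_of_hasDerivAt (fun s _ => hd s)]
    · have := Real.arctan_lt_pi_div_two ((q - s₀) / |τ|)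
      have := Real.neg_pi_div_two_lt_arctan ((p - s₀) / |τ|)
      linarith
    · refine Continuous.intervalIntegrable (Continuous.div (by fun_prop) (by fun_prop) fun s => ?_) _ _
      positivity

lemma continuous_poisson (s₀ : ℝ) {τ : ℝ} (hτ : τ ≠ 0) :
    Continuous fun s : ℝ => |τ| / ((s - s₀) ^ 2 + τ ^ 2) :=
  Continuous.div (by fun_prop) (by fun_prop) fun s => by positivity

lemma _root_.IsDiniSmoothArc.norm_sub_sub_le (h : IsDiniSmoothArc γ γ' a b) {s t : ℝ}
    (hs : s ∈ Icc a b) (ht : t ∈ Icc a b) {B : ℝ} {v : ℂ}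
    (hB : ∀ x ∈ uIcc s t, ‖γ' x - v‖ ≤ B) :
    ‖γ s - γ t - v * ((s - t : ℝ) : ℂ)‖ ≤ B * |s - t| := by
  have hsub : uIcc s t ⊆ Icc a b := ordConnected_Icc.uIcc_subset hs ht
  have hd : ∀ x ∈ uIcc s t, HasDerivWithinAt (fun x : ℝ => γ x - v * x) (γ' x - v) (uIcc s t) x := by
    intro x hx
    have h1 := (h.deriv x (hsub hx)).mono hsub
    have h2 : HasDerivWithinAt (fun x : ℝ => v * (x : ℂ)) v (uIcc s t) x := by
      have := ((Complex.ofRealCLM.hasDerivAt (x := x)).const_mul v).hasDerivWithinAt (s := uIcc s t)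
      simpa using this
    exact h1.sub h2
  have := (convex_uIcc s t).norm_image_sub_le_of_norm_hasDerivWithin_le hd hB right_mem_uIcc
    left_mem_uIcc
  rw [Real.norm_eq_abs] at this
  have e : γ s - γ t - v * ((s - t : ℝ) : ℂ) = γ s - v * s - (γ t - v * t) := by push_cast; ring
  rw [e]
  exact this

lemma _root_.IsDiniSmoothArc.exists_lower (h : IsDiniSmoothArc γ γ' a b) :
    ∃ m > 0, ∀ s ∈ Icc a b, m ≤ ‖γ' s‖ := by
  obtain ⟨s, hs, hmin⟩ := isCompact_Icc.exists_isMinOn (nonempty_Icc.2 h.lt.le) h.cont.norm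
  exact ⟨‖γ' s‖, norm_pos_iff.2 (h.nonzero s hs), fun t ht => hmin ht⟩

lemma _root_.IsDiniSmoothArc.continuousOn (h : IsDiniSmoothArc γ γ' a b) : ContinuousOn γ (Icc a b) :=
  fun s hs => (h.deriv s hs).continuousWithinAt

/-- Near `s₀` the logarithmic derivative along the arc is close to that along the tangent line. -/
lemma _root_.IsDiniSmoothArc.exists_tangent_approx (h : IsDiniSmoothArc γ γ' a b) {ε : ℝ} (hε : 0 < ε) :
    ∃ δ > 0, ∃ F : ℝ → ℝ, (∀ s t, IntervalIntegrable F volume s t) ∧ (∀ u, 0 ≤ F u) ∧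
      ∫ u in (-δ)..δ, F u ≤ ε ∧ ∀ s₀ ∈ Icc a b, ∀ s ∈ Icc a b, |s - s₀| ≤ δ → ∀ τ : ℝ, τ ≠ 0 →
        γ s - (γ s₀ + τ * Complex.I * γ' s₀) ≠ 0 ∧
        ‖γ' s / (γ s - (γ s₀ + τ * Complex.I * γ' s₀)) -
          1 / (((s - s₀ : ℝ) : ℂ) - τ * Complex.I)‖ ≤ F (s - s₀) := by
  obtain ⟨m, hm, hlow⟩ := h.exists_lower
  obtain ⟨ω, h1, h2, h3, h4, h5⟩ := h.exists_majorant
  obtain ⟨δ, hδ, h6, h7⟩ := h5 (min (m / 2) (ε * m / 4)) (by positivity)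
  refine ⟨δ, hδ, fun u => 4 / m * (ω |u| / |u|), fun s t => (h4 s t).const_mul _, fun u =>
    mul_nonneg (by positivity) (div_nonneg (h3 _ (abs_nonneg _)) (abs_nonneg _)), ?_, ?_⟩
  · rw [intervalIntegral.integral_const_mul]
    calc _ ≤ 4 / m * (ε * m / 4) := by gcongr; exact h7.trans (min_le_right _ _)
      _ = ε := by field_simp
  · intro s₀ hs₀ s hs hss τ hτ
    set u := s - s₀ with hu
    have hω : ω |u| ≤ m / 2 :=
      (h2 (abs_nonneg u) hδ.le hss).trans (h6.trans (min_le_left _ _))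
    have hω0 := h3 _ (abs_nonneg u)
    have hin : ∀ x ∈ uIcc s s₀, x ∈ Icc a b := fun x hx => ordConnected_Icc.uIcc_subset hs hs₀ hx
    have e1 : ‖γ s - γ s₀ - γ' s₀ * (u : ℂ)‖ ≤ ω |u| * |u| :=
      h.norm_sub_sub_le hs hs₀ fun x hx => h1 x (hin x hx) s₀ hs₀ _ (by
        exact abs_sub_left_of_mem_uIcc (uIcc_comm s s₀ ▸ hx))
    have e2 : ‖γ s - γ s₀ - γ' s * (u : ℂ)‖ ≤ ω |u| * |u| :=
      h.norm_sub_sub_le hs hs₀ fun x hx => h1 x (hin x hx) s hs _ (by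
        rw [hu, abs_sub_comm s s₀]; exact abs_sub_left_of_mem_uIcc hx)
    have e3 : ‖γ' s - γ' s₀‖ ≤ ω |u| := h1 s hs s₀ hs₀ _ le_rfl
    set w : ℂ := (u : ℂ) - τ * Complex.I with hw
    have hwu : |u| ≤ ‖w‖ := by
      have := Complex.abs_re_le_norm w
      simpa [hw] using this
    have hwτ : |τ| ≤ ‖w‖ := by
      have := Complex.abs_im_le_norm w
      simpa [hw] using this
    have hw0 : 0 < ‖w‖ := (abs_pos.2 hτ).trans_le hwτ
    have hT := hlow s₀ hs₀
    set k : ℂ := γ s - (γ s₀ + τ * Complex.I * γ' s₀) with hk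
    have hkw : m / 2 * ‖w‖ ≤ ‖k‖ := by
      have e : γ' s₀ * w = k - (γ s - γ s₀ - γ' s₀ * (u : ℂ)) := by rw [hw, hk]; ring
      have e4 := norm_sub_le k (γ s - γ s₀ - γ' s₀ * (u : ℂ))
      rw [← e, norm_mul] at e4
      have e5 : m * ‖w‖ ≤ ‖γ' s₀‖ * ‖w‖ := mul_le_mul_of_nonneg_right hT hw0.le
      have e6 : ω |u| * |u| ≤ m / 2 * ‖w‖ := mul_le_mul hω hwu (abs_nonneg _) (by positivity)
      linarith
    have hk0 : k ≠ 0 := norm_pos_iff.1 ((by positivity : 0 < m / 2 * ‖w‖).trans_le hkw)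
    have hwc : w ≠ 0 := norm_pos_iff.1 hw0
    refine ⟨hk0, ?_⟩
    have e7 : γ' s / k - 1 / w = (-(γ s - γ s₀ - γ' s * (u : ℂ)) - τ * Complex.I * (γ' s - γ' s₀)) /
        (k * w) := by
      rw [div_sub_div _ _ hk0 hwc]
      congr 1
      rw [hw, hk]; ring
    have e8 : ‖-(γ s - γ s₀ - γ' s * (u : ℂ)) - τ * Complex.I * (γ' s - γ' s₀)‖ ≤
        ω |u| * (2 * ‖w‖) := by
      refine (norm_sub_le _ _).trans ?_
      rw [norm_neg, norm_mul, norm_mul, Complex.norm_I, mul_one, Complex.norm_real, Real.norm_eq_abs]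
      have q1 : |τ| * ‖γ' s - γ' s₀‖ ≤ ‖w‖ * ω |u| := mul_le_mul hwτ e3 (norm_nonneg _) hw0.le
      have q2 : ω |u| * |u| ≤ ω |u| * ‖w‖ := mul_le_mul_of_nonneg_left hwu hω0
      linarith
    rcases eq_or_ne u 0 with hu0 | hu0
    · have hss0 : s = s₀ := sub_eq_zero.1 hu0
      have : γ' s / k - 1 / w = 0 := by
        rw [e7, hss0, hu0]; simp
      rw [this, hu0]; simp
    · have hu1 : 0 < |u| := abs_pos.2 hu0
      rw [e7, norm_div, norm_mul]
      calc _ ≤ ω |u| * (2 * ‖w‖) / (m / 2 * ‖w‖ * ‖w‖) := by gcongr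
        _ = 4 / m * (ω |u| / ‖w‖) := by field_simp; ring
        _ ≤ 4 / m * (ω |u| / |u|) := by gcongr

end Dini

section Dini
variable {γ γ' : ℝ → ℂ} {a b : ℝ}

lemma _root_.IsDiniSmoothArc.intervalIntegrable_div (h : IsDiniSmoothArc γ γ' a b) {z : ℂ} {p q : ℝ}
    (hp : p ∈ Icc a b) (hq : q ∈ Icc a b) (hz : ∀ s ∈ uIcc p q, γ s - z ≠ 0) :
    ContinuousOn (fun s => γ' s / (γ s - z)) (uIcc p q) := by
  have hsub : uIcc p q ⊆ Icc a b := ordConnected_Icc.uIcc_subset hp hq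
  exact (h.cont.mono hsub).div ((h.continuousOn.mono hsub).sub continuousOn_const) hz

lemma abs_im_one_div_sub (u τ : ℝ) : |(1 / ((u : ℂ) - τ * Complex.I)).im| = |τ| / (u ^ 2 + τ ^ 2) := by
  have hn : Complex.normSq ((u : ℂ) - τ * Complex.I) = u ^ 2 + τ ^ 2 := by
    simp [Complex.normSq_apply]; ring
  rw [one_div, Complex.inv_im, hn, abs_div, abs_of_nonneg (show (0 : ℝ) ≤ u ^ 2 + τ ^ 2 by positivity)]
  simp

lemma integral_near_le {F : ℝ → ℝ} {δ ε : ℝ} (hF : ∀ s t, IntervalIntegrable F volume s t)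
    (hF0 : ∀ u, 0 ≤ F u) (hδ : ∫ u in (-δ)..δ, F u ≤ ε) {s₀ p q : ℝ} (hpq : p ≤ q)
    (hp : |p - s₀| ≤ δ) (hq : |q - s₀| ≤ δ) : ∫ s in p..q, F (s - s₀) ≤ ε := by
  rw [intervalIntegral.integral_comp_sub_right F s₀]
  refine (intervalIntegral.integral_mono_interval (abs_le.1 hp).1 (by linarith) (abs_le.1 hq).2
    (Eventually.of_forall hF0) (hF _ _)).trans hδ

lemma abs_sub_le_of_mem {s p q s₀ δ : ℝ} (hs : s ∈ Icc p q) (hp : |p - s₀| ≤ δ) (hq : |q - s₀| ≤ δ) :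
    |s - s₀| ≤ δ := by
  rw [abs_le] at *
  constructor <;> linarith [hs.1, hs.2]

/-- Near its foot, a point on the normal sees the arc under an angle of at most about `π`. -/
lemma _root_.IsDiniSmoothArc.exists_near_bound (h : IsDiniSmoothArc γ γ' a b) {ε : ℝ} (hε : 0 < ε) :
    ∃ δ > 0, ∀ s₀ ∈ Icc a b, ∀ p ∈ Icc a b, ∀ q ∈ Icc a b, p ≤ q → |p - s₀| ≤ δ → |q - s₀| ≤ δ →
      ∀ τ : ℝ, τ ≠ 0 → (∀ s ∈ Icc p q, γ s - (γ s₀ + τ * Complex.I * γ' s₀) ≠ 0) ∧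
        ∫ s in p..q, |(γ' s / (γ s - (γ s₀ + τ * Complex.I * γ' s₀))).im| ≤ Real.pi + ε := by
  obtain ⟨δ, hδ, F, hF, hF0, hFε, happ⟩ := h.exists_tangent_approx hε
  refine ⟨δ, hδ, fun s₀ hs₀ p hp q hq hpq hpδ hqδ τ hτ => ?_⟩
  have hsub : Icc p q ⊆ Icc a b := Icc_subset_Icc hp.1 hq.2
  have hin : ∀ s ∈ Icc p q, s ∈ Icc a b ∧ |s - s₀| ≤ δ := fun s hs =>
    ⟨hsub hs, abs_sub_le_of_mem hs hpδ hqδ⟩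
  have hne : ∀ s ∈ Icc p q, γ s - (γ s₀ + τ * Complex.I * γ' s₀) ≠ 0 := fun s hs =>
    (happ s₀ hs₀ s (hin s hs).1 (hin s hs).2 τ hτ).1
  refine ⟨hne, ?_⟩
  have hc := h.intervalIntegrable_div hp hq (by rwa [uIcc_of_le hpq])
  have i1 : IntervalIntegrable (fun s => |(γ' s / (γ s - (γ s₀ + τ * Complex.I * γ' s₀))).im|)
      volume p q := (Complex.continuous_im.comp_continuousOn hc).abs.intervalIntegrable
  have i2 := (continuous_poisson s₀ hτ).intervalIntegrable (μ := volume) p q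
  have i3 : IntervalIntegrable (fun s => F (s - s₀)) volume p q := by
    simpa using (hF (p - s₀) (q - s₀)).comp_sub_right s₀
  calc _ ≤ ∫ s in p..q, (|τ| / ((s - s₀) ^ 2 + τ ^ 2) + F (s - s₀)) := by
        refine intervalIntegral.integral_mono_on hpq i1 (i2.add i3) fun s hs => ?_
        have h1 := (happ s₀ hs₀ s (hin s hs).1 (hin s hs).2 τ hτ).2
        have h2 := Complex.abs_im_le_norm (γ' s / (γ s - (γ s₀ + τ * Complex.I * γ' s₀)) -
          1 / (((s - s₀ : ℝ) : ℂ) - τ * Complex.I))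
        rw [Complex.sub_im] at h2
        rw [← abs_im_one_div_sub]
        have h3 := abs_sub_abs_le_abs_sub (γ' s / (γ s - (γ s₀ + τ * Complex.I * γ' s₀))).im
          (1 / (((s - s₀ : ℝ) : ℂ) - τ * Complex.I)).im
        linarith
    _ = (∫ s in p..q, |τ| / ((s - s₀) ^ 2 + τ ^ 2)) + ∫ s in p..q, F (s - s₀) :=
        intervalIntegral.integral_add i2 i3
    _ ≤ Real.pi + ε := add_le_add (integral_poisson_le τ s₀ p q)
        (integral_near_le hF hF0 hFε hpq hpδ hqδ)

/-- The logarithmic integral jumps when crossing the arc along the normal. -/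
lemma _root_.IsDiniSmoothArc.exists_jump (h : IsDiniSmoothArc γ γ' a b) :
    ∃ δ > 0, ∀ s₀ ∈ Icc a b, ∀ δ' > 0, δ' ≤ δ → s₀ - δ' ∈ Icc a b → s₀ + δ' ∈ Icc a b →
      ∀ τ : ℝ, 0 < τ → τ ≤ δ' →
        1 ≤ ‖∫ s in (s₀ - δ')..(s₀ + δ'), (γ' s / (γ s - (γ s₀ + τ * Complex.I * γ' s₀)) -
          γ' s / (γ s - (γ s₀ + (-τ : ℝ) * Complex.I * γ' s₀)))‖ := by
  obtain ⟨δ, hδ, F, hF, hF0, hFε, happ⟩ := h.exists_tangent_approx one_pos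
  refine ⟨δ, hδ, fun s₀ hs₀ δ' hδ' hδδ hp hq τ hτ hτδ => ?_⟩
  set p := s₀ - δ' with hpd
  set q := s₀ + δ' with hqd
  have hpq : p ≤ q := by linarith
  have hpδ : |p - s₀| ≤ δ := by rw [hpd, abs_le]; constructor <;> linarith
  have hqδ : |q - s₀| ≤ δ := by rw [hqd, abs_le]; constructor <;> linarith
  have hsub : Icc p q ⊆ Icc a b := Icc_subset_Icc hp.1 hq.2
  have hin : ∀ s ∈ Icc p q, s ∈ Icc a b ∧ |s - s₀| ≤ δ := fun s hs =>
    ⟨hsub hs, abs_sub_le_of_mem hs hpδ hqδ⟩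
  have hτ' : (-τ : ℝ) ≠ 0 := neg_ne_zero.2 hτ.ne'
  have hcont : ∀ t : ℝ, t ≠ 0 → IntervalIntegrable
      (fun s => γ' s / (γ s - (γ s₀ + t * Complex.I * γ' s₀))) volume p q := fun t ht =>
    (h.intervalIntegrable_div hp hq (by
      rw [uIcc_of_le hpq]
      exact fun s hs => (happ s₀ hs₀ s (hin s hs).1 (hin s hs).2 t ht).1)).intervalIntegrable
  have hw0 : ∀ t : ℝ, t ≠ 0 → ∀ s : ℝ, ((s - s₀ : ℝ) : ℂ) - t * Complex.I ≠ 0 := by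
    intro t ht s h0
    have := congrArg Complex.im h0
    simp [ht] at this
  have hcw : ∀ t : ℝ, t ≠ 0 → Continuous fun s : ℝ => 1 / (((s - s₀ : ℝ) : ℂ) - t * Complex.I) :=
    fun t ht => Continuous.div (by fun_prop) (by fun_prop) (hw0 t ht)
  set A : ℝ → ℂ := fun s => γ' s / (γ s - (γ s₀ + τ * Complex.I * γ' s₀)) -
          γ' s / (γ s - (γ s₀ + (-τ : ℝ) * Complex.I * γ' s₀)) with hA
  set B : ℝ → ℂ := fun s => 1 / (((s - s₀ : ℝ) : ℂ) - τ * Complex.I) -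
    1 / (((s - s₀ : ℝ) : ℂ) - (-τ : ℝ) * Complex.I) with hB
  have iA : IntervalIntegrable A volume p q := (hcont τ hτ.ne').sub (hcont (-τ) hτ')
  have hBc : Continuous B := (hcw τ hτ.ne').sub (hcw (-τ) hτ')
  have i3 : IntervalIntegrable (fun s => 2 * F (s - s₀)) volume p q := by
    simpa using ((hF (p - s₀) (q - s₀)).comp_sub_right s₀).const_mul 2
  have hAB : ‖∫ s in p..q, (A s - B s)‖ ≤ 2 := by
    refine (intervalIntegral.norm_integral_le_of_norm_le hpq (g := fun s => 2 * F (s - s₀))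
      (Eventually.of_forall fun s hs => ?_) i3).trans ?_
    · have hs' := hin s (Ioc_subset_Icc_self hs)
      have h1 := (happ s₀ hs₀ s hs'.1 hs'.2 τ hτ.ne').2
      have h2 := (happ s₀ hs₀ s hs'.1 hs'.2 (-τ) hτ').2
      have e : A s - B s = (γ' s / (γ s - (γ s₀ + τ * Complex.I * γ' s₀)) -
          1 / (((s - s₀ : ℝ) : ℂ) - τ * Complex.I)) - (γ' s / (γ s - (γ s₀ + (-τ : ℝ) * Complex.I * γ' s₀))
          - 1 / (((s - s₀ : ℝ) : ℂ) - (-τ : ℝ) * Complex.I)) := by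
        simp only [hA, hB]; ring
      rw [e]
      exact (norm_sub_le _ _).trans (by linarith)
    · rw [intervalIntegral.integral_const_mul]
      have := integral_near_le hF hF0 hFε hpq hpδ hqδ
      linarith
  have hBv : ∀ s, B s = ((2 * (τ / ((s - s₀) ^ 2 + τ ^ 2)) : ℝ) : ℂ) * Complex.I := by
    intro s
    have h1 := hw0 τ hτ.ne' s
    have h2 := hw0 (-τ) hτ' s
    have h3 : (s - s₀) ^ 2 + τ ^ 2 ≠ 0 := by positivity
    have h4 : (((s - s₀ : ℝ) : ℂ) - τ * Complex.I) * (((s - s₀ : ℝ) : ℂ) - (-τ : ℝ) * Complex.I) =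
        (((s - s₀) ^ 2 + τ ^ 2 : ℝ) : ℂ) := by
      push_cast
      linear_combination (-(τ : ℂ) ^ 2) * Complex.I_sq
    simp only [hB]
    rw [div_sub_div _ _ h1 h2, h4, ← mul_div_assoc, Complex.ofReal_div, div_mul_eq_mul_div]
    congr 1
    push_cast
    ring
  have hd : ∀ s, HasDerivAt (fun s => 2 * Real.arctan ((s - s₀) / τ))
      (2 * (τ / ((s - s₀) ^ 2 + τ ^ 2))) s := by
    intro s
    have h1 := (((hasDerivAt_id' s).sub_const s₀).div_const τ).arctan.const_mul 2
    refine h1.congr_deriv ?_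
    have : (s - s₀) ^ 2 + τ ^ 2 ≠ 0 := by positivity
    have : 1 + ((s - s₀) / τ) ^ 2 ≠ 0 := by positivity
    field_simp
    ring
  have hBi : ∫ s in p..q, B s = ((4 * Real.arctan (δ' / τ) : ℝ) : ℂ) * Complex.I := by
    simp_rw [hBv]
    rw [intervalIntegral.integral_mul_const, intervalIntegral.integral_ofReal,
      intervalIntegral.integral_eq_sub_of_hasDerivAt (fun s _ => hd s)]
    · congr 2
      rw [hpd, hqd, show s₀ - δ' - s₀ = -δ' by ring, show s₀ + δ' - s₀ = δ' by ring, neg_div,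
        Real.arctan_neg]
      ring
    · refine Continuous.intervalIntegrable (continuous_const.mul
        (Continuous.div (by fun_prop) (by fun_prop) fun s => ?_)) _ _
      positivity
  have hat : Real.pi / 4 ≤ Real.arctan (δ' / τ) := by
    rw [← Real.arctan_one]
    exact Real.arctan_strictMono.monotone ((one_le_div hτ).2 hτδ)
  have hBn : Real.pi ≤ ‖∫ s in p..q, B s‖ := by
    rw [hBi, norm_mul, Complex.norm_I, mul_one, Complex.norm_real, Real.norm_eq_abs]
    exact le_trans (by linarith) (le_abs_self _)
  rw [intervalIntegral.integral_sub iA (hBc.intervalIntegrable _ _), norm_sub_rev] at hAB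
  have := norm_sub_norm_le (∫ s in p..q, B s) (∫ s in p..q, A s)
  have := Real.pi_gt_three
  linarith

lemma _root_.IsDiniSmoothArc.exists_chord_arc (h : IsDiniSmoothArc γ γ' a b) :
    ∃ κ > 0, ∀ s ∈ Icc a b, ∀ t ∈ Icc a b, κ * |s - t| ≤ ‖γ s - γ t‖ := by
  obtain ⟨m, hm, hlow⟩ := h.exists_lower
  obtain ⟨ω, h1, h2, h3, h4, h5⟩ := h.exists_majorant
  obtain ⟨δ, hδ, h6, -⟩ := h5 (m / 2) (by positivity)
  have hK : IsCompact ((Icc a b ×ˢ Icc a b) ∩ {p : ℝ × ℝ | δ ≤ |p.1 - p.2|}) :=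
    (isCompact_Icc.prod isCompact_Icc).inter_right (isClosed_le continuous_const (by fun_prop))
  have hcont : ContinuousOn (fun p : ℝ × ℝ => ‖γ p.1 - γ p.2‖)
      ((Icc a b ×ˢ Icc a b) ∩ {p : ℝ × ℝ | δ ≤ |p.1 - p.2|}) :=
    ((h.continuousOn.comp continuousOn_fst fun p hp => hp.1.1).sub
      (h.continuousOn.comp continuousOn_snd fun p hp => hp.1.2)).norm
  obtain ⟨μ, hμ, hμ'⟩ := hK.exists_forall_le' hcont (a := 0) fun p hp => by
    rw [norm_pos_iff]
    intro h0
    have := h.inj hp.1.1 hp.1.2 (sub_eq_zero.1 h0)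
    have h7 : δ ≤ |p.1 - p.2| := hp.2
    rw [this, sub_self, abs_zero] at h7
    linarith
  have hL : 0 < b - a := sub_pos.2 h.lt
  refine ⟨min (m / 2) (μ / (b - a)), by positivity, fun s hs t ht => ?_⟩
  rcases le_total δ |s - t| with hd | hd
  · have h7 : μ ≤ ‖γ s - γ t‖ := hμ' (s, t) ⟨⟨hs, ht⟩, hd⟩
    have h8 : |s - t| ≤ b - a := by
      rw [abs_le]; constructor <;> linarith [hs.1, hs.2, ht.1, ht.2]
    calc _ ≤ μ / (b - a) * (b - a) := by gcongr; exact min_le_right _ _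
      _ = μ := by field_simp
      _ ≤ _ := h7
  · have h7 := h.norm_sub_sub_le hs ht (v := γ' t) (B := m / 2) fun x hx =>
      (h1 x (ordConnected_Icc.uIcc_subset hs ht hx) t ht δ
        ((abs_sub_left_of_mem_uIcc (uIcc_comm s t ▸ hx)).trans hd)).trans h6
    have h8 := norm_sub_norm_le (γ' t * ((s - t : ℝ) : ℂ)) (γ s - γ t)
    rw [norm_sub_rev (γ' t * _), norm_mul, Complex.norm_real, Real.norm_eq_abs] at h8
    have h9 : m * |s - t| ≤ ‖γ' t‖ * |s - t| := mul_le_mul_of_nonneg_right (hlow t ht) (abs_nonneg _)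
    have h10 : min (m / 2) (μ / (b - a)) * |s - t| ≤ m / 2 * |s - t| := by
      gcongr; exact min_le_left _ _
    linarith

/-- The variation of the argument along the arc is bounded uniformly in the base point. -/
lemma _root_.IsDiniSmoothArc.exists_variation_bound (h : IsDiniSmoothArc γ γ' a b) :
    ∃ V, 0 ≤ V ∧ ∀ z, (∀ s ∈ Icc a b, γ s - z ≠ 0) → ∫ s in a..b, |(γ' s / (γ s - z)).im| ≤ V := by
  obtain ⟨ω, h1, h2, h3, h4, h5⟩ := h.exists_majorant
  obtain ⟨κ, hκ, hch⟩ := h.exists_chord_arc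
  obtain ⟨M, hM⟩ := isCompact_Icc.exists_bound_of_continuousOn h.cont
  have ha : a ∈ Icc a b := left_mem_Icc.2 h.lt.le
  have hb : b ∈ Icc a b := right_mem_Icc.2 h.lt.le
  have hM0 : 0 ≤ M := (norm_nonneg _).trans (hM a ha)
  set J := ∫ u in (-(b - a))..(b - a), ω |u| / |u| with hJ
  have hq0 : ∀ u, 0 ≤ ω |u| / |u| := fun u => div_nonneg (h3 _ (abs_nonneg _)) (abs_nonneg _)
  have hJ0 : 0 ≤ J := intervalIntegral.integral_nonneg (by linarith [h.lt]) fun u _ => hq0 u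
  refine ⟨M * (4 / κ ^ 2) * J + M * (4 / κ) * Real.pi, by positivity, fun z hz => ?_⟩
  obtain ⟨s₀, hs₀, hmin⟩ := isCompact_Icc.exists_isMinOn (nonempty_Icc.2 h.lt.le)
    (h.continuousOn.sub (continuousOn_const (c := z))).norm
  set ρ := ‖γ s₀ - z‖ with hρ
  have hρ0 : 0 < ρ := norm_pos_iff.2 (hz s₀ hs₀)
  have hmin' : ∀ s ∈ Icc a b, ρ ≤ ‖γ s - z‖ := fun s hs => hmin hs
  set τ := 2 * ρ / κ with hτd
  have hτ : 0 < τ := by positivity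
  have hc := h.intervalIntegrable_div ha hb (z := z) (by rwa [uIcc_of_le h.lt.le])
  have i1 : IntervalIntegrable (fun s => |(γ' s / (γ s - z)).im|) volume a b :=
    (Complex.continuous_im.comp_continuousOn hc).abs.intervalIntegrable
  have i2 := ((continuous_poisson s₀ hτ.ne').intervalIntegrable (μ := volume) a b).const_mul
    (M * (4 / κ))
  have i3 : IntervalIntegrable (fun s => M * (4 / κ ^ 2) * (ω |s - s₀| / |s - s₀|)) volume a b := by
    simpa using ((h4 (a - s₀) (b - s₀)).comp_sub_right s₀).const_mul (M * (4 / κ ^ 2))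
  calc _ ≤ ∫ s in a..b, (M * (4 / κ ^ 2) * (ω |s - s₀| / |s - s₀|) +
        M * (4 / κ) * (|τ| / ((s - s₀) ^ 2 + τ ^ 2))) := by
        refine intervalIntegral.integral_mono_on h.lt.le i1 (i3.add i2) fun s hs => ?_
        have hk := hmin' s hs
        have hk1 : κ * |s - s₀| ≤ 2 * ‖γ s - z‖ := by
          have e1 := hch s hs s₀ hs₀
          have e2 := norm_sub_le (γ s - z) (γ s₀ - z)
          rw [sub_sub_sub_cancel_right] at e2
          linarith
        have hk0 : 0 < ‖γ s - z‖ := hρ0.trans_le hk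
        have e1 : ‖γ s - γ s₀ - γ' s * ((s - s₀ : ℝ) : ℂ)‖ ≤ ω |s - s₀| * |s - s₀| :=
          h.norm_sub_sub_le hs hs₀ fun x hx => h1 x (ordConnected_Icc.uIcc_subset hs hs₀ hx) s hs _ (by
            rw [abs_sub_comm s s₀]; exact abs_sub_left_of_mem_uIcc hx)
        set w := γ s - z with hw
        have him : (γ' s / w).im = (γ' s * (starRingEnd ℂ) (w - γ' s * ((s - s₀ : ℝ) : ℂ))).im /
            ‖w‖ ^ 2 := by
          have hwc : w ≠ 0 := norm_pos_iff.1 hk0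
          have e3 : γ' s / w = γ' s * (starRingEnd ℂ) w / ((‖w‖ ^ 2 : ℝ) : ℂ) := by
            have hcw : (starRingEnd ℂ) w ≠ 0 := (map_ne_zero _).2 hwc
            push_cast
            rw [← Complex.mul_conj', mul_div_mul_right _ _ hcw]
          rw [e3, Complex.div_ofReal_im]
          congr 1
          rw [map_sub (starRingEnd ℂ) w, map_mul, mul_sub, Complex.conj_ofReal, ← mul_assoc, Complex.mul_conj',
            Complex.sub_im]
          have : ((‖γ' s‖ : ℂ) ^ 2 * ((s - s₀ : ℝ) : ℂ)).im = 0 := by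
            rw [← Complex.ofReal_pow, ← Complex.ofReal_mul, Complex.ofReal_im]
          rw [this, sub_zero]
        have hnum : |(γ' s * (starRingEnd ℂ) (w - γ' s * ((s - s₀ : ℝ) : ℂ))).im| ≤
            M * (ω |s - s₀| * |s - s₀| + ρ) := by
          refine (Complex.abs_im_le_norm _).trans ?_
          rw [norm_mul, RCLike.norm_conj]
          refine mul_le_mul (hM s hs) ?_ (norm_nonneg _) hM0
          have e4 : w - γ' s * ((s - s₀ : ℝ) : ℂ) = (γ s - γ s₀ - γ' s * ((s - s₀ : ℝ) : ℂ)) +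
              (γ s₀ - z) := by rw [hw]; ring
          rw [e4]
          exact (norm_add_le _ _).trans (add_le_add_left e1 _)
        rw [him, abs_div, abs_of_pos (show 0 < ‖w‖ ^ 2 by positivity)]
        have hu0 := abs_nonneg (s - s₀)
        have hω0 := h3 _ hu0
        have hsq : κ ^ 2 * |s - s₀| ^ 2 ≤ 4 * ‖w‖ ^ 2 := by
          have := mul_self_le_mul_self (by positivity) hk1
          nlinarith
        have t1 : ω |s - s₀| * |s - s₀| / ‖w‖ ^ 2 ≤ 4 / κ ^ 2 * (ω |s - s₀| / |s - s₀|) := by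
          rcases hu0.eq_or_lt with h0 | h0
          · rw [← h0]; simp
          · rw [div_mul_div_comm, div_le_div_iff₀ (by positivity) (by positivity)]
            have := mul_le_mul_of_nonneg_left hsq hω0
            nlinarith
        have t2 : ρ / ‖w‖ ^ 2 ≤ 4 / κ * (|τ| / ((s - s₀) ^ 2 + τ ^ 2)) := by
          rw [abs_of_pos hτ, div_mul_div_comm, div_le_div_iff₀ (by positivity) (by positivity)]
          have e5 : ρ ^ 2 ≤ ‖w‖ ^ 2 := by gcongr
          have e6 : κ * τ = 2 * ρ := by rw [hτd]; field_simp
          have e7 : κ * ((s - s₀) ^ 2 + τ ^ 2) * κ ≤ 8 * ‖w‖ ^ 2 := by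
            have : κ * ((s - s₀) ^ 2 + τ ^ 2) * κ = κ ^ 2 * |s - s₀| ^ 2 + (κ * τ) ^ 2 := by
              rw [sq_abs]; ring
            rw [this, e6]
            nlinarith
          have e8 := mul_le_mul_of_nonneg_left e7 hτ.le
          have e9 : ρ * (κ * ((s - s₀) ^ 2 + τ ^ 2)) * 2 = τ * (κ * ((s - s₀) ^ 2 + τ ^ 2) * κ) := by
            linear_combination (-(κ * ((s - s₀) ^ 2 + τ ^ 2))) * e6
          linarith
        calc _ ≤ M * (ω |s - s₀| * |s - s₀| + ρ) / ‖w‖ ^ 2 := by gcongr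
          _ = M * (ω |s - s₀| * |s - s₀| / ‖w‖ ^ 2) + M * (ρ / ‖w‖ ^ 2) := by ring
          _ ≤ M * (4 / κ ^ 2 * (ω |s - s₀| / |s - s₀|)) +
              M * (4 / κ * (|τ| / ((s - s₀) ^ 2 + τ ^ 2))) := by gcongr
          _ = _ := by ring
    _ = M * (4 / κ ^ 2) * (∫ s in a..b, ω |s - s₀| / |s - s₀|) +
        M * (4 / κ) * ∫ s in a..b, |τ| / ((s - s₀) ^ 2 + τ ^ 2) := by
        rw [intervalIntegral.integral_add i3 i2, intervalIntegral.integral_const_mul,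
          intervalIntegral.integral_const_mul]
    _ ≤ _ := by
        have e1 := integral_near_le (F := fun u => ω |u| / |u|) h4 hq0 hJ.symm.le (s₀ := s₀) h.lt.le
          (by rw [abs_le]; constructor <;> linarith [hs₀.1, hs₀.2])
          (by rw [abs_le]; constructor <;> linarith [hs₀.1, hs₀.2])
        have e2 := integral_poisson_le τ s₀ a b
        gcongr

end Dini

section ChangeOfVariables
variable {Γ : Set ℂ} {c : ℝ} {K : ℂ → ℂ} {b : ℝ → ℂ}

lemma Piece.τ_mem (P : Piece K) {s : ℝ} (hs : s ∈ Icc P.a P.b) :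
    P.τ s ∈ Icc (P.τ P.a) (P.τ P.b) :=
  ⟨P.τ_mono.monotoneOn P.left_mem hs hs.1, P.τ_mono.monotoneOn hs P.right_mem hs.2⟩

/-- Change of variables from the conformal parameter to the arc parameter. -/
lemma Piece.integral_mul_eq (P : Piece K) (hb : IsBdryDeriv K b) {H : ℝ → ℂ} (hH : Continuous H)
    {s₁ s₂ : ℝ} (h₁ : s₁ ∈ Icc P.a P.b) (h₂ : s₂ ∈ Icc P.a P.b) (h₁₂ : s₁ ≤ s₂) :
    ∫ θ in P.τ s₁..P.τ s₂, H θ * b θ = ∫ s in s₁..s₂, H (P.τ s) * P.γ' s := by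
  have hsub : Icc s₁ s₂ ⊆ Icc P.a P.b := Icc_subset_Icc h₁.1 h₂.2
  have hτc : ContinuousOn P.τ (Icc s₁ s₂) := P.τ_cont.mono hsub
  have hHb : ∀ s t, IntervalIntegrable (fun θ => H θ * b θ) volume s t := fun s t =>
    (hb.int s t).continuousOn_mul hH.continuousOn
  have hγ' : ContinuousOn P.γ' (Icc s₁ s₂) := P.arc.cont.mono hsub
  have hHγ : ContinuousOn (fun s => H (P.τ s) * P.γ' s) (Icc s₁ s₂) :=
    (hH.comp_continuousOn hτc).mul hγ'
  have hint : ∀ {F : Type} [NormedAddCommGroup F] (f : ℝ → F), ContinuousOn f (Icc s₁ s₂) →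
      ∀ s ∈ Icc s₁ s₂, ∀ t ∈ Icc s₁ s₂, IntervalIntegrable f volume s t := fun f hf s hs t ht =>
    (hf.mono (ordConnected_Icc.uIcc_subset hs ht)).intervalIntegrable
  have m₁ : s₁ ∈ Icc s₁ s₂ := left_mem_Icc.2 h₁₂
  have m₂ : s₂ ∈ Icc s₁ s₂ := right_mem_Icc.2 h₁₂
  set E : ℝ → ℂ := fun s => (∫ θ in P.τ s₁..P.τ s, H θ * b θ) - ∫ s in s₁..s, H (P.τ s) * P.γ' s
    with hE
  set m : ℝ → ℝ := fun s => (∫ θ in P.τ s₁..P.τ s, ‖b θ‖) + ∫ s in s₁..s, ‖P.γ' s‖ with hm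
  have prim : ∀ {F : Type} [NormedAddCommGroup F] [NormedSpace ℝ F] (f : ℝ → F),
      ContinuousOn f (Icc s₁ s₂) → ContinuousOn (fun s => ∫ u in s₁..s, f u) (Icc s₁ s₂) := by
    intro F _ _ f hf
    have := intervalIntegral.continuousOn_primitive_interval (μ := volume) (f := f) (a := s₁) (b := s₂)
      (by rw [uIcc_of_le h₁₂]; exact hf.integrableOn_Icc)
    rwa [uIcc_of_le h₁₂] at this
  have hEc : ContinuousOn E (Icc s₁ s₂) :=
    ((intervalIntegral.continuous_primitive hHb _).comp_continuousOn hτc).sub (prim _ hHγ)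
  have hmc : ContinuousOn m (Icc s₁ s₂) :=
    ((intervalIntegral.continuous_primitive (fun s t => (hb.int s t).norm) _).comp_continuousOn
      hτc).add (prim _ hγ'.norm)
  have hE1 : E s₁ = 0 := by simp [hE]
  have key : ∀ ε > 0, ‖E s₂‖ ≤ ε * (m s₂ - m s₁) := by
    intro ε hε
    have := norm_sub_le_of_frequently (m := fun s => ε * m s) h₁₂ hEc (continuousOn_const.mul hmc) ?_
    · rw [hE1, sub_zero] at this
      rw [mul_sub]
      exact this
    intro t ht
    have ht' : t ∈ Icc s₁ s₂ := Ico_subset_Icc_self ht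
    obtain ⟨δ, hδ, hHδ⟩ := Metric.continuous_iff.1 hH (P.τ t) ε hε
    have hev : ∀ᶠ y in 𝓝[>] t, dist (P.τ y) (P.τ t) < δ := by
      have h3 : ContinuousWithinAt P.τ (Ioc t s₂) t :=
        (hτc t ht').mono fun x hx => ⟨ht.1.trans hx.1.le, hx.2⟩
      have := h3.eventually (Metric.ball_mem_nhds _ hδ)
      rwa [nhdsWithin_Ioc_eq_nhdsGT ht.2] at this
    refine Eventually.frequently ?_
    filter_upwards [hev, Ioc_mem_nhdsGT ht.2] with y hy hyt
    have hy' : y ∈ Icc s₁ s₂ := ⟨ht.1.trans hyt.1.le, hyt.2⟩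
    have hle : P.τ t ≤ P.τ y := P.τ_mono.monotoneOn (hsub ht') (hsub hy') hyt.1.le
    have hnear : ∀ θ ∈ Icc (P.τ t) (P.τ y), ‖H θ - H (P.τ t)‖ ≤ ε := by
      intro θ hθ
      rw [← dist_eq_norm]
      refine (hHδ θ ?_).le
      rw [Real.dist_eq, abs_of_nonneg (by linarith [hθ.1])] at *
      linarith [hθ.2]
    have e1 : ∫ θ in P.τ t..P.τ y, b θ = ∫ s in t..y, P.γ' s := by
      rw [hb.integral, P.β_τ _ (hsub hy'), P.β_τ _ (hsub ht'), eq_comm]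
      refine intervalIntegral.integral_eq_sub_of_hasDeriv_right ?_ (fun x hx => ?_)
        (hint _ hγ' t ht' y hy')
      · rw [uIcc_of_le hyt.1.le]
        exact P.arc.continuousOn.mono ((Icc_subset_Icc ht.1 hyt.2).trans hsub)
      · rw [min_eq_left hyt.1.le, max_eq_right hyt.1.le] at hx
        have hxs : x ∈ Icc s₁ s₂ := ⟨ht.1.trans hx.1.le, hx.2.le.trans hyt.2⟩
        refine (P.arc.deriv x (hsub hxs)).mono_of_mem_nhdsWithin ?_
        exact mem_of_superset (Ioo_mem_nhdsGT (hx.2.trans_le (hsub hy').2))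
          fun u hu => ⟨(hsub hxs).1.trans hu.1.le, hu.2.le⟩
    have eE : E y - E t = (∫ θ in P.τ t..P.τ y, (H θ - H (P.τ t)) * b θ) -
        ∫ s in t..y, (H (P.τ s) - H (P.τ t)) * P.γ' s := by
      simp only [sub_mul]
      rw [intervalIntegral.integral_sub (hHb _ _) ((hb.int _ _).const_mul _),
        intervalIntegral.integral_sub (hint _ hHγ t ht' y hy')
          ((hint _ hγ' t ht' y hy').const_mul _), intervalIntegral.integral_const_mul,
        intervalIntegral.integral_const_mul, e1]
      simp only [hE]
      rw [← intervalIntegral.integral_add_adjacent_intervals (hHb _ (P.τ t)) (hHb _ (P.τ y)),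
        ← intervalIntegral.integral_add_adjacent_intervals (hint _ hHγ s₁ m₁ t ht')
          (hint _ hHγ t ht' y hy')]
      ring
    have em : m y - m t = (∫ θ in P.τ t..P.τ y, ‖b θ‖) + ∫ s in t..y, ‖P.γ' s‖ := by
      simp only [hm]
      rw [← intervalIntegral.integral_add_adjacent_intervals (hb.int _ (P.τ t)).norm
          (hb.int _ (P.τ y)).norm,
        ← intervalIntegral.integral_add_adjacent_intervals (hint _ hγ'.norm s₁ m₁ t ht')
          (hint _ hγ'.norm t ht' y hy')]
      ring
    rw [← mul_sub, em, eE, mul_add]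
    refine (norm_sub_le _ _).trans (add_le_add ?_ ?_)
    · rw [← intervalIntegral.integral_const_mul]
      refine intervalIntegral.norm_integral_le_of_norm_le hle (Eventually.of_forall fun θ hθ => ?_)
        ((hb.int _ _).norm.const_mul _)
      rw [norm_mul]
      exact mul_le_mul_of_nonneg_right (hnear θ (Ioc_subset_Icc_self hθ)) (norm_nonneg _)
    · rw [← intervalIntegral.integral_const_mul]
      refine intervalIntegral.norm_integral_le_of_norm_le hyt.1.le
        (Eventually.of_forall fun s hs => ?_) ((hint _ hγ'.norm t ht' y hy').const_mul _)
      rw [norm_mul]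
      have hs' : s ∈ Icc s₁ s₂ := ⟨ht.1.trans hs.1.le, hs.2.trans hyt.2⟩
      exact mul_le_mul_of_nonneg_right (hnear _
        ⟨P.τ_mono.monotoneOn (hsub ht') (hsub hs') hs.1.le,
          P.τ_mono.monotoneOn (hsub hs') (hsub hy') hs.2⟩) (norm_nonneg _)
  have h0 : E s₂ = 0 := by
    rw [← norm_le_zero_iff]
    have h5 : Tendsto (fun ε : ℝ => ε * (m s₂ - m s₁)) (𝓝[>] 0) (𝓝 (0 * (m s₂ - m s₁))) :=
      (tendsto_id.mul_const _).mono_left nhdsWithin_le_nhds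
    rw [zero_mul] at h5
    exact ge_of_tendsto h5 (eventually_nhdsWithin_of_forall fun ε hε => key ε hε)
  exact sub_eq_zero.1 h0

lemma integral_abs_le_of_forall_continuous {f : ℝ → ℝ} {p q C : ℝ} (hpq : p ≤ q)
    (hf : IntervalIntegrable f volume p q)
    (h : ∀ k : ℝ → ℝ, Continuous k → (∀ x, |k x| ≤ 1) → ∫ x in p..q, k x * f x ≤ C) :
    ∫ x in p..q, |f x| ≤ C := by
  refine le_of_forall_pos_le_add fun η hη => ?_
  set ε := η / (2 + (q - p)) with hεd
  have hL : 0 ≤ q - p := sub_nonneg.2 hpq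
  have hε : 0 < ε := by positivity
  have hfi := (intervalIntegrable_iff_integrableOn_Ioc_of_le hpq).1 hf
  obtain ⟨g, hg, hgi⟩ := hfi.exists_boundedContinuous_integral_sub_le hε
  rw [← intervalIntegral.integral_of_le hpq] at hg
  have hg0 : ∀ x, 0 < |g x| + ε := fun x => by positivity
  set k : ℝ → ℝ := fun x => g x / (|g x| + ε) with hk
  have hkc : Continuous k := g.continuous.div (by fun_prop) fun x => (hg0 x).ne'
  have hk1 : ∀ x, |k x| ≤ 1 := fun x => by
    rw [hk, abs_div, abs_of_pos (hg0 x), div_le_one (hg0 x)]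
    linarith
  have hgI : IntervalIntegrable g volume p q := g.continuous.intervalIntegrable _ _
  have hpt : ∀ x, |f x| ≤ k x * f x + (2 * ‖f x - g x‖ + ε) := by
    intro x
    have h1 : |g x| - ε ≤ k x * g x := by
      rw [hk, div_mul_eq_mul_div, le_div_iff₀ (hg0 x), ← abs_mul_abs_self (g x)]
      nlinarith
    have h2 : k x * (g x - f x) ≤ ‖f x - g x‖ := by
      rw [norm_sub_rev, Real.norm_eq_abs]
      refine (le_abs_self _).trans ?_
      rw [abs_mul]
      exact mul_le_of_le_one_left (abs_nonneg _) (hk1 x)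
    have h3 : |f x| - |g x| ≤ ‖f x - g x‖ := abs_sub_abs_le_abs_sub _ _
    linarith
  have i1 : IntervalIntegrable (fun x => k x * f x) volume p q :=
    hf.continuousOn_mul hkc.continuousOn
  have i2 : IntervalIntegrable (fun x => 2 * ‖f x - g x‖ + ε) volume p q :=
    ((hf.sub hgI).norm.const_mul 2).add intervalIntegrable_const
  have i3 := intervalIntegral.integral_mono_on hpq hf.abs (i1.add i2) fun x _ => hpt x
  rw [intervalIntegral.integral_add i1 i2, intervalIntegral.integral_add
    ((hf.sub hgI).norm.const_mul 2) intervalIntegrable_const, intervalIntegral.integral_const_mul,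
    intervalIntegral.integral_const, smul_eq_mul] at i3
  have h4 := h k hkc hk1
  have h5 : ε * (2 + (q - p)) = η := by rw [hεd]; field_simp
  have h6 : ∫ x in p..q, ‖f x - g x‖ ≤ ε := hg
  have h7 : ∫ x in p..q, ‖(f - g) x‖ = ∫ x in p..q, ‖f x - g x‖ := rfl
  nlinarith

lemma integral_im {f : ℝ → ℂ} {p q : ℝ} (hf : IntervalIntegrable f volume p q) :
    ∫ x in p..q, (f x).im = (∫ x in p..q, f x).im :=
  Complex.imCLM.intervalIntegral_comp_comm hf

/-- The variation of the argument in the conformal parameter is at most that along the arc. -/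
lemma Piece.integral_abs_im_le (P : Piece K) (h : ContDiscMap Γ c K) (hb : IsBdryDeriv K b) {z : ℂ}
    (hz : z ∉ Γ) {s₁ s₂ : ℝ} (h₁ : s₁ ∈ Icc P.a P.b) (h₂ : s₂ ∈ Icc P.a P.b) (h₁₂ : s₁ ≤ s₂) :
    ∫ θ in P.τ s₁..P.τ s₂, |(b θ / (bdryParam K θ - z)).im| ≤
      ∫ s in s₁..s₂, |(P.γ' s / (P.γ s - z)).im| := by
  have hsub : uIcc s₁ s₂ ⊆ Icc P.a P.b := ordConnected_Icc.uIcc_subset h₁ h₂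
  have hne : ∀ s ∈ uIcc s₁ s₂, P.γ s - z ≠ 0 := fun s hs => by
    rw [← P.β_τ s (hsub hs)]
    exact h.bdryParam_sub_ne_zero hz _
  have hgc := P.arc.intervalIntegrable_div h₁ h₂ hne
  have hbi := h.intervalIntegrable_div hb hz (P.τ s₁) (P.τ s₂)
  have hle : P.τ s₁ ≤ P.τ s₂ := P.τ_mono.monotoneOn h₁ h₂ h₁₂
  have hbim : IntervalIntegrable (fun θ => (b θ / (bdryParam K θ - z)).im) volume (P.τ s₁) (P.τ s₂) :=
    ⟨hbi.1.im, hbi.2.im⟩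
  refine integral_abs_le_of_forall_continuous hle hbim fun k hk hk1 => ?_
  have hkC : Continuous fun θ => (k θ : ℂ) := by fun_prop
  have hH : Continuous fun θ => (k θ : ℂ) / (bdryParam K θ - z) :=
    Continuous.div hkC (h.continuous_bdryParam.sub continuous_const)
      fun θ => h.bdryParam_sub_ne_zero hz θ
  have i1 : IntervalIntegrable (fun θ => (k θ : ℂ) * (b θ / (bdryParam K θ - z))) volume
    (P.τ s₁) (P.τ s₂) := hbi.continuousOn_mul hkC.continuousOn
  have hkτ : ContinuousOn (fun s => (k (P.τ s) : ℂ)) (uIcc s₁ s₂) :=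
    hkC.comp_continuousOn (P.τ_cont.mono hsub)
  have i2 : IntervalIntegrable (fun s => (k (P.τ s) : ℂ) * (P.γ' s / (P.γ s - z))) volume s₁ s₂ :=
    (hkτ.mul hgc).intervalIntegrable
  calc ∫ θ in P.τ s₁..P.τ s₂, k θ * (b θ / (bdryParam K θ - z)).im
      = ∫ θ in P.τ s₁..P.τ s₂, ((k θ : ℂ) * (b θ / (bdryParam K θ - z))).im := by
        simp only [Complex.im_ofReal_mul]
    _ = (∫ θ in P.τ s₁..P.τ s₂, (k θ : ℂ) / (bdryParam K θ - z) * b θ).im := by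
        rw [integral_im i1]
        congr 2
        ext θ
        ring
    _ = (∫ s in s₁..s₂, (k (P.τ s) : ℂ) * (P.γ' s / (P.γ s - z))).im := by
        rw [P.integral_mul_eq hb hH h₁ h₂ h₁₂]
        congr 1
        refine intervalIntegral.integral_congr fun s hs => ?_
        simp only [P.β_τ s (hsub hs)]
        ring
    _ = ∫ s in s₁..s₂, k (P.τ s) * (P.γ' s / (P.γ s - z)).im := by
        rw [← integral_im i2]
        simp only [Complex.im_ofReal_mul]
    _ ≤ _ := by
        refine intervalIntegral.integral_mono_on h₁₂ ?_ ?_ fun s _ => ?_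
        · exact ((Complex.continuous_ofReal.comp_continuousOn
            (hk.comp_continuousOn (P.τ_cont.mono hsub))).mul hgc |>
            fun hc => (Complex.continuous_im.comp_continuousOn hc).congr fun s _ => by
              simp).intervalIntegrable
        · exact (Complex.continuous_im.comp_continuousOn hgc).abs.intervalIntegrable
        · refine (le_abs_self _).trans ?_
          rw [abs_mul]
          exact mul_le_of_le_one_left (abs_nonneg _) (hk1 _)

end ChangeOfVariables

lemma one_add_mul_norm_one_sub_le {x : ℂ} (hx : ‖x‖ = 1) (r : ℝ) :
    (1 + r) * ‖1 - x‖ ≤ 2 * ‖1 - r * x‖ := by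
  have hxx : x.re ^ 2 + x.im ^ 2 = 1 := by
    have := Complex.sq_norm x
    rw [hx, Complex.normSq_apply] at this
    nlinarith
  refine le_of_sq_le_sq ?_ (by positivity)
  rw [mul_pow, mul_pow, Complex.sq_norm, Complex.sq_norm, Complex.normSq_apply, Complex.normSq_apply]
  simp only [Complex.sub_re, Complex.one_re, Complex.sub_im, Complex.one_im, Complex.re_ofReal_mul,
    Complex.im_ofReal_mul]
  have h1 : -1 ≤ x.re := by nlinarith [sq_nonneg x.im]
  have h2 : 0 ≤ (1 - r) ^ 2 * (1 + x.re) := mul_nonneg (sq_nonneg _) (by linarith)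
  have h3 : x.im ^ 2 = 1 - x.re ^ 2 := by linarith
  ring_nf at h2 ⊢
  rw [h3]
  ring_nf
  linarith

/-- A polynomial almost bounded by `1` on the unit circle, vanishing at `1` and equal to `1` at `0`. -/
lemma exists_peak_polynomial {ε : ℝ} (hε : 0 < ε) : ∃ Q : Polynomial ℂ, Q.eval 0 = 1 ∧
    Q.eval 1 = 0 ∧ ∀ x : ℂ, ‖x‖ = 1 → ‖Q.eval x‖ ≤ 1 + ε := by
  obtain ⟨r, hr0, hr1, hr⟩ : ∃ r : ℝ, 0 < r ∧ r < 1 ∧ 2 / (1 + r) < 1 + ε := by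
    have h1 : Tendsto (fun r : ℝ => 2 / (1 + r)) (𝓝[<] 1) (𝓝 (2 / (1 + 1))) :=
      (ContinuousAt.tendsto (f := fun r : ℝ => 2 / (1 + r))
        (ContinuousAt.div (by fun_prop) (by fun_prop) (by norm_num))).mono_left nhdsWithin_le_nhds
    have h2 : ∀ᶠ r : ℝ in 𝓝[<] 1, 2 / (1 + r) < 1 + ε := h1.eventually_lt_const (by norm_num; linarith)
    obtain ⟨r, h3, h4⟩ := (h2.and (Ioo_mem_nhdsLT (zero_lt_one' ℝ))).exists
    exact ⟨r, h4.1, h4.2, h3⟩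
  obtain ⟨N, hN, hN0⟩ : ∃ N : ℕ, 2 / (1 + r) * (1 + r ^ N) < 1 + ε ∧ 0 < N := by
    have h1 : Tendsto (fun N : ℕ => 2 / (1 + r) * (1 + r ^ N)) atTop (𝓝 (2 / (1 + r) * (1 + 0))) :=
      ((tendsto_pow_atTop_nhds_zero_of_lt_one hr0.le hr1).const_add 1).const_mul _
    rw [add_zero, mul_one] at h1
    exact ((h1.eventually_lt_const hr).and (eventually_gt_atTop 0)).exists
  refine ⟨(1 - Polynomial.X) * ∑ k ∈ Finset.range N, (Polynomial.C (r : ℂ) * Polynomial.X) ^ k,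
    ?_, ?_, fun x hx => ?_⟩
  · obtain ⟨m, rfl⟩ := Nat.exists_eq_succ_of_ne_zero hN0.ne'
    simp [Polynomial.eval_finsetSum, Finset.sum_range_succ']
  · simp
  · have hrx : ‖(r : ℂ) * x‖ = r := by rw [norm_mul, hx, mul_one, Complex.norm_real]; exact abs_of_pos hr0
    have hne : (1 : ℂ) - r * x ≠ 0 := fun h0 => by
      rw [← sub_eq_zero.1 h0, norm_one] at hrx
      linarith
    have hpos : 0 < ‖(1 : ℂ) - r * x‖ := norm_pos_iff.2 hne
    have hgs := mul_neg_geom_sum ((r : ℂ) * x) N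
    have e1 : (∑ k ∈ Finset.range N, ((r : ℂ) * x) ^ k) = (1 - ((r : ℂ) * x) ^ N) / (1 - r * x) := by
      rw [eq_div_iff hne, mul_comm, hgs]
    simp only [Polynomial.eval_mul, Polynomial.eval_sub, Polynomial.eval_one, Polynomial.eval_X,
      Polynomial.eval_finsetSum, Polynomial.eval_pow, Polynomial.eval_C]
    rw [e1, norm_mul, norm_div]
    have h2 : ‖(1 : ℂ) - (r * x) ^ N‖ ≤ 1 + r ^ N := by
      refine (norm_sub_le _ _).trans ?_
      rw [norm_one, norm_pow, hrx]
    have h3 := one_add_mul_norm_one_sub_le hx r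
    have h4 : ‖1 - x‖ ≤ 2 / (1 + r) * ‖(1 : ℂ) - r * x‖ := by
      rw [div_mul_eq_mul_div, le_div_iff₀ (by positivity)]
      linarith
    refine le_trans ?_ hN.le
    calc _ ≤ 2 / (1 + r) * ‖(1 : ℂ) - r * x‖ * ((1 + r ^ N) / ‖(1 : ℂ) - r * x‖) := by gcongr
      _ = _ := by field_simp

lemma exists_peak_polynomial_finset (s : Finset ℝ) {ε : ℝ} (hε : 0 < ε) : ∃ Q : Polynomial ℂ,
    Q.eval 0 = 1 ∧ (∀ p ∈ s, Q.eval (Complex.exp (p * Complex.I)) = 0) ∧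
      ∀ x : ℂ, ‖x‖ = 1 → ‖Q.eval x‖ ≤ 1 + ε := by
  induction s using Finset.induction_on generalizing ε with
  | empty => exact ⟨1, by simp, by simp, fun x _ => by simp [hε.le]⟩
  | insert p s hp ih =>
    set η := min 1 (ε / 3) with hη
    have hη0 : 0 < η := by positivity
    obtain ⟨Q, h0, h1, h2⟩ := ih hη0
    obtain ⟨G, g0, g1, g2⟩ := exists_peak_polynomial hη0
    refine ⟨Q * G.comp (Polynomial.C (Complex.exp (-(p * Complex.I))) * Polynomial.X),
      by simp [h0, g0], fun q hq => ?_, fun x hx => ?_⟩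
    · rcases Finset.mem_insert.1 hq with rfl | hq
      · simp [Polynomial.eval_comp, ← Complex.exp_add, g1]
      · simp [h1 q hq]
    · have hn : ‖Complex.exp (-(p * Complex.I)) * x‖ = 1 := by
        rw [norm_mul, hx, mul_one, Complex.norm_exp]
        simp
      have h3 := g2 _ hn
      have h4 := h2 x hx
      simp only [Polynomial.eval_mul, Polynomial.eval_comp, Polynomial.eval_C, Polynomial.eval_X]
      rw [norm_mul]
      have h5 : η ≤ 1 := min_le_left _ _
      have h6 : η ≤ ε / 3 := min_le_right _ _
      calc _ ≤ (1 + η) * (1 + η) := by gcongr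
        _ ≤ 1 + ε := by nlinarith

lemma tendsto_integral_exp_mul (f : ℝ → ℂ) {p q : ℝ} (hpq : p ≤ q) :
    Tendsto (fun n : ℕ => ∫ θ in p..q, f θ / Complex.exp (θ * Complex.I) ^ n) atTop (𝓝 0) := by
  have h1 := Real.tendsto_integral_exp_smul_cocompact ((Ioc p q).indicator f)
  have h2 : Tendsto (fun n : ℕ => (n : ℝ) * (2 * Real.pi)⁻¹) atTop (cocompact ℝ) :=
    (tendsto_natCast_atTop_atTop.atTop_mul_const (by positivity)).mono_right
      atTop_le_cocompact
  refine (h1.comp h2).congr fun n => ?_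
  rw [intervalIntegral.integral_of_le hpq, ← integral_indicator measurableSet_Ioc]
  simp only [Function.comp]
  congr 1
  ext θ
  by_cases hθ : θ ∈ Ioc p q
  · simp only [indicator_of_mem hθ, Circle.smul_def, Real.fourierChar_apply, smul_eq_mul]
    rw [div_eq_mul_inv, mul_comm, ← Complex.exp_nat_mul, ← Complex.exp_neg]
    congr 2
    push_cast
    have : (Real.pi : ℂ) ≠ 0 := by exact_mod_cast Real.pi_ne_zero
    field_simp
  · simp [indicator_of_notMem hθ]

/-- A Riemann–Lebesgue lemma, uniform over a compact family of continuous multipliers. -/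
lemma eventually_norm_integral_le {X : Type*} [TopologicalSpace X] {S : Set X} (hS : IsCompact S)
    {k : X → ℝ → ℂ} (hk : Continuous (Function.uncurry k)) {f : ℝ → ℂ} {p q : ℝ} (hpq : p ≤ q)
    (hf : IntervalIntegrable f volume p q) {ε : ℝ} (hε : 0 < ε) :
    ∀ᶠ n : ℕ in atTop, ∀ x ∈ S,
      ‖∫ θ in p..q, k x θ * f θ / Complex.exp (θ * Complex.I) ^ n‖ ≤ ε := by
  have hkx : ∀ x, Continuous (k x) := fun x => hk.comp (by fun_prop : Continuous fun θ => (x, θ))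
  have hint : ∀ x, IntervalIntegrable (fun θ => k x θ * f θ) volume p q := fun x =>
    hf.continuousOn_mul (hkx x).continuousOn
  have hexp : ∀ n : ℕ, Continuous fun θ : ℝ => (Complex.exp (θ * Complex.I) ^ n)⁻¹ := fun n =>
    Continuous.inv₀ (by fun_prop) fun θ => pow_ne_zero _ (Complex.exp_ne_zero _)
  have hintn : ∀ x (n : ℕ), IntervalIntegrable
      (fun θ => k x θ * f θ / Complex.exp (θ * Complex.I) ^ n) volume p q := fun x n => by
    simpa only [div_eq_mul_inv] using (hint x).mul_continuousOn (hexp n).continuousOn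
  refine hS.induction_on (p := fun S => ∀ᶠ n : ℕ in atTop, ∀ x ∈ S,
      ‖∫ θ in p..q, k x θ * f θ / Complex.exp (θ * Complex.I) ^ n‖ ≤ ε) (by simp) ?_ ?_ ?_
  · exact fun s t hst ht => ht.mono fun n hn x hx => hn x (hst hx)
  · intro s t hs ht
    filter_upwards [hs, ht] with n h1 h2 x hx
    exact hx.elim (h1 x) (h2 x)
  · intro x hx
    set J := ∫ θ in p..q, ‖f θ‖ with hJ
    have hJ0 : 0 ≤ J := intervalIntegral.integral_nonneg hpq fun _ _ => norm_nonneg _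
    obtain ⟨v, hv, hv'⟩ := (isCompact_Icc (a := p) (b := q)).mem_uniformity_of_prod (s := S)
      hk.continuousOn hx (Metric.dist_mem_uniformity (show 0 < ε / 2 / (J + 1) by positivity))
    refine ⟨v, hv, ?_⟩
    have h1 := (tendsto_integral_exp_mul (fun θ => k x θ * f θ) hpq).norm
    rw [norm_zero] at h1
    filter_upwards [h1.eventually_le_const (half_pos hε)] with n hn y hy
    have e : (∫ θ in p..q, k y θ * f θ / Complex.exp (θ * Complex.I) ^ n) =
        (∫ θ in p..q, (k y θ * f θ / Complex.exp (θ * Complex.I) ^ n -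
          k x θ * f θ / Complex.exp (θ * Complex.I) ^ n)) +
        ∫ θ in p..q, k x θ * f θ / Complex.exp (θ * Complex.I) ^ n := by
      rw [intervalIntegral.integral_sub (hintn y n) (hintn x n)]
      ring
    have h2 : ‖∫ θ in p..q, (k y θ * f θ / Complex.exp (θ * Complex.I) ^ n -
          k x θ * f θ / Complex.exp (θ * Complex.I) ^ n)‖ ≤ ε / 2 / (J + 1) * J := by
      rw [hJ, ← intervalIntegral.integral_const_mul]
      refine intervalIntegral.norm_integral_le_of_norm_le hpq (Eventually.of_forall fun θ hθ => ?_)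
        (hf.norm.const_mul _)
      rw [← sub_div, ← sub_mul, norm_div, norm_pow, exp_norm_one, one_pow, div_one, norm_mul]
      refine mul_le_mul_of_nonneg_right ?_ (norm_nonneg _)
      have := hv' y hy θ (Ioc_subset_Icc_self hθ)
      rw [← dist_eq_norm]
      exact le_of_lt this
    have h3 : ε / 2 / (J + 1) * J ≤ ε / 2 := by
      rw [div_mul_eq_mul_div, div_le_iff₀ (by positivity)]
      nlinarith
    rw [e]
    exact (norm_add_le _ _).trans (by linarith)

section Inside
variable {Γ : Set ℂ} {c : ℝ} {K : ℂ → ℂ} {b : ℝ → ℂ}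

lemma ContDiscMap.exists_le_norm_sub (h : ContDiscMap Γ c K) {p θ₀ q : ℝ} (hp : p < θ₀)
    (hq : θ₀ < q) : ∃ d > 0, ∀ θ ∈ Icc q (p + 2 * Real.pi),
      d ≤ ‖bdryParam K θ - bdryParam K θ₀‖ := by
  obtain ⟨d, hd, hd'⟩ := (isCompact_Icc (a := q) (b := p + 2 * Real.pi)).exists_forall_le' (a := 0)
    (f := fun θ => ‖bdryParam K θ - bdryParam K θ₀‖)
    (h.continuous_bdryParam.sub continuous_const).norm.continuousOn fun θ hθ => by
      rw [norm_pos_iff]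
      intro h0
      obtain ⟨n, hn⟩ := h.eq_add_of_bdryParam_eq (sub_eq_zero.1 h0)
      have hpi := Real.pi_pos
      have h1 : (0 : ℝ) < n := by
        by_contra! h1
        nlinarith [hθ.1]
      have h2 : (n : ℝ) < 1 := by
        by_contra! h2
        nlinarith [hθ.2]
      have h3 : (0 : ℤ) < n := by exact_mod_cast h1
      have h4 : n < (1 : ℤ) := by exact_mod_cast h2
      omega
  exact ⟨d, hd, hd'⟩

lemma ContDiscMap.integral_period_eq_zero (h : ContDiscMap Γ c K) (hb : IsBdryDeriv K b) {z : ℂ}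
    (hz : z ∈ exteriorDomain Γ) (p : ℝ) :
    ∫ θ in p..p + 2 * Real.pi, b θ / (bdryParam K θ - z) = 0 := by
  have hper : Function.Periodic (fun θ => b θ / (bdryParam K θ - z)) (2 * Real.pi) := fun θ => by
    simp only [hb.periodic θ, bdryParam_periodic K θ]
  rw [hper.intervalIntegral_add_eq p 0, zero_add, h.integral_eq_zero hb hz]

lemma Piece.mem_Ioo (P : Piece K) {θ : ℝ} (hθ : θ ∈ Ioo (P.τ P.a) (P.τ P.b)) :
    P.σ θ ∈ Ioo P.a P.b := by
  have h1 := P.τ_σ θ (Ioo_subset_Icc_self hθ)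
  have h2 := P.σ_mem θ
  refine ⟨lt_of_le_of_ne h2.1 fun h3 => ?_, lt_of_le_of_ne h2.2 fun h3 => ?_⟩
  · rw [← h3] at h1
    exact hθ.1.ne h1
  · rw [h3] at h1
    exact hθ.2.ne h1.symm

/-- One of the two points at small distance on the normal lies inside the curve. -/
lemma Piece.exists_inside (P : Piece K) (h : ContDiscMap Γ c K) (hb : IsBdryDeriv K b) {θ₀ : ℝ}
    (hθ₀ : θ₀ ∈ Ioo (P.τ P.a) (P.τ P.b)) : ∃ τ₀ > 0, ∀ τ : ℝ, 0 < τ → τ < τ₀ → ∃ t : ℝ, |t| = τ ∧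
      P.γ (P.σ θ₀) + t * Complex.I * P.γ' (P.σ θ₀) ∉ Γ ∧
      P.γ (P.σ θ₀) + t * Complex.I * P.γ' (P.σ θ₀) ∉ exteriorDomain Γ := by
  set s₀ := P.σ θ₀ with hs₀d
  have hs₀ : s₀ ∈ Ioo P.a P.b := P.mem_Ioo hθ₀
  have hs₀' := Ioo_subset_Icc_self hs₀
  have hτs₀ : P.τ s₀ = θ₀ := P.τ_σ θ₀ (Ioo_subset_Icc_self hθ₀)
  have hβ₀ : bdryParam K θ₀ = P.γ s₀ := P.β_eq (Ioo_subset_Icc_self hθ₀)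
  obtain ⟨δ₁, hδ₁, hnear⟩ := P.arc.exists_near_bound one_pos
  obtain ⟨δ₂, hδ₂, hjump⟩ := P.arc.exists_jump
  have hτc : ContinuousAt P.τ s₀ := P.τ_cont.continuousAt (Icc_mem_nhds hs₀.1 hs₀.2)
  obtain ⟨δ₃, hδ₃, hτδ⟩ := Metric.continuousAt_iff.1 hτc Real.pi Real.pi_pos
  rw [hτs₀] at hτδ
  obtain ⟨δ, hδ, h1, h2, h3, h4, h5⟩ : ∃ δ > 0, δ ≤ δ₁ ∧ δ ≤ δ₂ ∧ δ < δ₃ ∧ P.a ≤ s₀ - δ ∧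
      s₀ + δ ≤ P.b := by
    have ha : 0 < s₀ - P.a := sub_pos.2 hs₀.1
    have hb : 0 < P.b - s₀ := sub_pos.2 hs₀.2
    refine ⟨min (min δ₁ δ₂) (min (δ₃ / 2) (min (s₀ - P.a) (P.b - s₀))), by positivity, ?_, ?_, ?_,
      ?_, ?_⟩
    · exact (min_le_left _ _).trans (min_le_left _ _)
    · exact (min_le_left _ _).trans (min_le_right _ _)
    · exact ((min_le_right _ _).trans (min_le_left _ _)).trans_lt (by linarith)
    · have := (min_le_right (min δ₁ δ₂) (min (δ₃ / 2) (min (s₀ - P.a) (P.b - s₀)))).trans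
        ((min_le_right _ _).trans (min_le_left _ _))
      linarith
    · have := (min_le_right (min δ₁ δ₂) (min (δ₃ / 2) (min (s₀ - P.a) (P.b - s₀)))).trans
        ((min_le_right _ _).trans (min_le_right _ _))
      linarith
  have hm : s₀ - δ ∈ Icc P.a P.b := ⟨h4, by linarith [hs₀.2]⟩
  have hp : s₀ + δ ∈ Icc P.a P.b := ⟨by linarith [hs₀.1], h5⟩
  have hlt₁ : P.τ (s₀ - δ) < θ₀ := hτs₀ ▸ P.τ_mono hm hs₀' (by linarith)
  have hlt₂ : θ₀ < P.τ (s₀ + δ) := by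
    conv_lhs => rw [← hτs₀]
    exact P.τ_mono hs₀' hp (by linarith)
  set p := P.τ (s₀ - δ) with hpd
  set q := P.τ (s₀ + δ) with hqd
  have hqp : q < p + 2 * Real.pi := by
    have e1 : dist q θ₀ < Real.pi := hτδ (by rw [Real.dist_eq, add_sub_cancel_left, abs_of_pos hδ]; exact h3)
    have e2 : dist p θ₀ < Real.pi := hτδ (by
      rw [Real.dist_eq, sub_sub_cancel_left, abs_neg, abs_of_pos hδ]; exact h3)
    rw [Real.dist_eq, abs_lt] at e1 e2
    linarith
  obtain ⟨d, hd, hfar⟩ := h.exists_le_norm_sub hlt₁ hlt₂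
  set g := ‖P.γ' s₀‖ with hg
  set J := ∫ θ in q..p + 2 * Real.pi, ‖b θ‖ with hJ
  have hJ0 : 0 ≤ J := intervalIntegral.integral_nonneg hqp.le fun _ _ => norm_nonneg _
  have hg0 : 0 ≤ g := norm_nonneg _
  refine ⟨min δ (min (d / (2 * (g + 1))) (d ^ 2 / (16 * (g + 1) * (J + 1)))), by positivity,
    fun τ hτ hτlt => ?_⟩
  have hτ1 : τ ≤ δ := hτlt.le.trans (min_le_left _ _)
  have hτ2 : τ * g ≤ d / 2 := by
    have := hτlt.le.trans ((min_le_right _ _).trans (min_le_left _ _))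
    rw [le_div_iff₀ (by positivity)] at this
    linarith
  have hτ3 : 8 * (τ * g) / d ^ 2 * J ≤ 1 / 2 := by
    have := hτlt.le.trans ((min_le_right _ _).trans (min_le_right _ _))
    rw [le_div_iff₀ (by positivity)] at this
    rw [div_mul_eq_mul_div, div_le_iff₀ (by positivity)]
    have e1 : τ * g * J ≤ τ * (g + 1) * (J + 1) := by gcongr <;> linarith
    linarith
  set z : ℝ → ℂ := fun t => P.γ s₀ + t * Complex.I * P.γ' s₀ with hz
  have hzn : ∀ t : ℝ, ‖z t - P.γ s₀‖ = |t| * g := fun t => by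
    simp only [hz]
    rw [add_sub_cancel_left, norm_mul, norm_mul, Complex.norm_I, mul_one, Complex.norm_real,
      Real.norm_eq_abs]
  have hfar' : ∀ t : ℝ, |t| = τ → ∀ θ ∈ Icc q (p + 2 * Real.pi), d / 2 ≤ ‖bdryParam K θ - z t‖ := by
    intro t ht θ hθ
    have e1 := hfar θ hθ
    have e2 := norm_sub_le (bdryParam K θ - z t) (P.γ s₀ - z t)
    rw [sub_sub_sub_cancel_right, norm_sub_rev (P.γ s₀), hzn, ht, ← hβ₀] at e2
    linarith
  have hzΓ : ∀ t : ℝ, |t| = τ → z t ∉ Γ := by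
    intro t ht hmem
    rw [← h.range_bdryParam] at hmem
    obtain ⟨θ', hθ'⟩ := hmem
    obtain ⟨θ, hθ, hθe⟩ := (bdryParam_periodic K).exists_mem_Ico Real.two_pi_pos θ' p
    rw [hθ'] at hθe
    rcases le_total θ q with hle | hle
    · have hθI : θ ∈ Icc (P.τ P.a) (P.τ P.b) :=
        ⟨(P.τ_mem hm).1.trans hθ.1, hle.trans (P.τ_mem hp).2⟩
      have e1 : P.σ θ ∈ Icc (s₀ - δ) (s₀ + δ) := by
        rw [← P.σ_τ _ hm, ← P.σ_τ _ hp]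
        exact ⟨P.σ_mono hθ.1, P.σ_mono hle⟩
      have ht0 : t ≠ 0 := fun h0 => by rw [h0, abs_zero] at ht; exact hτ.ne ht
      refine (hnear s₀ hs₀' _ hm _ hp (by linarith) ?_ ?_ t ht0).1 _ e1 ?_
      · rw [sub_sub_cancel_left, abs_neg, abs_of_pos hδ]; exact h1
      · rw [add_sub_cancel_left, abs_of_pos hδ]; exact h1
      · rw [← P.β_eq hθI, ← hθe, sub_self]
    · have := hfar' t ht θ ⟨hle, hθ.2.le⟩
      rw [← hθe, sub_self, norm_zero] at this
      linarith
  by_contra! hcon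
  have hτa : |τ| = τ := abs_of_pos hτ
  have hτa' : |(-τ)| = τ := by rw [abs_neg, hτa]
  have hΓ₁ := hzΓ τ hτa
  have hΓ₂ := hzΓ (-τ) hτa'
  have hΩ₁ : z τ ∈ exteriorDomain Γ := hcon τ hτa hΓ₁
  have hΩ₂ : z (-τ) ∈ exteriorDomain Γ := hcon (-τ) hτa' hΓ₂
  have hn₁ := h.bdryParam_sub_ne_zero hΓ₁
  have hn₂ := h.bdryParam_sub_ne_zero hΓ₂
  set H : ℝ → ℂ := fun θ => 1 / (bdryParam K θ - z τ) - 1 / (bdryParam K θ - z (-τ)) with hH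
  have hHc : Continuous H :=
    (Continuous.div continuous_const (h.continuous_bdryParam.sub continuous_const) hn₁).sub
      (Continuous.div continuous_const (h.continuous_bdryParam.sub continuous_const) hn₂)
  have hHb : ∀ s t, IntervalIntegrable (fun θ => H θ * b θ) volume s t := fun s t =>
    (hb.int s t).continuousOn_mul hHc.continuousOn
  have htot : ∫ θ in p..p + 2 * Real.pi, H θ * b θ = 0 := by
    have e : (fun θ => H θ * b θ) = fun θ => b θ / (bdryParam K θ - z τ) -
        b θ / (bdryParam K θ - z (-τ)) := by
      ext θ; simp only [hH]; ring
    rw [e, intervalIntegral.integral_sub (h.intervalIntegrable_div hb hΓ₁ _ _)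
      (h.intervalIntegrable_div hb hΓ₂ _ _), h.integral_period_eq_zero hb hΩ₁,
      h.integral_period_eq_zero hb hΩ₂, sub_zero]
  have hnr : 1 ≤ ‖∫ θ in p..q, H θ * b θ‖ := by
    rw [hpd, hqd, P.integral_mul_eq hb hHc hm hp (by linarith)]
    refine (hjump s₀ hs₀' δ hδ h2 hm hp τ hτ hτ1).trans_eq ?_
    congr 1
    refine intervalIntegral.integral_congr fun s hs => ?_
    have hs' := ordConnected_Icc.uIcc_subset hm hp hs
    simp only [hH, P.β_τ s hs', hz]
    ring
  have hfr : ‖∫ θ in q..p + 2 * Real.pi, H θ * b θ‖ ≤ 1 / 2 := by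
    refine le_trans ?_ hτ3
    rw [hJ, ← intervalIntegral.integral_const_mul]
    refine intervalIntegral.norm_integral_le_of_norm_le hqp.le (Eventually.of_forall fun θ hθ => ?_)
      ((hb.int _ _).norm.const_mul _)
    rw [norm_mul]
    refine mul_le_mul_of_nonneg_right ?_ (norm_nonneg _)
    have e1 := hfar' τ hτa θ (Ioc_subset_Icc_self hθ)
    have e2 := hfar' (-τ) hτa' θ (Ioc_subset_Icc_self hθ)
    have e3 : H θ = (z τ - z (-τ)) / ((bdryParam K θ - z τ) * (bdryParam K θ - z (-τ))) := by
      simp only [hH]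
      rw [div_sub_div _ _ (hn₁ θ) (hn₂ θ)]
      congr 1
      ring
    have e4 : ‖z τ - z (-τ)‖ ≤ 2 * (τ * g) := by
      have := norm_sub_le (z τ - P.γ s₀) (z (-τ) - P.γ s₀)
      rw [sub_sub_sub_cancel_right, hzn, hzn, hτa, hτa'] at this
      linarith
    rw [e3, norm_div, norm_mul]
    calc _ ≤ 2 * (τ * g) / (d / 2 * (d / 2)) := by gcongr
      _ = _ := by field_simp; ring
  rw [← intervalIntegral.integral_add_adjacent_intervals (hHb _ q) (hHb q _)] at htot
  rw [eq_neg_of_add_eq_zero_left htot, norm_neg] at hnr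
  linarith

end Inside

section Far
variable {Γ : Set ℂ} {c : ℝ} {K : ℂ → ℂ} {b : ℝ → ℂ}

/-- A continuous cutoff: `1` for `x ≤ η / 2` and `0` for `η ≤ x`. -/
def cutoff (η x : ℝ) : ℝ := max 0 (min 1 (2 - 2 * x / η))

lemma continuous_cutoff (η : ℝ) : Continuous (cutoff η) := by
  unfold cutoff
  fun_prop

lemma cutoff_nonneg (η x : ℝ) : 0 ≤ cutoff η x := le_max_left _ _

lemma cutoff_le_one (η x : ℝ) : cutoff η x ≤ 1 := max_le zero_le_one (min_le_left _ _)

lemma cutoff_eq_one {η x : ℝ} (hη : 0 < η) (hx : x ≤ η / 2) : cutoff η x = 1 := by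
  have h1 : 2 * x / η ≤ 1 := by rw [div_le_one hη]; linarith
  rw [cutoff, min_eq_left (by linarith), max_eq_right zero_le_one]

lemma cutoff_eq_zero {η x : ℝ} (hη : 0 < η) (hx : η ≤ x) : cutoff η x = 0 := by
  have h1 : 2 ≤ 2 * x / η := by rw [le_div_iff₀ hη]; linarith
  rw [cutoff, max_eq_left ((min_le_right _ _).trans (by linarith))]

lemma le_norm_exp_sub {θ θ₀ : ℝ} (hθ : |θ - θ₀| ≤ Real.pi) :
    2 / Real.pi * |θ - θ₀| ≤ ‖Complex.exp (θ * Complex.I) - Complex.exp (θ₀ * Complex.I)‖ := by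
  have e : Complex.exp (θ * Complex.I) - Complex.exp (θ₀ * Complex.I) =
      Complex.exp (θ₀ * Complex.I) * (Complex.exp (Complex.I * ((θ - θ₀ : ℝ) : ℂ)) - 1) := by
    rw [mul_sub, ← Complex.exp_add, mul_one]
    congr 2
    push_cast
    ring
  rw [e, norm_mul, exp_norm_one, one_mul, Complex.norm_exp_I_mul_ofReal_sub_one, norm_mul,
    Real.norm_eq_abs, Real.norm_eq_abs, abs_of_pos (two_pos : (0 : ℝ) < 2)]
  have h1 := Real.mul_le_sin (x := |θ - θ₀| / 2) (by positivity) (by linarith)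
  have h2 : Real.sin (|θ - θ₀| / 2) ≤ |Real.sin ((θ - θ₀) / 2)| := by
    rcases abs_cases (θ - θ₀) with ⟨h, -⟩ | ⟨h, -⟩ <;> rw [h]
    · exact le_abs_self _
    · rw [neg_div, Real.sin_neg]
      exact neg_le_abs _
  have h3 : 2 / Real.pi * |θ - θ₀| = 2 * (2 / Real.pi * (|θ - θ₀| / 2)) := by ring
  rw [h3]
  linarith

lemma ContDiscMap.exists_le_norm_sub_of_exp (h : ContDiscMap Γ c K) {η : ℝ} (hη : 0 < η) :
    ∃ d > 0, ∀ θ θ₀ : ℝ, η ≤ ‖Complex.exp (θ * Complex.I) - Complex.exp (θ₀ * Complex.I)‖ →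
      d ≤ ‖bdryParam K θ - bdryParam K θ₀‖ := by
  set S : Set (ℂ × ℂ) := (Metric.sphere 0 1 ×ˢ Metric.sphere 0 1) ∩ {x | η ≤ ‖x.1 - x.2‖} with hS
  have hSc : IsCompact S := ((isCompact_sphere 0 1).prod (isCompact_sphere 0 1)).inter_right
    (isClosed_le continuous_const (by fun_prop))
  have hsub : ∀ x : ℂ, x ∈ Metric.sphere (0 : ℂ) 1 → x ∈ Metric.closedBall (0 : ℂ) 1 \ {0} :=
    fun x hx => ⟨Metric.sphere_subset_closedBall hx, fun h0 => by
      rw [mem_singleton_iff] at h0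
      simp [h0] at hx⟩
  have hc : ContinuousOn (fun x : ℂ × ℂ => ‖K x.1 / x.1 - K x.2 / x.2‖) S :=
    ((h.continuousOn_div.comp continuousOn_fst fun x hx => hsub _ hx.1.1).sub
      (h.continuousOn_div.comp continuousOn_snd fun x hx => hsub _ hx.1.2)).norm
  obtain ⟨d, hd, hd'⟩ := hSc.exists_forall_le' hc (a := 0) fun x hx => by
    rw [norm_pos_iff]
    intro h0
    have h1 := h.sphere_injOn (mem_sphere_zero_iff_norm.1 hx.1.1) (mem_sphere_zero_iff_norm.1 hx.1.2)
      (sub_eq_zero.1 h0)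
    have h2 : η ≤ ‖x.1 - x.2‖ := hx.2
    rw [h1, sub_self, norm_zero] at h2
    linarith
  refine ⟨d, hd, fun θ θ₀ hθ => hd' (Complex.exp (θ * Complex.I), Complex.exp (θ₀ * Complex.I)) ?_⟩
  exact ⟨⟨by simp, by simp⟩, hθ⟩

/-- The contribution away from the foot point tends to zero uniformly. -/
lemma ContDiscMap.exists_far_bound (h : ContDiscMap Γ c K) (hb : IsBdryDeriv K b) (Q : Polynomial ℂ)
    {η ε : ℝ} (hη : 0 < η) (hε : 0 < ε) : ∃ d > 0, ∀ᶠ n : ℕ in atTop,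
      ∀ θ₀ ∈ Icc 0 (2 * Real.pi), ∀ z ∉ Γ, ‖z - bdryParam K θ₀‖ ≤ d →
        ‖∫ θ in (0 : ℝ)..2 * Real.pi, ((1 - cutoff η
          ‖Complex.exp (θ * Complex.I) - Complex.exp (θ₀ * Complex.I)‖ : ℝ) : ℂ) *
          (Q.eval (Complex.exp (θ * Complex.I)) / Complex.exp (θ * Complex.I) ^ n *
          ((b θ / (bdryParam K θ - z)).im : ℂ))‖ ≤ ε := by
  obtain ⟨d', hd', hsep⟩ := h.exists_le_norm_sub_of_exp (half_pos hη)
  set d := d' / 2 with hdd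
  have hd : 0 < d := half_pos hd'
  have hβ := h.continuous_bdryParam
  obtain ⟨R, hR⟩ := (isCompact_Icc (a := (0 : ℝ)) (b := 2 * Real.pi)).exists_bound_of_continuousOn
    hβ.continuousOn
  set k : ℝ × ℂ → ℝ → ℂ := fun x θ => ((1 - cutoff η
    ‖Complex.exp (θ * Complex.I) - Complex.exp (x.1 * Complex.I)‖ : ℝ) : ℂ) *
      (starRingEnd ℂ) (bdryParam K θ - x.2) / ((max (‖bdryParam K θ - x.2‖ ^ 2) (d ^ 2) : ℝ) : ℂ)
    with hk
  have hmpos : ∀ (x : ℝ × ℂ) (θ : ℝ), 0 < max (‖bdryParam K θ - x.2‖ ^ 2) (d ^ 2) := fun x θ =>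
    lt_max_of_lt_right (by positivity)
  have hkc : Continuous (Function.uncurry k) := by
    have h1 : Continuous fun y : (ℝ × ℂ) × ℝ => bdryParam K y.2 - y.1.2 :=
      (hβ.comp continuous_snd).sub (by fun_prop)
    refine Continuous.div (Continuous.mul ?_ (Complex.continuous_conj.comp h1))
      (Complex.continuous_ofReal.comp ((h1.norm.pow 2).max continuous_const)) fun y => ?_
    · refine Complex.continuous_ofReal.comp (continuous_const.sub ((continuous_cutoff η).comp ?_))
      fun_prop
    · exact_mod_cast (hmpos y.1 y.2).ne'
  have hQc : Continuous fun y : (ℝ × ℂ) × ℝ => Q.eval (Complex.exp (y.2 * Complex.I)) :=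
    Q.continuous.comp (by fun_prop)
  have hS : IsCompact (Icc (0 : ℝ) (2 * Real.pi) ×ˢ Metric.closedBall (0 : ℂ) (R + d)) :=
    isCompact_Icc.prod (isCompact_closedBall _ _)
  have hbc : IntervalIntegrable (fun θ => (starRingEnd ℂ) (b θ)) volume 0 (2 * Real.pi) :=
    ⟨Complex.conjCLE.toContinuousLinearMap.integrable_comp (hb.int _ _).1,
      Complex.conjCLE.toContinuousLinearMap.integrable_comp (hb.int _ _).2⟩
  refine ⟨d, hd, ?_⟩
  filter_upwards [eventually_norm_integral_le hS (k := fun x θ => k x θ *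
      Q.eval (Complex.exp (θ * Complex.I))) (hkc.mul hQc) Real.two_pi_pos.le (hb.int _ _) hε,
    eventually_norm_integral_le hS (k := fun x θ => (starRingEnd ℂ) (k x θ) *
      Q.eval (Complex.exp (θ * Complex.I))) ((Complex.continuous_conj.comp hkc).mul hQc)
      Real.two_pi_pos.le hbc hε] with n hn₁ hn₂ θ₀ hθ₀ z hz hzd
  have hmem : (θ₀, z) ∈ Icc (0 : ℝ) (2 * Real.pi) ×ˢ Metric.closedBall (0 : ℂ) (R + d) := by
    refine ⟨hθ₀, mem_closedBall_zero_iff.2 ?_⟩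
    have e1 := hR θ₀ hθ₀
    have e2 := norm_add_le (z - bdryParam K θ₀) (bdryParam K θ₀)
    rw [sub_add_cancel] at e2
    linarith
  have hk' : ∀ θ, k (θ₀, z) θ = ((1 - cutoff η
      ‖Complex.exp (θ * Complex.I) - Complex.exp (θ₀ * Complex.I)‖ : ℝ) : ℂ) /
        (bdryParam K θ - z) := by
    intro θ
    simp only [hk]
    rcases le_total ‖Complex.exp (θ * Complex.I) - Complex.exp (θ₀ * Complex.I)‖ (η / 2) with hle | hle
    · rw [cutoff_eq_one hη hle]
      simp
    · have e1 := hsep θ θ₀ hle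
      have e2 := norm_add_le (bdryParam K θ - z) (z - bdryParam K θ₀)
      rw [sub_add_sub_cancel] at e2
      have e3 : d ≤ ‖bdryParam K θ - z‖ := by linarith
      have hne := h.bdryParam_sub_ne_zero hz θ
      have hcn : (starRingEnd ℂ) (bdryParam K θ - z) ≠ 0 := (map_ne_zero _).2 hne
      rw [max_eq_left (by gcongr)]
      push_cast
      rw [← Complex.mul_conj', mul_div_mul_right _ _ hcn]
  clear_value k
  have key : ∀ θ : ℝ, ((1 - cutoff η
          ‖Complex.exp (θ * Complex.I) - Complex.exp (θ₀ * Complex.I)‖ : ℝ) : ℂ) *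
          (Q.eval (Complex.exp (θ * Complex.I)) / Complex.exp (θ * Complex.I) ^ n *
          ((b θ / (bdryParam K θ - z)).im : ℂ)) =
      (2 * Complex.I)⁻¹ * (k (θ₀, z) θ * Q.eval (Complex.exp (θ * Complex.I)) * b θ /
          Complex.exp (θ * Complex.I) ^ n) - (2 * Complex.I)⁻¹ *
        ((starRingEnd ℂ) (k (θ₀, z) θ) * Q.eval (Complex.exp (θ * Complex.I)) *
          (starRingEnd ℂ) (b θ) / Complex.exp (θ * Complex.I) ^ n) := by
    intro θ
    rw [hk', Complex.im_eq_sub_conj, map_div₀, map_div₀, Complex.conj_ofReal]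
    field_simp
  have hi : ∀ (u f : ℝ → ℂ), Continuous u → IntervalIntegrable f volume 0 (2 * Real.pi) →
      IntervalIntegrable (fun θ : ℝ => (2 * Complex.I)⁻¹ * (u θ * Q.eval (Complex.exp (θ * Complex.I))
        * f θ / Complex.exp (θ * Complex.I) ^ n)) volume 0 (2 * Real.pi) := by
    intro u f hu hf
    have hQ' : Continuous fun θ : ℝ => Q.eval (Complex.exp (θ * Complex.I)) :=
      Q.continuous.comp (by fun_prop)
    have h2 : Continuous fun θ : ℝ => u θ * Q.eval (Complex.exp (θ * Complex.I)) /
        Complex.exp (θ * Complex.I) ^ n :=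
      Continuous.div (hu.mul hQ') (by fun_prop) fun θ => pow_ne_zero _ (Complex.exp_ne_zero _)
    have h3 := (hf.continuousOn_mul h2.continuousOn).const_mul (2 * Complex.I)⁻¹
    refine h3.congr fun θ _ => ?_
    ring
  have hkx : Continuous (k (θ₀, z)) :=
    hkc.comp (by fun_prop : Continuous fun θ : ℝ => ((θ₀, z), θ))
  have i1 := hi (k (θ₀, z)) b hkx (hb.int _ _)
  have i2 := hi (fun θ => (starRingEnd ℂ) (k (θ₀, z) θ)) (fun θ => (starRingEnd ℂ) (b θ))
    (Complex.continuous_conj.comp hkx) hbc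
  rw [intervalIntegral.integral_congr fun θ _ => key θ, intervalIntegral.integral_sub i1 i2,
    intervalIntegral.integral_const_mul, intervalIntegral.integral_const_mul]
  have e1 := hn₁ _ hmem
  have e2 := hn₂ _ hmem
  have e3 : ‖(2 * Complex.I)⁻¹‖ = 1 / 2 := by simp
  refine (norm_sub_le _ _).trans ?_
  rw [norm_mul, norm_mul, e3]
  linarith

end Far

section Near
variable {Γ : Set ℂ} {c : ℝ} {K : ℂ → ℂ} {b : ℝ → ℂ}

lemma ContDiscMap.intervalIntegrable_abs_im (h : ContDiscMap Γ c K) (hb : IsBdryDeriv K b) {z : ℂ}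
    (hz : z ∉ Γ) (s t : ℝ) :
    IntervalIntegrable (fun θ => |(b θ / (bdryParam K θ - z)).im|) volume s t := by
  have hbi := h.intervalIntegrable_div hb hz s t
  have : IntervalIntegrable (fun θ => (b θ / (bdryParam K θ - z)).im) volume s t :=
    ⟨hbi.1.im, hbi.2.im⟩
  exact this.abs

lemma setIntegral_le_sum {ι : Type} [Fintype ι] {f : ℝ → ℝ} (hf : ∀ x, 0 ≤ f x) {S : Set ℝ}
    (hS : MeasurableSet S) {T : ι → Set ℝ} (hT : ∀ i, MeasurableSet (T i)) (hST : S ⊆ ⋃ i, T i)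
    (hSi : IntegrableOn f S) (hTi : ∀ i, IntegrableOn f (T i)) :
    ∫ x in S, f x ≤ ∑ i, ∫ x in T i, f x := by
  rw [← integral_indicator hS]
  simp_rw [← integral_indicator (hT _)]
  rw [← integral_finsetSum _ fun i _ => (integrable_indicator_iff (hT i)).2 (hTi i)]
  refine integral_mono ((integrable_indicator_iff hS).2 hSi)
    (integrable_finsetSum _ fun i _ => (integrable_indicator_iff (hT i)).2 (hTi i)) fun x => ?_
  have h0 : ∀ i ∈ Finset.univ, 0 ≤ (T i).indicator f x := fun i _ => indicator_nonneg (fun y _ => hf y) x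
  by_cases hx : x ∈ S
  · obtain ⟨i, hi⟩ := mem_iUnion.1 (hST hx)
    have h1 := Finset.single_le_sum h0 (Finset.mem_univ i)
    rw [indicator_of_mem hi] at h1
    rw [indicator_of_mem hx]
    exact h1
  · rw [indicator_of_notMem hx]
    exact Finset.sum_nonneg h0

/-- The variation of the argument along the curve is bounded uniformly in the base point. -/
lemma ContDiscMap.exists_variation_bound (h : ContDiscMap Γ c K)
    (hΓ : IsPiecewiseDiniSmoothJordanCurve Γ) (hb : IsBdryDeriv K b) (M : ℝ) :
    ∃ V : ℝ, 0 ≤ V ∧ ∀ z ∉ Γ, ∀ s t, -M ≤ s → s ≤ t → t ≤ M →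
      ∫ θ in s..t, |(b θ / (bdryParam K θ - z)).im| ≤ V := by
  obtain ⟨ι, _, P, hP⟩ := h.exists_pieces hΓ M
  choose V hV0 hV using fun i => (P i).arc.exists_variation_bound
  refine ⟨∑ i, V i, Finset.sum_nonneg fun i _ => hV0 i, fun z hz s t hs hst ht => ?_⟩
  have hle : ∀ i, (P i).τ (P i).a ≤ (P i).τ (P i).b := fun i =>
    (P i).τ_mono.monotoneOn (P i).left_mem (P i).right_mem (P i).arc.lt.le
  have hi := fun s t => h.intervalIntegrable_abs_im hb hz s t
  rw [intervalIntegral.integral_of_le hst]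
  refine (setIntegral_le_sum (T := fun i => Icc ((P i).τ (P i).a) ((P i).τ (P i).b))
    (fun _ => abs_nonneg _) measurableSet_Ioc (fun _ => measurableSet_Icc) (fun θ hθ => ?_)
    (hi s t).1 fun i => ?_).trans (Finset.sum_le_sum fun i _ => ?_)
  · exact mem_iUnion.2 (hP θ ⟨by linarith [hθ.1], by linarith [hθ.2]⟩)
  · exact (intervalIntegrable_iff_integrableOn_Icc_of_le (hle i)).1 (hi _ _)
  · rw [integral_Icc_eq_integral_Ioc, ← intervalIntegral.integral_of_le (hle i)]
    refine ((P i).integral_abs_im_le h hb hz (P i).left_mem (P i).right_mem (P i).arc.lt.le).trans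
      (hV i z fun u hu => ?_)
    rw [← (P i).β_τ u hu]
    exact h.bdryParam_sub_ne_zero hz _

/-- The weighted variation of the argument over a short window around the foot point. -/
lemma Piece.eventually_window (P : Piece K) (h : ContDiscMap Γ c K)
    (hΓ : IsPiecewiseDiniSmoothJordanCurve Γ) (hb : IsBdryDeriv K b) {Q : Polynomial ℂ} {ε : ℝ}
    (hε : 0 < ε) (hQ : ∀ x : ℂ, ‖x‖ = 1 → ‖Q.eval x‖ ≤ 1 + ε)
    (hQa : Q.eval (Complex.exp (P.τ P.a * Complex.I)) = 0)
    (hQb : Q.eval (Complex.exp (P.τ P.b * Complex.I)) = 0) :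
    ∀ᶠ η in 𝓝[>] (0 : ℝ), ∀ θ₀ ∈ Ioo (P.τ P.a) (P.τ P.b), θ₀ ∈ Icc 0 (2 * Real.pi) → ∀ t : ℝ,
      t ≠ 0 → P.γ (P.σ θ₀) + t * Complex.I * P.γ' (P.σ θ₀) ∉ Γ →
      ∫ θ in θ₀ - η..θ₀ + η, ‖Q.eval (Complex.exp (θ * Complex.I))‖ *
        |(b θ / (bdryParam K θ - (P.γ (P.σ θ₀) + t * Complex.I * P.γ' (P.σ θ₀)))).im| ≤
          (1 + ε) * (Real.pi + ε) := by
  have hpi := Real.pi_gt_three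
  obtain ⟨V, hV0, hV⟩ := h.exists_variation_bound hΓ hb (4 * Real.pi)
  obtain ⟨δ, hδ, hnear⟩ := P.arc.exists_near_bound hε
  have hσu := (isCompact_Icc (a := P.τ P.a) (b := P.τ P.b)).uniformContinuousOn_of_continuous
    P.σ_cont.continuousOn
  obtain ⟨η₁, hη₁, hση⟩ := Metric.uniformContinuousOn_iff.1 hσu δ hδ
  have hQc : Continuous fun θ : ℝ => ‖Q.eval (Complex.exp (θ * Complex.I))‖ :=
    (Q.continuous.comp (by fun_prop : Continuous fun θ : ℝ => Complex.exp (θ * Complex.I))).norm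
  have hcor : ∀ p : ℝ, Q.eval (Complex.exp (p * Complex.I)) = 0 → ∃ ρ > 0, ∀ θ : ℝ, |θ - p| < ρ →
      ‖Q.eval (Complex.exp (θ * Complex.I))‖ ≤ 1 / (V + 1) := by
    intro p hp
    obtain ⟨ρ, hρ, hρ'⟩ := Metric.continuous_iff.1 hQc p (1 / (V + 1)) (by positivity)
    refine ⟨ρ, hρ, fun θ hθ => ?_⟩
    have := hρ' θ hθ
    rw [hp, norm_zero, dist_zero_right, norm_norm] at this
    exact this.le
  obtain ⟨ρ₁, hρ₁, hc₁⟩ := hcor _ hQa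
  obtain ⟨ρ₂, hρ₂, hc₂⟩ := hcor _ hQb
  have hmin : 0 < min (min η₁ Real.pi) (min (ρ₁ / 2) (ρ₂ / 2)) := by positivity
  filter_upwards [Ioo_mem_nhdsGT hmin] with η ⟨hη, hηlt⟩ θ₀ hθ₀ hθ₀' t ht hz
  obtain ⟨⟨l1, l2⟩, l3, l4⟩ := (lt_min_iff.1 hηlt).imp lt_min_iff.1 lt_min_iff.1
  set z := P.γ (P.σ θ₀) + t * Complex.I * P.γ' (P.σ θ₀) with hzd
  have hI := fun s t => h.intervalIntegrable_abs_im hb hz s t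
  have hIQ := fun s t => (hI s t).continuousOn_mul hQc.continuousOn
  have hle : θ₀ - η ≤ θ₀ + η := by linarith
  have bound : ∀ (B W : ℝ), 0 ≤ B → (∀ θ ∈ Icc (θ₀ - η) (θ₀ + η),
      ‖Q.eval (Complex.exp (θ * Complex.I))‖ ≤ B) →
      (∫ θ in θ₀ - η..θ₀ + η, |(b θ / (bdryParam K θ - z)).im|) ≤ W →
      ∫ θ in θ₀ - η..θ₀ + η, ‖Q.eval (Complex.exp (θ * Complex.I))‖ *
        |(b θ / (bdryParam K θ - z)).im| ≤ B * W := by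
    intro B W hB hQB hW
    refine (intervalIntegral.integral_mono_on hle (hIQ _ _) ((hI _ _).const_mul B) fun θ hθ =>
      mul_le_mul_of_nonneg_right (hQB θ hθ) (abs_nonneg _)).trans ?_
    rw [intervalIntegral.integral_const_mul]
    exact mul_le_mul_of_nonneg_left hW hB
  have corner : ∀ p ρ : ℝ, (∀ θ : ℝ, |θ - p| < ρ →
      ‖Q.eval (Complex.exp (θ * Complex.I))‖ ≤ 1 / (V + 1)) → |θ₀ - p| ≤ η → η < ρ / 2 →
      ∫ θ in θ₀ - η..θ₀ + η, ‖Q.eval (Complex.exp (θ * Complex.I))‖ *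
        |(b θ / (bdryParam K θ - z)).im| ≤ (1 + ε) * (Real.pi + ε) := by
    intro p ρ hρ hp hηρ
    have h1 := bound (1 / (V + 1)) V (by positivity) (fun θ hθ => hρ θ ?_)
      (hV z hz _ _ (by linarith [hθ₀'.1]) hle (by linarith [hθ₀'.2]))
    · have h2 : 1 / (V + 1) * V ≤ 1 := by
        rw [one_div_mul_eq_div, div_le_one (by positivity)]
        linarith
      nlinarith
    · rw [abs_le] at hp
      rw [abs_lt]
      constructor <;> linarith [hθ.1, hθ.2]
  by_cases h1 : P.τ P.a ≤ θ₀ - η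
  swap
  · exact corner _ _ hc₁ (by rw [abs_le]; constructor <;> linarith [hθ₀.1]) l3
  by_cases h2 : θ₀ + η ≤ P.τ P.b
  swap
  · exact corner _ _ hc₂ (by rw [abs_le]; constructor <;> linarith [hθ₀.2]) l4
  have m₀ := Ioo_subset_Icc_self hθ₀
  have m₁ : θ₀ - η ∈ Icc (P.τ P.a) (P.τ P.b) := ⟨h1, by linarith⟩
  have m₂ : θ₀ + η ∈ Icc (P.τ P.a) (P.τ P.b) := ⟨by linarith, h2⟩
  have d₁ : |P.σ (θ₀ - η) - P.σ θ₀| ≤ δ := (hση _ m₁ _ m₀ (by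
    rw [Real.dist_eq, sub_sub_cancel_left, abs_neg, abs_of_pos hη]; exact l1)).le
  have d₂ : |P.σ (θ₀ + η) - P.σ θ₀| ≤ δ := (hση _ m₂ _ m₀ (by
    rw [Real.dist_eq, add_sub_cancel_left, abs_of_pos hη]; exact l1)).le
  have h3 := P.integral_abs_im_le h hb hz (P.σ_mem (θ₀ - η)) (P.σ_mem (θ₀ + η)) (P.σ_mono hle)
  rw [P.τ_σ _ m₁, P.τ_σ _ m₂] at h3
  have h4 := (hnear _ (P.σ_mem θ₀) _ (P.σ_mem (θ₀ - η)) _ (P.σ_mem (θ₀ + η)) (P.σ_mono hle) d₁ d₂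
    t ht).2
  exact bound _ _ (by positivity) (fun θ _ => hQ _ (exp_norm_one θ)) (h3.trans h4)

end Near

section Final
variable {Γ : Set ℂ} {c : ℝ} {K : ℂ → ℂ} {b : ℝ → ℂ}

lemma cutoff_norm_exp_sub_eq_zero {η θ θ₀ : ℝ} (hη : 0 < η) (h : η ≤ |θ - θ₀|)
    (hθ : |θ - θ₀| ≤ Real.pi) : cutoff (2 / Real.pi * η)
      ‖Complex.exp (θ * Complex.I) - Complex.exp (θ₀ * Complex.I)‖ = 0 := by
  have hpi := Real.pi_pos
  refine cutoff_eq_zero (by positivity) ((mul_le_mul_of_nonneg_left h ?_).trans (le_norm_exp_sub hθ))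
  positivity

lemma ContDiscMap.norm_integral_cutoff_le (h : ContDiscMap Γ c K) (hb : IsBdryDeriv K b)
    (Q : Polynomial ℂ) (n : ℕ) {z : ℂ} (hz : z ∉ Γ) {η : ℝ} (hη : 0 < η) (hηpi : η ≤ Real.pi)
    (θ₀ : ℝ) :
    ‖∫ θ in (0 : ℝ)..2 * Real.pi, ((cutoff (2 / Real.pi * η)
        ‖Complex.exp (θ * Complex.I) - Complex.exp (θ₀ * Complex.I)‖ : ℝ) : ℂ) *
        (Q.eval (Complex.exp (θ * Complex.I)) / Complex.exp (θ * Complex.I) ^ n *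
        ((b θ / (bdryParam K θ - z)).im : ℂ))‖ ≤
      ∫ θ in θ₀ - η..θ₀ + η, ‖Q.eval (Complex.exp (θ * Complex.I))‖ *
        |(b θ / (bdryParam K θ - z)).im| := by
  set κ : ℝ → ℝ := fun θ => cutoff (2 / Real.pi * η)
    ‖Complex.exp (θ * Complex.I) - Complex.exp (θ₀ * Complex.I)‖ with hκ
  set G : ℝ → ℝ := fun θ => ‖Q.eval (Complex.exp (θ * Complex.I))‖ *
        |(b θ / (bdryParam K θ - z)).im| with hG
  have hQc : Continuous fun θ : ℝ => ‖Q.eval (Complex.exp (θ * Complex.I))‖ :=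
    (Q.continuous.comp (by fun_prop : Continuous fun θ : ℝ => Complex.exp (θ * Complex.I))).norm
  have hκc : Continuous κ := (continuous_cutoff _).comp (by fun_prop)
  have hGi : ∀ s t, IntervalIntegrable G volume s t := fun s t =>
    (h.intervalIntegrable_abs_im hb hz s t).continuousOn_mul hQc.continuousOn
  have hG0 : ∀ θ, 0 ≤ G θ := fun θ => by positivity
  have hκG : ∀ s t, IntervalIntegrable (fun θ => κ θ * G θ) volume s t := fun s t =>
    (hGi s t).continuousOn_mul hκc.continuousOn
  have hper : ∀ θ : ℝ, Complex.exp (((θ + 2 * Real.pi : ℝ) : ℂ) * Complex.I) =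
      Complex.exp (θ * Complex.I) := fun θ => exp_add_two_pi_mul_I θ
  have hκper : Function.Periodic (fun θ => κ θ * G θ) (2 * Real.pi) := fun θ => by
    simp only [hκ, hG, hper, hb.periodic θ, bdryParam_periodic K θ]
  have e1 : ∫ θ in (0 : ℝ)..2 * Real.pi, κ θ * G θ =
      ∫ θ in θ₀ - Real.pi..θ₀ + Real.pi, κ θ * G θ := by
    have := hκper.intervalIntegral_add_eq 0 (θ₀ - Real.pi)
    rw [zero_add] at this
    rw [this]
    congr 1
    ring
  have e2 : ∫ θ in θ₀ - Real.pi..θ₀ + Real.pi, κ θ * G θ = ∫ θ in θ₀ - η..θ₀ + η, κ θ * G θ := by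
    rw [intervalIntegral.integral_of_le (by linarith), intervalIntegral.integral_of_le (by linarith)]
    refine setIntegral_eq_of_subset_of_forall_sdiff_eq_zero measurableSet_Ioc
      (Ioc_subset_Ioc (by linarith) (by linarith)) fun θ hθ => ?_
    have h1 : |θ - θ₀| ≤ Real.pi := abs_le.2 ⟨by linarith [hθ.1.1], by linarith [hθ.1.2]⟩
    have h2 : η ≤ |θ - θ₀| := by
      by_contra! h2
      rw [abs_lt] at h2
      exact hθ.2 ⟨by linarith, by linarith⟩
    simp only [hκ, cutoff_norm_exp_sub_eq_zero hη h2 h1, zero_mul]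
  refine (intervalIntegral.norm_integral_le_of_norm_le Real.two_pi_pos.le
    (Eventually.of_forall fun θ _ => ?_) (hκG _ _)).trans ?_
  · rw [norm_mul, norm_mul, norm_div, norm_pow, exp_norm_one, one_pow, div_one, Complex.norm_real,
      Complex.norm_real, Real.norm_eq_abs, Real.norm_eq_abs, abs_of_nonneg (cutoff_nonneg _ _)]
  · rw [e1, e2]
    exact intervalIntegral.integral_mono_on (by linarith) (hκG _ _) (hGi _ _) fun θ _ =>
      mul_le_of_le_one_left (hG0 θ) (cutoff_le_one _ _)

/-- Polynomials with prescribed leading coefficient and nearly optimal norm on the curve. -/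
lemma ContDiscMap.eventually_exists_polynomial (h : ContDiscMap Γ c K)
    (hΓ : IsPiecewiseDiniSmoothJordanCurve Γ) (hb : IsBdryDeriv K b) {ε : ℝ} (hε : 0 < ε) :
    ∀ᶠ n : ℕ in atTop, ∃ P : Polynomial ℂ, P.natDegree ≤ n ∧ P.coeff n = 1 / c ^ n ∧
      ∀ z ∈ Γ, Real.pi * ‖P.eval z‖ ≤ (1 + ε) * (Real.pi + ε) + ε := by
  have hpi := Real.pi_pos
  obtain ⟨ι, _, P, hP⟩ := h.exists_pieces hΓ (2 * Real.pi)
  set S : Set ℝ := (range fun i => (P i).τ (P i).a) ∪ range fun i => (P i).τ (P i).b with hS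
  have hSf : S.Finite := (finite_range _).union (finite_range _)
  obtain ⟨Q, hQ0, hQS, hQ⟩ := exists_peak_polynomial_finset hSf.toFinset hε
  obtain ⟨η, hwin, hη, hηpi⟩ := ((eventually_all.2 fun i => (P i).eventually_window h hΓ hb hε hQ
    (hQS _ (hSf.mem_toFinset.2 (Or.inl ⟨i, rfl⟩)))
    (hQS _ (hSf.mem_toFinset.2 (Or.inr ⟨i, rfl⟩)))).and (Ioc_mem_nhdsGT hpi)).exists
  obtain ⟨d, hd, hfar⟩ := h.exists_far_bound hb Q (by positivity : 0 < 2 / Real.pi * η) hε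
  filter_upwards [hfar, eventually_gt_atTop Q.natDegree] with n hn hQn
  obtain ⟨R, hRn, hRc, hR⟩ := h.exists_faber hb Q hQn
  refine ⟨R, hRn, by rw [hRc, hQ0], ?_⟩
  set B := (1 + ε) * (Real.pi + ε) + ε with hB
  have inside : ∀ i, ∀ θ₀ ∈ Ioo ((P i).τ (P i).a) ((P i).τ (P i).b), θ₀ ∈ Icc 0 (2 * Real.pi) →
      ∀ t : ℝ, t ≠ 0 → ∀ z, z = (P i).γ ((P i).σ θ₀) + t * Complex.I * (P i).γ' ((P i).σ θ₀) →
      z ∉ Γ → z ∉ exteriorDomain Γ → ‖z - bdryParam K θ₀‖ ≤ d → Real.pi * ‖R.eval z‖ ≤ B := by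
    rintro i θ₀ hθ₀ hθ₀' t ht z hzd hz hz' hzn
    have h1 : Real.pi * ‖R.eval z‖ = ‖(Real.pi : ℂ) * R.eval z‖ := by
      rw [norm_mul, Complex.norm_real, Real.norm_of_nonneg hpi.le]
    have h2 := hwin i θ₀ hθ₀ hθ₀' t ht (hzd ▸ hz)
    rw [← hzd] at h2
    have h3 := (h.norm_integral_cutoff_le hb Q n hz hη hηpi θ₀).trans h2
    have h4 := hn θ₀ hθ₀' z hz hzn
    have hQe : Continuous fun θ : ℝ =>
        Q.eval (Complex.exp (θ * Complex.I)) / Complex.exp (θ * Complex.I) ^ n :=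
      Continuous.div (Q.continuous.comp (by fun_prop)) (by fun_prop)
        fun θ => pow_ne_zero _ (Complex.exp_ne_zero _)
    have hbi := h.intervalIntegrable_div hb hz 0 (2 * Real.pi)
    have hbim : IntervalIntegrable (fun θ => (((b θ / (bdryParam K θ - z)).im : ℝ) : ℂ)) volume 0
        (2 * Real.pi) := ⟨hbi.1.im.ofReal, hbi.2.im.ofReal⟩
    have hF := hbim.continuousOn_mul hQe.continuousOn
    have hκc : Continuous fun θ : ℝ => ((cutoff (2 / Real.pi * η)
        ‖Complex.exp (θ * Complex.I) - Complex.exp (θ₀ * Complex.I)‖ : ℝ) : ℂ) :=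
      Complex.continuous_ofReal.comp ((continuous_cutoff _).comp (by fun_prop))
    have hκc' : Continuous fun θ : ℝ => ((1 - cutoff (2 / Real.pi * η)
        ‖Complex.exp (θ * Complex.I) - Complex.exp (θ₀ * Complex.I)‖ : ℝ) : ℂ) :=
      Complex.continuous_ofReal.comp (continuous_const.sub ((continuous_cutoff _).comp (by fun_prop)))
    rw [h1, hR z hz hz', norm_neg]
    refine le_trans (le_of_eq ?_) ((norm_add_le _ _).trans (add_le_add h3 h4))
    rw [← intervalIntegral.integral_add (hF.continuousOn_mul hκc.continuousOn)
      (hF.continuousOn_mul hκc'.continuousOn)]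
    congr 1
    refine intervalIntegral.integral_congr fun θ _ => ?_
    push_cast
    ring
  have regular : ∀ θ₀ ∈ Ioo 0 (2 * Real.pi) ∩ Sᶜ, Real.pi * ‖R.eval (bdryParam K θ₀)‖ ≤ B := by
    rintro θ₀ ⟨hθ₀', hθS⟩
    obtain ⟨i, hi⟩ := hP θ₀ ⟨by linarith [hθ₀'.1], hθ₀'.2.le⟩
    have hi' : θ₀ ∈ Ioo ((P i).τ (P i).a) ((P i).τ (P i).b) :=
      ⟨lt_of_le_of_ne hi.1 fun h1 => hθS (Or.inl ⟨i, h1⟩),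
        lt_of_le_of_ne hi.2 fun h1 => hθS (Or.inr ⟨i, h1.symm⟩)⟩
    obtain ⟨τ₀, hτ₀, hins⟩ := (P i).exists_inside h hb hi'
    have hβ := (P i).β_eq hi
    by_contra! hlt
    have hRc : Continuous fun z => Real.pi * ‖R.eval z‖ := continuous_const.mul R.continuous.norm
    obtain ⟨ρ, hρ, hρ'⟩ := Metric.eventually_nhds_iff.1
      (hRc.continuousAt.eventually (lt_mem_nhds hlt))
    set g := ‖(P i).γ' ((P i).σ θ₀)‖ with hg
    have hg0 : 0 ≤ g := norm_nonneg _
    set τ := min (τ₀ / 2) (min (d / (g + 1)) (ρ / 2 / (g + 1))) with hτd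
    have hτ : 0 < τ := by positivity
    have hτ1 : τ < τ₀ := (min_le_left _ _).trans_lt (by linarith)
    have hτ2 : τ * g ≤ d := by
      have h5 : τ ≤ d / (g + 1) := (min_le_right _ _).trans (min_le_left _ _)
      rw [le_div_iff₀ (by positivity)] at h5
      linarith
    have hτ3 : τ * g < ρ := by
      have h5 : τ ≤ ρ / 2 / (g + 1) := (min_le_right _ _).trans (min_le_right _ _)
      rw [le_div_iff₀ (by positivity)] at h5
      linarith
    obtain ⟨t, ht, hz, hz'⟩ := hins τ hτ hτ1
    set z := (P i).γ ((P i).σ θ₀) + t * Complex.I * (P i).γ' ((P i).σ θ₀) with hzd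
    have hzn : ‖z - bdryParam K θ₀‖ = τ * g := by
      rw [hβ, hzd, add_sub_cancel_left, norm_mul, norm_mul, Complex.norm_I, mul_one,
        Complex.norm_real, Real.norm_eq_abs, ht]
    have ht0 : t ≠ 0 := by
      rintro rfl
      rw [abs_zero] at ht
      exact hτ.ne ht
    have h6 := inside i θ₀ hi' (Ioo_subset_Icc_self hθ₀') t ht0 z hzd hz hz' (by rw [hzn]; exact hτ2)
    have h7 := hρ' (y := z) (by rw [dist_eq_norm, hzn]; exact hτ3)
    linarith
  intro z hz
  rw [← h.range_bdryParam] at hz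
  obtain ⟨θ', rfl⟩ := hz
  obtain ⟨θ, hθ, hθθ'⟩ := (bdryParam_periodic K).exists_mem_Ico₀ Real.two_pi_pos θ'
  rw [hθθ']
  have hclosed : IsClosed {θ : ℝ | Real.pi * ‖R.eval (bdryParam K θ)‖ ≤ B} :=
    isClosed_le (continuous_const.mul (R.continuous.comp h.continuous_bdryParam).norm)
      continuous_const
  have h8 : Ioo 0 (2 * Real.pi) ⊆ {θ : ℝ | Real.pi * ‖R.eval (bdryParam K θ)‖ ≤ B} :=
    ((hSf.countable.dense_compl ℝ).open_subset_closure_inter isOpen_Ioo).trans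
      (closure_minimal regular hclosed)
  have h9 := closure_minimal h8 hclosed
  rw [closure_Ioo Real.two_pi_pos.ne] at h9
  exact h9 (Ico_subset_Icc_self hθ)

lemma norm_le_supNorm (hΓ : IsCompact Γ) (P : Polynomial ℂ) {z : ℂ} (hz : z ∈ Γ) :
    ‖P.eval z‖ ≤ supNorm Γ fun z => P.eval z :=
  le_csSup (hΓ.image_of_continuousOn P.continuous.norm.continuousOn).bddAbove ⟨z, hz, rfl⟩

lemma ContDiscMap.one_le_widom (h : ContDiscMap Γ c K) {n : ℕ} {T : Polynomial ℂ}
    (hT : IsChebyshevPoly Γ n T) : 1 ≤ supNorm Γ (fun z => T.eval z) / c ^ n := by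
  rw [le_div_iff₀ (pow_pos h.cpos n), one_mul]
  have := h.norm_coeff_mul_pow_le hT.2.1.le fun z hz => norm_le_supNorm h.compact T hz
  rwa [← hT.2.1, hT.1.coeff_natDegree, norm_one, one_mul, hT.2.1] at this

lemma ContDiscMap.widom_le (h : ContDiscMap Γ c K) {n : ℕ} {T P : Polynomial ℂ} {B : ℝ}
    (hT : IsChebyshevPoly Γ n T) (hPn : P.natDegree ≤ n) (hPc : P.coeff n = 1 / c ^ n)
    (hPB : ∀ z ∈ Γ, ‖P.eval z‖ ≤ B) : supNorm Γ (fun z => T.eval z) / c ^ n ≤ B := by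
  have hc : 0 < c ^ n := pow_pos h.cpos n
  have hcc : (c : ℂ) ^ n ≠ 0 := pow_ne_zero _ (by exact_mod_cast h.cpos.ne')
  have hcoeff : (Polynomial.C ((c : ℂ) ^ n) * P).coeff n = 1 := by
    rw [Polynomial.coeff_C_mul, hPc, mul_one_div_cancel hcc]
  have hdeg : (Polynomial.C ((c : ℂ) ^ n) * P).natDegree ≤ n :=
    (Polynomial.natDegree_C_mul_le _ _).trans hPn
  have hmonic := Polynomial.monic_of_natDegree_le_of_coeff_eq_one n hdeg hcoeff
  have hdeg' : (Polynomial.C ((c : ℂ) ^ n) * P).natDegree = n :=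
    le_antisymm hdeg (Polynomial.le_natDegree_of_ne_zero (by rw [hcoeff]; exact one_ne_zero))
  rw [div_le_iff₀ hc]
  refine (hT.2.2 _ hmonic hdeg').trans ?_
  refine csSup_le (h.nonempty.image _) ?_
  rintro _ ⟨z, hz, rfl⟩
  simp only [Polynomial.eval_mul, Polynomial.eval_C, norm_mul, norm_pow, Complex.norm_real,
    Real.norm_of_nonneg h.cpos.le]
  rw [mul_comm]
  exact mul_le_mul_of_nonneg_right (hPB z hz) hc.le

end Final

theorem tendsto_supNorm_div_pow {Γ : Set ℂ} {φ : ℂ → ℂ} {c : ℝ}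
    {T : ℕ → Polynomial ℂ} (hΓ : IsPiecewiseDiniSmoothJordanCurve Γ) (hφ : IsExteriorMap Γ φ c)
    (hT : ∀ n, IsChebyshevPoly Γ n (T n)) :
    Tendsto (fun n => supNorm Γ (fun z => (T n).eval z) / c ^ n) atTop (nhds 1) := by
  obtain ⟨K₀, hK₀⟩ := exists_discMap (IsJordanCurve.isCompact hΓ.1) hφ
  obtain ⟨K, h⟩ := hK₀.exists_contDiscMap hΓ.1
  obtain ⟨b, hb⟩ := h.exists_isBdryDeriv hΓ
  have hpi := Real.pi_pos
  refine tendsto_order.2 ⟨fun x hx => Eventually.of_forall fun n => hx.trans_le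
    (h.one_le_widom (hT n)), fun x hx => ?_⟩
  have hlim : Tendsto (fun ε : ℝ => ((1 + ε) * (Real.pi + ε) + ε) / Real.pi) (𝓝[>] 0) (𝓝 1) := by
    have : Continuous fun ε : ℝ => ((1 + ε) * (Real.pi + ε) + ε) / Real.pi := by fun_prop
    have h1 := this.tendsto 0
    simp only [add_zero, one_mul, div_self hpi.ne'] at h1
    exact h1.mono_left nhdsWithin_le_nhds
  obtain ⟨ε, hεx, hε⟩ := ((hlim.eventually_lt_const hx).and self_mem_nhdsWithin).exists
  filter_upwards [h.eventually_exists_polynomial hΓ hb hε] with n ⟨P, hPn, hPc, hPB⟩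
  refine (h.widom_le (hT n) hPn hPc fun z hz => ?_).trans_lt hεx
  rw [le_div_iff₀ hpi, mul_comm]
  exact hPB z hz

end Widom

/-- If `Γ` is a piecewise Dini-smooth Jordan curve, then its Widom factors
converge to `1`: `lim_{n→∞} ‖T_n‖_Γ / cap(Γ)^n = 1`, where `T_n` is the `n`-th Chebyshev
polynomial of `Γ` and `c = cap(Γ)` is its logarithmic capacity (characterized by the canonical
exterior conformal map `φ`). -/
theorem chebyshev_widom_factors_tendsto_one
    (Γ : Set ℂ) (φ : ℂ → ℂ) (c : ℝ) (T : ℕ → Polynomial ℂ)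
    (hΓ : IsPiecewiseDiniSmoothJordanCurve Γ)
    (hφ : IsExteriorMap Γ φ c)
    (hT : ∀ n : ℕ, IsChebyshevPoly Γ n (T n)) :
    Filter.Tendsto (fun n : ℕ => supNorm Γ (fun z => (T n).eval z) / c ^ n)
      Filter.atTop (nhds 1) := by
  exact Widom.tendsto_supNorm_div_pow hΓ hφ hT

end
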